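/- Let h be a weak solution of the gravity water-wave problem (no periodicity in q is assumed). Then for every m ∈ ℕ the iterated partial derivative ∂_q^m h exists on Ω̄ and belongs to C^{1+α}(Ω̄); moreover there exists a constant L > 1 such that ‖∂_q^m h‖_{1+α} ≤ L^{m−2}·(m−3)! for every integer m ≥ 3. -/

import Mathlib

open MeasureTheory Set Real Filter

noncomputable section

/-- The closed strip `Ω̄ = ℝ × [p₀, 0]`. -/
def Obar (p₀ : ℝ) : Set (ℝ × ℝ) := Set.univ ×ˢ Set.Icc p₀ 0

/-- The open strip `Ω = ℝ × (p₀, 0)`. -/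
def Oset (p₀ : ℝ) : Set (ℝ × ℝ) := Set.univ ×ˢ Set.Ioo p₀ 0

/-- Partial derivative in the horizontal variable `q`. -/
def pd_q (f : ℝ × ℝ → ℝ) : ℝ × ℝ → ℝ := fun x => deriv (fun q => f (q, x.2)) x.1

/-- Partial derivative in the vertical variable `p` (within `[p₀, 0]`). -/
def pd_p (p₀ : ℝ) (f : ℝ × ℝ → ℝ) : ℝ × ℝ → ℝ :=
  fun x => derivWithin (fun p => f (x.1, p)) (Set.Icc p₀ 0) x.2

/-- Iterated partial derivative `∂_q^m`. -/
def pd_q_iter (m : ℕ) (f : ℝ × ℝ → ℝ) : ℝ × ℝ → ℝ := pd_q^[m] f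

/-- Bounded and uniformly `α`-Hölder continuous on `s`: membership in `C^α(s)`. -/
def MemCα (α : ℝ) (s : Set (ℝ × ℝ)) (f : ℝ × ℝ → ℝ) : Prop :=
  (∃ M : ℝ, ∀ x ∈ s, |f x| ≤ M) ∧
  (∃ C : ℝ, ∀ x ∈ s, ∀ y ∈ s, |f x - f y| ≤ C * dist x y ^ α)

/-- Membership in `C^{1+α}(Ω̄)`: continuously differentiable on `Ω̄` with `f`, `∂_q f`, `∂_p f`
bounded and uniformly `α`-Hölder continuous on `Ω̄`. -/
def MemC1α (p₀ α : ℝ) (f : ℝ × ℝ → ℝ) : Prop :=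
  ContDiffOn ℝ 1 f (Obar p₀) ∧ MemCα α (Obar p₀) f ∧
    MemCα α (Obar p₀) (pd_q f) ∧ MemCα α (Obar p₀) (pd_p p₀ f)

/-- Supremum norm on `s`. -/
def supNorm (s : Set (ℝ × ℝ)) (f : ℝ × ℝ → ℝ) : ℝ :=
  sSup {c | ∃ x ∈ s, c = |f x|}

/-- `α`-Hölder seminorm on `s`. -/
def holderSemi (α : ℝ) (s : Set (ℝ × ℝ)) (f : ℝ × ℝ → ℝ) : ℝ :=
  sSup {c | ∃ x ∈ s, ∃ y ∈ s, x ≠ y ∧ c = |f x - f y| / dist x y ^ α}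

/-- The `C^{1+α}(Ω̄)` norm: sup norms and `α`-Hölder seminorms of the function
and of its first-order partial derivatives. -/
def norm1α (p₀ α : ℝ) (f : ℝ × ℝ → ℝ) : ℝ :=
  supNorm (Obar p₀) f + supNorm (Obar p₀) (pd_q f) + supNorm (Obar p₀) (pd_p p₀ f) +
  holderSemi α (Obar p₀) f + holderSemi α (Obar p₀) (pd_q f) +
  holderSemi α (Obar p₀) (pd_p p₀ f)

/-- Test functions: `C¹` with compact support contained in `ℝ × (p₀, 0)`. -/
def IsTest (p₀ : ℝ) (ψ : ℝ × ℝ → ℝ) : Prop :=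
  ContDiff ℝ 1 ψ ∧ HasCompactSupport ψ ∧ tsupport ψ ⊆ Oset p₀

/-- `h` is a weak solution of the gravity water-wave problem \eqref{H}-\eqref{CH}. -/
structure IsWeakSolution (p₀ g Q α : ℝ) (γ : ℝ → ℝ) (h : ℝ × ℝ → ℝ) : Prop where
  reg : MemC1α p₀ α h
  infpos : ∃ δ > 0, ∀ x ∈ Oset p₀, δ ≤ pd_p p₀ h x
  weak : ∀ ψ : ℝ × ℝ → ℝ, IsTest p₀ ψ →
    (∫ x in Oset p₀,
      ((pd_q h x / pd_p p₀ h x) * pd_q ψ x -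
        ((∫ s in (0:ℝ)..x.2, γ s) + (1 + (pd_q h x) ^ 2) / (2 * (pd_p p₀ h x) ^ 2)) *
          pd_p p₀ ψ x)) = 0
  top : ∀ q : ℝ, 1 + (pd_q h (q, 0)) ^ 2 + (2 * g * h (q, 0) - Q) * (pd_p p₀ h (q, 0)) ^ 2 = 0
  bottom : ∀ q : ℝ, h (q, p₀) = 0

end

/-- `f` is bounded by `N` and `α`-Hölder continuous with constant `N` on `s`. -/
def HolderBdd {E : Type*} [SeminormedAddCommGroup E] (α : ℝ) (s : Set (ℝ × ℝ)) (N : ℝ)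
    (f : ℝ × ℝ → E) : Prop :=
  (∀ x ∈ s, ‖f x‖ ≤ N) ∧ ∀ x ∈ s, ∀ y ∈ s, ‖f x - f y‖ ≤ N * dist x y ^ α

section TaylorBounds

open Asymptotics Topology

theorem hasFDerivWithinAt_of_rpow_bound {𝕜 E F : Type*} [NontriviallyNormedField 𝕜]
    [NormedAddCommGroup E] [NormedSpace 𝕜 E] [NormedAddCommGroup F] [NormedSpace 𝕜 F]
    {f : E → F} {L : E →L[𝕜] F} {s : Set E} {x : E} {C α : ℝ} (hα : 0 < α)
    (h : ∀ y ∈ s, ‖f y - f x - L (y - x)‖ ≤ C * ‖y - x‖ ^ α * ‖y - x‖) :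
    HasFDerivWithinAt f L s x := by
  rw [hasFDerivWithinAt_iff_isLittleO, isLittleO_iff]
  intro c hc
  have ht : Filter.Tendsto (fun y : E => C * ‖y - x‖ ^ α) (𝓝[s] x) (𝓝 0) := by
    have : ContinuousAt (fun y : E => C * ‖y - x‖ ^ α) x := by
      have h1 : ContinuousAt (fun y : E => ‖y - x‖) x := by fun_prop
      exact continuousAt_const.mul (h1.rpow_const (Or.inr hα.le))
    have h0 : C * ‖x - x‖ ^ α = 0 := by simp [Real.zero_rpow hα.ne']
    have := this.tendsto
    rw [h0] at this
    exact this.mono_left nhdsWithin_le_nhds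
  filter_upwards [ht.eventually (gt_mem_nhds hc), self_mem_nhdsWithin] with y hy hys
  refine (h y hys).trans ?_
  gcongr

theorem hasDerivWithinAt_of_rpow_bound {𝕜 F : Type*} [NontriviallyNormedField 𝕜]
    [NormedAddCommGroup F] [NormedSpace 𝕜 F]
    {f : 𝕜 → F} {f' : F} {s : Set 𝕜} {x : 𝕜} {C α : ℝ} (hα : 0 < α)
    (h : ∀ y ∈ s, ‖f y - f x - (y - x) • f'‖ ≤ C * ‖y - x‖ ^ α * ‖y - x‖) :
    HasDerivWithinAt f f' s x := by
  rw [hasDerivWithinAt_iff_hasFDerivWithinAt]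
  exact hasFDerivWithinAt_of_rpow_bound hα (by simpa using h)

theorem hasDerivAt_of_rpow_bound {𝕜 F : Type*} [NontriviallyNormedField 𝕜]
    [NormedAddCommGroup F] [NormedSpace 𝕜 F]
    {f : 𝕜 → F} {f' : F} {x : 𝕜} {C α : ℝ} (hα : 0 < α)
    (h : ∀ y, ‖f y - f x - (y - x) • f'‖ ≤ C * ‖y - x‖ ^ α * ‖y - x‖) :
    HasDerivAt f f' x := by
  rw [← hasDerivWithinAt_univ]
  exact hasDerivWithinAt_of_rpow_bound hα fun y _ => h y

theorem Ultrafilter.exists_tendsto_of_norm_le {ι E : Type*} [NormedAddCommGroup E] [ProperSpace E]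
    (U : Ultrafilter ι) {f : ι → E} {M : ℝ} (h : ∀ᶠ i in (U : Filter ι), ‖f i‖ ≤ M) :
    ∃ l, Filter.Tendsto f U (𝓝 l) := by
  have hc : IsCompact (Metric.closedBall (0 : E) M) := isCompact_closedBall 0 M
  obtain ⟨l, -, hl⟩ := hc.ultrafilter_le_nhds (U.map f) (by
    rw [Filter.le_principal_iff]
    change f ⁻¹' Metric.closedBall 0 M ∈ (U : Filter ι)
    refine Filter.mem_of_superset h fun i hi => ?_
    simpa using hi)
  exact ⟨l, hl⟩

theorem norm_sub_sub_smul_le_of_partials {E : Type*} [NormedAddCommGroup E] [NormedSpace ℝ E]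
    {p₀ α K : ℝ} (hα : 0 < α) (hK : 0 ≤ K) {W P R : ℝ × ℝ → E}
    (hq : ∀ x ∈ Obar p₀, HasDerivAt (fun q => W (q, x.2)) (P x) x.1)
    (hp : ∀ x ∈ Obar p₀, HasDerivWithinAt (fun p => W (x.1, p)) (R x) (Set.Icc p₀ 0) x.2)
    (hP : ∀ x ∈ Obar p₀, ∀ y ∈ Obar p₀, ‖P x - P y‖ ≤ K * dist x y ^ α)
    (hR : ∀ x ∈ Obar p₀, ∀ y ∈ Obar p₀, ‖R x - R y‖ ≤ K * dist x y ^ α)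
    {x y : ℝ × ℝ} (hx : x ∈ Obar p₀) (hy : y ∈ Obar p₀) :
    ‖W y - W x - ((y.1 - x.1) • P x + (y.2 - x.2) • R x)‖
      ≤ 2 * K * ‖y - x‖ ^ α * ‖y - x‖ := by
  have hx2 : x.2 ∈ Set.Icc p₀ 0 := hx.2
  have hy2 : y.2 ∈ Set.Icc p₀ 0 := hy.2
  have hsub : ‖y - x‖ = max |y.1 - x.1| |y.2 - x.2| := by
    rw [Prod.norm_def]; simp [Real.norm_eq_abs]
  have h1 : ‖(W (y.1, y.2) - y.1 • P x) - (W (x.1, y.2) - x.1 • P x)‖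
      ≤ (K * ‖y - x‖ ^ α) * ‖y.1 - x.1‖ := by
    refine (convex_uIcc x.1 y.1).norm_image_sub_le_of_norm_hasDerivWithin_le
      (f := fun t => W (t, y.2) - t • P x) (f' := fun t => P (t, y.2) - P x) ?_ ?_
      Set.left_mem_uIcc Set.right_mem_uIcc
    · intro t _
      have := (hq (t, y.2) ⟨trivial, hy2⟩).fun_sub ((hasDerivAt_id t).smul_const (P x))
      simpa using this.hasDerivWithinAt
    · intro t ht
      refine (hP (t, y.2) ⟨trivial, hy2⟩ x hx).trans ?_
      gcongr
      rw [hsub, Prod.dist_eq, Real.dist_eq, Real.dist_eq]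
      exact max_le_max (Set.abs_sub_left_of_mem_uIcc ht) le_rfl
  have h2 : ‖(W (x.1, y.2) - y.2 • R x) - (W (x.1, x.2) - x.2 • R x)‖
      ≤ (K * ‖y - x‖ ^ α) * ‖y.2 - x.2‖ := by
    have hs : Set.uIcc x.2 y.2 ⊆ Set.Icc p₀ 0 := (Set.ordConnected_Icc).uIcc_subset hx2 hy2
    refine (convex_uIcc x.2 y.2).norm_image_sub_le_of_norm_hasDerivWithin_le
      (f := fun t => W (x.1, t) - t • R x) (f' := fun t => R (x.1, t) - R x) ?_ ?_
      Set.left_mem_uIcc Set.right_mem_uIcc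
    · intro t ht
      have := (hp (x.1, t) ⟨trivial, hs ht⟩).fun_sub
        ((hasDerivAt_id t).smul_const (R x)).hasDerivWithinAt
      simpa using this.mono hs
    · intro t ht
      refine (hR (x.1, t) ⟨trivial, hs ht⟩ x hx).trans ?_
      gcongr
      rw [hsub, Prod.dist_eq, Real.dist_eq, Real.dist_eq]
      refine max_le ?_ ?_
      · simp
      · exact (Set.abs_sub_left_of_mem_uIcc ht).trans (le_max_right _ _)
  have e : W y - W x - ((y.1 - x.1) • P x + (y.2 - x.2) • R x) =
      ((W (y.1, y.2) - y.1 • P x) - (W (x.1, y.2) - x.1 • P x)) +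
      ((W (x.1, y.2) - y.2 • R x) - (W (x.1, x.2) - x.2 • R x)) := by
    simp only [Prod.mk.eta, sub_smul]; abel
  rw [e]
  refine (norm_add_le _ _).trans ((add_le_add h1 h2).trans ?_)
  have hn : 0 ≤ K * ‖y - x‖ ^ α := by positivity
  have l1 : ‖y.1 - x.1‖ ≤ ‖y - x‖ := by rw [hsub]; exact le_max_left _ _
  have l2 : ‖y.2 - x.2‖ ≤ ‖y - x‖ := by rw [hsub]; exact le_max_right _ _
  nlinarith

end TaylorBounds

section Liouville

open Topology

theorem eq_of_entire_of_holder {α C : ℝ} (hα0 : 0 < α) (hα1 : α < 1) {G F : ℂ → ℂ}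
    (hG : ∀ z, HasDerivAt G (F z) z)
    (hF : ∀ z, ‖F z - F 0‖ ≤ C * (1 + ‖z‖ ^ α)) (z : ℂ) : F z = F 0 := by
  have hGd : Differentiable ℂ G := fun z => (hG z).differentiableAt
  have hFG : F = deriv G := by ext z; exact (hG z).deriv.symm
  have hFd : Differentiable ℂ F := by
    rw [hFG]
    exact fun z => (hGd.differentiableOn.deriv isOpen_univ).differentiableAt Filter.univ_mem
  have hd : ∀ z, deriv F z = 0 := by
    intro z
    have hb : ∀ R : ℝ, 0 < R → ‖deriv F z‖ ≤ C * (1 + (‖z‖ + R) ^ α) / R := by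
      intro R hR
      have hd' : deriv (fun w => F w - F 0) z = deriv F z := by simp
      rw [← hd']
      refine Complex.norm_deriv_le_of_forall_mem_sphere_norm_le hR
        (hFd.sub_const _).diffContOnCl ?_
      intro w hw
      have hC : 0 ≤ C := by
        have := (norm_nonneg _).trans (hF 0)
        rw [norm_zero, Real.zero_rpow hα0.ne'] at this
        linarith
      refine (hF w).trans ?_
      gcongr
      have : w = z + (w - z) := by ring
      rw [this]
      refine (norm_add_le _ _).trans ?_
      rw [mem_sphere_iff_norm.1 hw]
    have ht : Filter.Tendsto (fun R : ℝ => C * (1 + (‖z‖ + R) ^ α) / R) Filter.atTop (𝓝 0) := by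
      have h1 : Filter.Tendsto (fun R : ℝ => R⁻¹) Filter.atTop (𝓝 0) := tendsto_inv_atTop_zero
      have h2 : Filter.Tendsto (fun R : ℝ => (2 * R) ^ α / R) Filter.atTop (𝓝 0) := by
        have h3 : Filter.Tendsto (fun R : ℝ => (2 : ℝ) ^ α * R ^ (-(1 - α))) Filter.atTop
            (𝓝 ((2 : ℝ) ^ α * 0)) :=
          (tendsto_rpow_neg_atTop (by linarith)).const_mul _
        rw [mul_zero] at h3
        refine h3.congr' ?_
        filter_upwards [Filter.eventually_gt_atTop 0] with R hR
        rw [Real.mul_rpow (by norm_num) hR.le, mul_div_assoc, neg_sub, Real.rpow_sub hR,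
          Real.rpow_one]
      have h4 : Filter.Tendsto (fun R : ℝ => (‖z‖ + R) ^ α / R) Filter.atTop (𝓝 0) := by
        refine squeeze_zero' ?_ ?_ h2
        · filter_upwards [Filter.eventually_gt_atTop 0] with R hR
          positivity
        · filter_upwards [Filter.eventually_gt_atTop 0, Filter.eventually_ge_atTop ‖z‖]
            with R hR hR'
          gcongr
          linarith
      have := (h1.add h4).const_mul C
      simp only [add_zero, mul_zero] at this
      refine this.congr fun R => ?_
      rw [mul_div_assoc, add_div, one_div]
    have := ge_of_tendsto ht (by
      filter_upwards [Filter.eventually_gt_atTop 0] with R hR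
      exact hb R hR)
    simpa using this
  exact is_const_of_deriv_eq_zero hFd hd z 0

end Liouville

section HalfPlane

open Topology ComplexConjugate

theorem eq_of_halfPlane_of_im_eq_zero {α C : ℝ} (hα0 : 0 < α) (hα1 : α < 1) {G F : ℂ → ℂ}
    (hG : ∀ z z' : ℂ, 0 ≤ z.im → 0 ≤ z'.im →
      ‖G z' - G z - (z' - z) * F z‖ ≤ C * ‖z' - z‖ ^ α * ‖z' - z‖)
    (hF : ∀ z : ℂ, 0 ≤ z.im → ‖F z - F 0‖ ≤ C * ‖z‖ ^ α)
    (hG0 : ∀ z : ℂ, z.im = 0 → (G z).im = 0) (hF0 : ∀ z : ℂ, z.im = 0 → (F z).im = 0)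
    (z : ℂ) (hz : 0 ≤ z.im) : F z = F 0 := by
  classical
  set G' : ℂ → ℂ := fun z => if 0 ≤ z.im then G z else conj (G (conj z)) with hG'
  set F' : ℂ → ℂ := fun z => if 0 ≤ z.im then F z else conj (F (conj z)) with hF'
  have gu : ∀ z : ℂ, 0 ≤ z.im → G' z = G z := fun z hz => by simp [hG', hz]
  have fu : ∀ z : ℂ, 0 ≤ z.im → F' z = F z := fun z hz => by simp [hF', hz]
  have gl : ∀ z : ℂ, z.im ≤ 0 → G' z = conj (G (conj z)) := fun z hz => by
    rcases hz.lt_or_eq with h | h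
    · simp [hG', h]
    · rw [gu z h.ge, Complex.conj_eq_iff_im.2 h, Complex.conj_eq_iff_im.2 (hG0 z h)]
  have fl : ∀ z : ℂ, z.im ≤ 0 → F' z = conj (F (conj z)) := fun z hz => by
    rcases hz.lt_or_eq with h | h
    · simp [hF', h]
    · rw [fu z h.ge, Complex.conj_eq_iff_im.2 h, Complex.conj_eq_iff_im.2 (hF0 z h)]
  have du : ∀ z : ℂ, 0 ≤ z.im → HasDerivWithinAt G' (F' z) {z | 0 ≤ z.im} z := fun z hz =>
    hasDerivWithinAt_of_rpow_bound (C := C) hα0 fun y hy => by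
      rw [gu y hy, gu z hz, fu z hz, smul_eq_mul]; exact hG z y hz hy
  have dl : ∀ z : ℂ, z.im ≤ 0 → HasDerivWithinAt G' (F' z) {z | z.im ≤ 0} z := fun z hz =>
    hasDerivWithinAt_of_rpow_bound (C := C) hα0 fun y hy => by
      have hy' : y.im ≤ 0 := hy
      rw [gl y hy, gl z hz, fl z hz, smul_eq_mul]
      have := hG (conj z) (conj y) (by simpa using hz) (by simpa using hy')
      rw [← map_sub conj, Complex.norm_conj] at this
      rw [← Complex.norm_conj]
      simpa using this
  have hd : ∀ z, HasDerivAt G' (F' z) z := by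
    intro z
    rcases lt_trichotomy z.im 0 with h | h | h
    · exact (dl z h.le).hasDerivAt
        (Filter.mem_of_superset ((isOpen_lt Complex.continuous_im continuous_const).mem_nhds h)
          fun w (hw : w.im < 0) => hw.le)
    · have := (du z h.ge).union (dl z h.le)
      refine this.hasDerivAt (Filter.mem_of_superset Filter.univ_mem fun w _ => ?_)
      exact le_total 0 w.im
    · exact (du z h.le).hasDerivAt
        (Filter.mem_of_superset ((isOpen_lt continuous_const Complex.continuous_im).mem_nhds h)
          fun w (hw : 0 < w.im) => hw.le)
  have hC : 0 ≤ C := by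
    have := (norm_nonneg _).trans (hF 1 (by simp))
    simpa using this
  have hgr : ∀ z, ‖F' z - F' 0‖ ≤ C * (1 + ‖z‖ ^ α) := by
    intro z
    have key : ‖F' z - F' 0‖ ≤ C * ‖z‖ ^ α := by
      rcases le_total 0 z.im with h | h
      · rw [fu z h, fu 0 (by simp)]; exact hF z h
      · rw [fl z h, fl 0 (by simp), map_zero, ← map_sub, Complex.norm_conj,
          ← Complex.norm_conj z]
        exact hF _ (by simpa using h)
    refine key.trans ?_
    gcongr; linarith
  have := eq_of_entire_of_holder hα0 hα1 hd hgr z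
  rwa [fu z hz, fu 0 (by simp)] at this

/-- The real-linear map of `ℂ` sending `x + i y` to `c x - i b y`. -/
noncomputable def twist (c b : ℝ) (w : ℂ) : ℂ := ⟨c * w.re, -(b * w.im)⟩

theorem norm_twist_le {c b : ℝ} (hc : 0 < c) (hb : 0 < b) (w : ℂ) :
    ‖twist c b w‖ ≤ (c + b) * ‖w‖ := by
  refine (Complex.norm_le_abs_re_add_abs_im _).trans ?_
  simp only [twist, abs_neg, abs_mul, abs_of_pos hc, abs_of_pos hb]
  nlinarith [Complex.abs_re_le_norm w, Complex.abs_im_le_norm w]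

theorem twist_sub (c b : ℝ) (v w : ℂ) : twist c b (v - w) = twist c b v - twist c b w := by
  apply Complex.ext <;> simp [twist] <;> ring

theorem twist_inj {c b : ℝ} (hc : 0 < c) (hb : 0 < b) {v w : ℂ}
    (h : twist c b v = twist c b w) : v = w := by
  have h1 := congrArg Complex.re h
  have h2 := congrArg Complex.im h
  simp only [twist, neg_inj] at h1 h2
  exact Complex.ext (mul_left_cancel₀ hc.ne' h1) (mul_left_cancel₀ hb.ne' h2)

/-- The constant-coefficient elliptic relations between the two partial derivatives `P`, `R`
of `σ + i w`. -/
def EllipticRel (c s b : ℝ) (P R : ℂ) : Prop :=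
  c * R.re = P.im - s * R.im ∧ c * P.re = s * P.im - (b ^ 2 + s ^ 2) * R.im

theorem EllipticRel.twist_eq {c s b : ℝ} {P R : ℂ} (h : EllipticRel c s b P R) :
    (⟨s, -b⟩ : ℂ) * twist c b R = twist c b P := by
  obtain ⟨h1, h2⟩ := h
  apply Complex.ext
  · simp only [twist, Complex.mul_re]; linear_combination s * h1 - h2
  · simp only [twist, Complex.mul_im]; linear_combination -b * h1

theorem EllipticRel.eq_right {c s b : ℝ} (hc : 0 < c) (hb : 0 < b) {P R R' : ℂ}
    (h : EllipticRel c s b P R) (h' : EllipticRel c s b P R') : R = R' := by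
  have := h.twist_eq.trans h'.twist_eq.symm
  refine twist_inj hc hb (mul_left_cancel₀ ?_ this)
  intro h0
  have := congrArg Complex.im h0
  simp at this
  exact hb.ne' this

/-- The inverse of the linear change of variables `(q, p) ↦ q + τ p`, where `τ = 1 / (s - i b)`. -/
noncomputable def uncoord (s b : ℝ) (ζ : ℂ) : ℝ × ℝ :=
  (ζ.re - s / b * ζ.im, (s ^ 2 + b ^ 2) / b * ζ.im)

theorem uncoord_sub (s b : ℝ) (ζ ζ' : ℂ) :
    uncoord s b ζ - uncoord s b ζ' = uncoord s b (ζ - ζ') := by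
  simp only [uncoord, Prod.mk_sub_mk, Complex.sub_re, Complex.sub_im]
  ext <;> ring

theorem norm_uncoord_le {s b : ℝ} (hb : 0 < b) (ζ : ℂ) :
    ‖uncoord s b ζ‖ ≤ (1 + |s| / b + (s ^ 2 + b ^ 2) / b) * ‖ζ‖ := by
  have h1 := Complex.abs_re_le_norm ζ
  have h2 := Complex.abs_im_le_norm ζ
  have h3 : 0 ≤ |s| / b := by positivity
  have h4 : 0 ≤ (s ^ 2 + b ^ 2) / b := by positivity
  have h0 := norm_nonneg ζ
  rw [Prod.norm_def]
  refine max_le ?_ ?_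
  · simp only [uncoord, Real.norm_eq_abs]
    refine (abs_sub _ _).trans ?_
    rw [abs_mul, abs_div, abs_of_pos hb]
    nlinarith [mul_le_mul_of_nonneg_left h2 h3]
  · simp only [uncoord, Real.norm_eq_abs]
    rw [abs_mul, abs_of_nonneg h4]
    nlinarith [mul_le_mul_of_nonneg_left h2 h4]

theorem sub_eq_of_uncoord {s b : ℝ} (hb : 0 < b) (ζ : ℂ) :
    (⟨s, -b⟩ : ℂ) * ζ = ⟨s, -b⟩ * ((uncoord s b ζ).1 : ℂ) + ((uncoord s b ζ).2 : ℂ) := by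
  apply Complex.ext <;> simp [uncoord, sq] <;> field_simp <;> ring

theorem exists_uncoord {s b : ℝ} (hb : 0 < b) (x : ℝ × ℝ) : ∃ ζ : ℂ, uncoord s b ζ = x := by
  refine ⟨⟨x.1 + s / (s ^ 2 + b ^ 2) * x.2, b / (s ^ 2 + b ^ 2) * x.2⟩, ?_⟩
  have : 0 < s ^ 2 + b ^ 2 := by positivity
  ext <;> simp [uncoord] <;> field_simp; ring

theorem twist_taylor {α C c s b : ℝ} (hα : 0 < α) (hC : 0 ≤ C) (hc : 0 < c) (hb : 0 < b)
    {W P R : ℝ × ℝ → ℂ} {K : Set (ℝ × ℝ)}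
    (hT : ∀ x ∈ K, ∀ y ∈ K, ‖W y - W x - ((y.1 - x.1) • P x + (y.2 - x.2) • R x)‖
      ≤ C * ‖y - x‖ ^ α * ‖y - x‖)
    (hH : ∀ x ∈ K, ∀ y ∈ K, ‖P x - P y‖ ≤ C * ‖x - y‖ ^ α)
    (hE : ∀ x ∈ K, EllipticRel c s b (P x) (R x)) :
    ∃ C' : ℝ, (∀ z z' : ℂ, uncoord s b z ∈ K → uncoord s b z' ∈ K →
      ‖twist c b (W (uncoord s b z')) - twist c b (W (uncoord s b z))
        - (z' - z) * twist c b (P (uncoord s b z))‖ ≤ C' * ‖z' - z‖ ^ α * ‖z' - z‖) ∧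
    (∀ z : ℂ, uncoord s b 0 ∈ K → uncoord s b z ∈ K →
      ‖twist c b (P (uncoord s b z)) - twist c b (P (uncoord s b 0))‖ ≤ C' * ‖z‖ ^ α) := by
  set κ := 1 + |s| / b + (s ^ 2 + b ^ 2) / b with hκ
  have hκ1 : 1 ≤ κ := by
    have h3 : 0 ≤ |s| / b := by positivity
    have h4 : 0 ≤ (s ^ 2 + b ^ 2) / b := by positivity
    linarith
  have hκ0 : 0 < κ := by linarith
  refine ⟨(c + b) * (C * κ ^ α * κ), ?_, ?_⟩
  · intro z z' hz hz'
    set x := uncoord s b z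
    set y := uncoord s b z'
    have hyx : y - x = uncoord s b (z' - z) := uncoord_sub s b z' z
    have e : twist c b (W y) - twist c b (W x) - (z' - z) * twist c b (P x) =
        twist c b (W y - W x - ((y.1 - x.1) • P x + (y.2 - x.2) • R x)) := by
      have h0 : (⟨s, -b⟩ : ℂ) ≠ 0 := fun h0 => hb.ne' (by simpa using congrArg Complex.im h0)
      have h1 := (hE x hz).twist_eq
      have h2 := sub_eq_of_uncoord (s := s) hb (z' - z)
      rw [← hyx] at h2
      have h3 : (z' - z) * twist c b (P x) =
          ((y.1 - x.1 : ℝ) : ℂ) * twist c b (P x) + ((y.2 - x.2 : ℝ) : ℂ) * twist c b (R x) := by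
        apply mul_left_cancel₀ h0
        rw [← mul_assoc, h2, ← h1]
        simp only [Prod.fst_sub, Prod.snd_sub]
        ring
      rw [h3]
      apply Complex.ext <;> simp [twist] <;> ring
    rw [e]
    refine (norm_twist_le hc hb _).trans ?_
    rw [mul_assoc, mul_assoc]
    refine mul_le_mul_of_nonneg_left ((hT x hz y hz').trans ?_) (by positivity)
    have hn : ‖y - x‖ ≤ κ * ‖z' - z‖ := by rw [hyx]; exact norm_uncoord_le hb _
    calc C * ‖y - x‖ ^ α * ‖y - x‖ ≤ C * (κ * ‖z' - z‖) ^ α * (κ * ‖z' - z‖) := by gcongr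
      _ = C * κ ^ α * κ * (‖z' - z‖ ^ α * ‖z' - z‖) := by
        rw [Real.mul_rpow hκ0.le (norm_nonneg _)]; ring
  · intro z h0 hz
    rw [← twist_sub]
    refine (norm_twist_le hc hb _).trans ?_
    rw [mul_assoc]
    refine mul_le_mul_of_nonneg_left ((hH _ hz _ h0).trans ?_) (by positivity)
    rw [uncoord_sub, sub_zero]
    calc C * ‖uncoord s b z‖ ^ α ≤ C * (κ * ‖z‖) ^ α := by
          gcongr; exact norm_uncoord_le hb _
      _ = C * κ ^ α * 1 * ‖z‖ ^ α := by
        rw [Real.mul_rpow hκ0.le (norm_nonneg _)]; ring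
      _ ≤ C * κ ^ α * κ * ‖z‖ ^ α := by gcongr

theorem elliptic_liouville_plane {α C c s b : ℝ} (hα0 : 0 < α) (hα1 : α < 1) (hC : 0 ≤ C)
    (hc : 0 < c) (hb : 0 < b) {W P R : ℝ × ℝ → ℂ}
    (hT : ∀ x y, ‖W y - W x - ((y.1 - x.1) • P x + (y.2 - x.2) • R x)‖
      ≤ C * ‖y - x‖ ^ α * ‖y - x‖)
    (hH : ∀ x y, ‖P x - P y‖ ≤ C * ‖x - y‖ ^ α)
    (hE : ∀ x, EllipticRel c s b (P x) (R x)) (x : ℝ × ℝ) : P x = P 0 ∧ R x = R 0 := by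
  obtain ⟨C', h1, h2⟩ := twist_taylor (K := Set.univ) hα0 hC hc hb (fun x _ y _ => hT x y)
    (fun x _ y _ => hH x y) (fun x _ => hE x)
  have hC' : 0 ≤ C' := by
    have := (norm_nonneg _).trans (h2 1 trivial trivial)
    simpa using this
  have hP : P x = P 0 := by
    obtain ⟨z, hz⟩ := exists_uncoord (s := s) hb x
    have := eq_of_entire_of_holder hα0 hα1 (C := C')
      (G := fun z => twist c b (W (uncoord s b z))) (F := fun z => twist c b (P (uncoord s b z)))
      (fun z => hasDerivAt_of_rpow_bound hα0 fun y => by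
        rw [smul_eq_mul]; exact h1 z y trivial trivial)
      (fun z => (h2 z trivial trivial).trans (by gcongr; linarith)) z
    have h0 : uncoord s b 0 = 0 := by simp [uncoord]
    rw [hz, h0] at this
    exact twist_inj hc hb this
  exact ⟨hP, (hE x).eq_right hc hb (hP ▸ hE 0)⟩

theorem elliptic_liouville_upper {α C c s b : ℝ} (hα0 : 0 < α) (hα1 : α < 1) (hC : 0 ≤ C)
    (hc : 0 < c) (hb : 0 < b) {W P R : ℝ × ℝ → ℂ}
    (hT : ∀ x ∈ {x : ℝ × ℝ | 0 ≤ x.2}, ∀ y ∈ {x : ℝ × ℝ | 0 ≤ x.2},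
      ‖W y - W x - ((y.1 - x.1) • P x + (y.2 - x.2) • R x)‖ ≤ C * ‖y - x‖ ^ α * ‖y - x‖)
    (hH : ∀ x ∈ {x : ℝ × ℝ | 0 ≤ x.2}, ∀ y ∈ {x : ℝ × ℝ | 0 ≤ x.2},
      ‖P x - P y‖ ≤ C * ‖x - y‖ ^ α)
    (hE : ∀ x ∈ {x : ℝ × ℝ | 0 ≤ x.2}, EllipticRel c s b (P x) (R x))
    (hB : (∀ t : ℝ, (P (t, 0)).im = 0) ∨ (∀ t : ℝ, (P (t, 0)).re = 0)) (hW : W 0 = 0)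
    (x : ℝ × ℝ) (hx : 0 ≤ x.2) : P x = P 0 ∧ R x = R 0 := by
  obtain ⟨C', h1, h2⟩ := twist_taylor hα0 hC hc hb hT hH hE
  have hmem : ∀ z : ℂ, 0 ≤ z.im → uncoord s b z ∈ {x : ℝ × ℝ | 0 ≤ x.2} := fun z hz => by
    change 0 ≤ (s ^ 2 + b ^ 2) / b * z.im
    positivity
  have h0 : uncoord s b 0 = 0 := by simp [uncoord]
  have hbd : ∀ z : ℂ, z.im = 0 → uncoord s b z = (z.re, 0) := fun z hz => by
    simp [uncoord, hz]
  have hWd : ∀ t : ℝ, HasDerivAt (fun t : ℝ => W (t, 0)) (P (t, 0)) t := fun t =>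
    hasDerivAt_of_rpow_bound (C := C) hα0 fun y => by
      have := hT (t, 0) (by simp) (y, 0) (by simp)
      simpa [Prod.norm_def] using this
  have hP : P x = P 0 := by
    obtain ⟨z, hz⟩ := exists_uncoord (s := s) hb x
    have hzi : 0 ≤ z.im := by
      rw [← hz] at hx
      simp only [uncoord] at hx
      have : 0 < (s ^ 2 + b ^ 2) / b := by positivity
      exact nonneg_of_mul_nonneg_right hx this
    rcases hB with hB | hB
    · have hW0 : ∀ t : ℝ, (W (t, 0)).im = 0 := fun t => by
        have hd : ∀ t : ℝ, HasDerivAt (fun t : ℝ => (W (t, 0)).im) 0 t := fun t => by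
          have : HasDerivAt (fun t : ℝ => (W (t, 0)).im) (P (t, 0)).im t :=
            Complex.imCLM.hasFDerivAt.comp_hasDerivAt t (hWd t)
          rwa [hB t] at this
        have := is_const_of_deriv_eq_zero (fun t => (hd t).differentiableAt)
          (fun t => (hd t).deriv) t 0
        rw [this]
        have : W (0, 0) = 0 := hW
        simp [this]
      have := eq_of_halfPlane_of_im_eq_zero hα0 hα1 (C := C')
        (G := fun z => twist c b (W (uncoord s b z)))
        (F := fun z => twist c b (P (uncoord s b z)))
        (fun z z' hz hz' => h1 z z' (hmem z hz) (hmem z' hz'))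
        (fun z hz => h2 z (hmem 0 (by simp)) (hmem z hz))
        (fun z hz => by simp [twist, hbd z hz, hW0]) (fun z hz => by simp [twist, hbd z hz, hB])
        z hzi
      rw [hz, h0] at this
      exact twist_inj hc hb this
    · have hW0 : ∀ t : ℝ, (W (t, 0)).re = 0 := fun t => by
        have hd : ∀ t : ℝ, HasDerivAt (fun t : ℝ => (W (t, 0)).re) 0 t := fun t => by
          have : HasDerivAt (fun t : ℝ => (W (t, 0)).re) (P (t, 0)).re t :=
            Complex.reCLM.hasFDerivAt.comp_hasDerivAt t (hWd t)
          rwa [hB t] at this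
        have := is_const_of_deriv_eq_zero (fun t => (hd t).differentiableAt)
          (fun t => (hd t).deriv) t 0
        rw [this]
        have : W (0, 0) = 0 := hW
        simp [this]
      have := eq_of_halfPlane_of_im_eq_zero hα0 hα1 (C := C')
        (G := fun z => Complex.I * twist c b (W (uncoord s b z)))
        (F := fun z => Complex.I * twist c b (P (uncoord s b z)))
        (fun z z' hz hz' => by
          have := h1 z z' (hmem z hz) (hmem z' hz')
          have e : ∀ u v w x : ℂ, Complex.I * u - Complex.I * v - w * (Complex.I * x) =
            Complex.I * (u - v - w * x) := fun u v w x => by ring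
          rw [e, norm_mul, Complex.norm_I, one_mul]
          exact this)
        (fun z hz => by
          rw [← mul_sub, norm_mul, Complex.norm_I, one_mul]
          exact h2 z (hmem 0 (by simp)) (hmem z hz))
        (fun z hz => by simp [twist, hbd z hz, hW0]) (fun z hz => by simp [twist, hbd z hz, hB])
        z hzi
      rw [hz, h0] at this
      exact twist_inj hc hb (mul_left_cancel₀ Complex.I_ne_zero this)
  exact ⟨hP, (hE x hx).eq_right hc hb (hP ▸ hE 0 (by simp))⟩

theorem elliptic_liouville_lower {α C c s b : ℝ} (hα0 : 0 < α) (hα1 : α < 1) (hC : 0 ≤ C)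
    (hc : 0 < c) (hb : 0 < b) {W P R : ℝ × ℝ → ℂ}
    (hT : ∀ x ∈ {x : ℝ × ℝ | x.2 ≤ 0}, ∀ y ∈ {x : ℝ × ℝ | x.2 ≤ 0},
      ‖W y - W x - ((y.1 - x.1) • P x + (y.2 - x.2) • R x)‖ ≤ C * ‖y - x‖ ^ α * ‖y - x‖)
    (hH : ∀ x ∈ {x : ℝ × ℝ | x.2 ≤ 0}, ∀ y ∈ {x : ℝ × ℝ | x.2 ≤ 0},
      ‖P x - P y‖ ≤ C * ‖x - y‖ ^ α)
    (hE : ∀ x ∈ {x : ℝ × ℝ | x.2 ≤ 0}, EllipticRel c s b (P x) (R x))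
    (hB : (∀ t : ℝ, (P (t, 0)).im = 0) ∨ (∀ t : ℝ, (P (t, 0)).re = 0)) (hW : W 0 = 0)
    (x : ℝ × ℝ) (hx : x.2 ≤ 0) : P x = P 0 ∧ R x = R 0 := by
  have hm : ∀ x : ℝ × ℝ, x ∈ {x : ℝ × ℝ | 0 ≤ x.2} → -x ∈ {x : ℝ × ℝ | x.2 ≤ 0} := fun x hx => by
    simpa using hx
  have := elliptic_liouville_upper hα0 hα1 hC hc hb (W := fun x => W (-x)) (P := fun x => -P (-x))
    (R := fun x => -R (-x)) (s := s)
    (fun x hx y hy => by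
      have := hT _ (hm x hx) _ (hm y hy)
      have e : -y - -x = -(y - x) := by abel
      rw [e, norm_neg] at this
      have e' : (y.1 - x.1) • -P (-x) + (y.2 - x.2) • -R (-x) =
          ((-y).1 - (-x).1) • P (-x) + ((-y).2 - (-x).2) • R (-x) := by
        simp only [Prod.fst_neg, Prod.snd_neg]
        module
      rwa [e'])
    (fun x hx y hy => by
      have := hH _ (hm x hx) _ (hm y hy)
      have e : -x - -y = -(x - y) := by abel
      rw [e, norm_neg] at this
      rwa [neg_sub_neg, norm_sub_rev])
    (fun x hx => by
      obtain ⟨h1, h2⟩ := hE _ (hm x hx)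
      constructor <;> simp only [Complex.neg_re, Complex.neg_im] <;> linarith)
    (hB.imp (fun h t => by simpa using h (-t)) (fun h t => by simpa using h (-t)))
    (by simpa using hW) (-x) (by simpa using hx)
  simpa using this

end HalfPlane

section Schauder

open Topology

/-- The pair `P`, `R` is `α`-Hölder continuous on the strip with (joint) constant `K`. -/
def GradHolder (p₀ α K : ℝ) (P R : ℝ × ℝ → ℂ) : Prop :=
  ∀ x ∈ Obar p₀, ∀ y ∈ Obar p₀, ‖P x - P y‖ + ‖R x - R y‖ ≤ K * dist x y ^ α

/-- `W = σ + i w` solves a linear elliptic first-order system on the strip, with partial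
derivatives `P`, `R`, with `w = 0` at the bottom and with `∂_q σ` controlled at the top. The
coefficients are controlled by `Λ`, the data and `W` by `N`. -/
structure LinSol (p₀ α Λ N : ℝ) (c s b f₁ f₂ : ℝ × ℝ → ℝ) (W P R : ℝ × ℝ → ℂ) : Prop where
  c_lower : ∀ x ∈ Obar p₀, Λ⁻¹ ≤ c x
  b_lower : ∀ x ∈ Obar p₀, Λ⁻¹ ≤ b x
  c_holder : HolderBdd α (Obar p₀) Λ c
  s_holder : HolderBdd α (Obar p₀) Λ s
  b_holder : HolderBdd α (Obar p₀) Λ b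
  f₁_holder : HolderBdd α (Obar p₀) N f₁
  f₂_holder : HolderBdd α (Obar p₀) N f₂
  bound : ∀ x ∈ Obar p₀, ‖W x‖ ≤ N
  deriv_q : ∀ x ∈ Obar p₀, HasDerivAt (fun q => W (q, x.2)) (P x) x.1
  deriv_p : ∀ x ∈ Obar p₀, HasDerivWithinAt (fun p => W (x.1, p)) (R x) (Set.Icc p₀ 0) x.2
  eq₁ : ∀ x ∈ Obar p₀, c x * (R x).re = (P x).im - s x * (R x).im + f₁ x
  eq₂ : ∀ x ∈ Obar p₀, c x * (P x).re = s x * (P x).im - (b x ^ 2 + s x ^ 2) * (R x).im + f₂ x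
  bottom : ∀ q, (P (q, p₀)).im = 0
  top : ∀ q q', |(P (q, 0)).re - (P (q', 0)).re| ≤ N * |q - q'| ^ α

theorem LinSol.taylor {p₀ α Λ N K : ℝ} {c s b f₁ f₂ : ℝ × ℝ → ℝ} {W P R : ℝ × ℝ → ℂ}
    (hα : 0 < α) (hK : 0 ≤ K) (h : LinSol p₀ α Λ N c s b f₁ f₂ W P R)
    (hH : GradHolder p₀ α K P R) {x y : ℝ × ℝ} (hx : x ∈ Obar p₀) (hy : y ∈ Obar p₀) :
    ‖W y - W x - ((y.1 - x.1) • P x + (y.2 - x.2) • R x)‖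
      ≤ 2 * K * ‖y - x‖ ^ α * ‖y - x‖ :=
  norm_sub_sub_smul_le_of_partials hα hK h.deriv_q h.deriv_p
    (fun x hx y hy => (le_add_of_nonneg_right (norm_nonneg _)).trans (hH x hx y hy))
    (fun x hx y hy => (le_add_of_nonneg_left (norm_nonneg _)).trans (hH x hx y hy)) hx hy

theorem LinSol.norm_grad_le {p₀ α Λ N K : ℝ} {c s b f₁ f₂ : ℝ × ℝ → ℝ} {W P R : ℝ × ℝ → ℂ}
    (hα : 0 < α) (hK : 0 ≤ K) (h : LinSol p₀ α Λ N c s b f₁ f₂ W P R)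
    (hH : GradHolder p₀ α K P R) {l : ℝ} (hl : 0 < l) (hl' : 2 * l ≤ -p₀) {x : ℝ × ℝ}
    (hx : x ∈ Obar p₀) :
    ‖P x‖ ≤ 2 * N / l + 2 * K * l ^ α ∧ ‖R x‖ ≤ 2 * N / l + 2 * K * l ^ α := by
  have key : ∀ (v : ℝ × ℝ) (V : ℂ), x + v ∈ Obar p₀ → ‖v‖ = l →
      ‖v.1 • P x + v.2 • R x‖ = l * ‖V‖ → ‖V‖ ≤ 2 * N / l + 2 * K * l ^ α := by
    intro v V hv hvn hV
    have h1 := h.taylor hα hK hH hx hv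
    have h2 := h.bound x hx
    have h3 := h.bound _ hv
    simp only [Prod.fst_add, Prod.snd_add, add_sub_cancel_left, hvn] at h1
    have h4 : ‖v.1 • P x + v.2 • R x‖ ≤ 2 * K * l ^ α * l + (N + N) := by
      have e : v.1 • P x + v.2 • R x = -(W (x + v) - W x - (v.1 • P x + v.2 • R x)) +
          (W (x + v) - W x) := by abel
      rw [e]
      refine (norm_add_le _ _).trans (add_le_add (by rwa [norm_neg]) ?_)
      exact (norm_sub_le _ _).trans (add_le_add h3 h2)
    rw [hV] at h4
    have : ‖V‖ ≤ (2 * K * l ^ α * l + (N + N)) / l := by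
      rw [le_div_iff₀ hl]; linarith
    refine this.trans (le_of_eq ?_)
    field_simp; ring
  have hx2 : x.2 ∈ Set.Icc p₀ 0 := hx.2
  constructor
  · refine key (l, 0) (P x) ⟨trivial, by simpa using hx2⟩ ?_ ?_
    · simp [Prod.norm_def, abs_of_pos hl, hl.le]
    · simp [abs_of_pos hl]
  · rcases le_total x.2 (-l) with hc | hc
    · refine key (0, l) (R x) ⟨trivial, ?_, ?_⟩ ?_ ?_
      · simpa using hx2.1.trans (by linarith)
      · simpa using by linarith
      · simp [Prod.norm_def, abs_of_pos hl, hl.le]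
      · simp [abs_of_pos hl]
    · refine key (0, -l) (R x) ⟨trivial, ?_, ?_⟩ ?_ ?_
      · simpa using by linarith
      · simpa using hx2.2.trans (by linarith)
      · simp [Prod.norm_def, abs_of_pos hl, hl.le]
      · simp [abs_of_pos hl]

theorem inv_rpow_mul_dist_rpow {α r : ℝ} (hr : 0 < r) (o x y : ℝ × ℝ) :
    (r ^ α)⁻¹ * dist (o + r • x) (o + r • y) ^ α = ‖x - y‖ ^ α := by
  have h0 : 0 < r ^ α := Real.rpow_pos_of_pos hr α
  rw [dist_add_left, dist_smul₀, Real.norm_eq_abs, abs_of_pos hr,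
    Real.mul_rpow hr.le dist_nonneg, dist_eq_norm]
  field_simp

theorem LinSol.exists_blowup_limit {p₀ α Λ : ℝ} (hα : 0 < α) (hΛ : 0 < Λ)
    {U : Ultrafilter ℕ} {N : ℕ → ℝ} (hN : Filter.Tendsto N U (𝓝 0))
    {c s b f₁ f₂ : ℕ → ℝ × ℝ → ℝ} {W P R : ℕ → ℝ × ℝ → ℂ}
    (h : ∀ n, LinSol p₀ α Λ (N n) (c n) (s n) (b n) (f₁ n) (f₂ n) (W n) (P n) (R n))
    (hH : ∀ n, GradHolder p₀ α 1 (P n) (R n))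
    (hsmall : ∀ ε > 0, ∀ᶠ n in (U : Filter ℕ), ∀ x ∈ Obar p₀, ‖P n x‖ ≤ ε ∧ ‖R n x‖ ≤ ε)
    {o : ℕ → ℝ × ℝ} (ho : ∀ n, o n ∈ Obar p₀) {r : ℕ → ℝ} (hr : ∀ n, 0 < r n)
    {K : Set (ℝ × ℝ)} (hK0 : (0 : ℝ × ℝ) ∈ K)
    (hK : ∀ z ∈ K, ∀ᶠ n in (U : Filter ℕ), o n + r n • z ∈ Obar p₀) :
    ∃ (c₀ s₀ b₀ : ℝ) (W₀ P₀ R₀ : ℝ × ℝ → ℂ), 0 < c₀ ∧ 0 < b₀ ∧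
      (∀ x ∈ K, ∀ y ∈ K, ‖W₀ y - W₀ x - ((y.1 - x.1) • P₀ x + (y.2 - x.2) • R₀ x)‖
        ≤ 2 * ‖y - x‖ ^ α * ‖y - x‖) ∧
      (∀ x ∈ K, ∀ y ∈ K, ‖P₀ x - P₀ y‖ ≤ 2 * ‖x - y‖ ^ α) ∧
      (∀ x ∈ K, EllipticRel c₀ s₀ b₀ (P₀ x) (R₀ x)) ∧ W₀ 0 = 0 ∧
      (∀ z ∈ K, Filter.Tendsto
        (fun n => (r n ^ α)⁻¹ • (P n (o n + r n • z) - P n (o n))) U (𝓝 (P₀ z))) ∧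
      (∀ z ∈ K, Filter.Tendsto
        (fun n => (r n ^ α)⁻¹ • (R n (o n + r n • z) - R n (o n))) U (𝓝 (R₀ z))) := by
  have hrα : ∀ n, 0 < r n ^ α := fun n => Real.rpow_pos_of_pos (hr n) α
  -- Hölder bounds for the rescaled gradients
  have hPR : ∀ n x y, o n + r n • x ∈ Obar p₀ → o n + r n • y ∈ Obar p₀ →
      (r n ^ α)⁻¹ * ‖P n (o n + r n • x) - P n (o n + r n • y)‖ +
      (r n ^ α)⁻¹ * ‖R n (o n + r n • x) - R n (o n + r n • y)‖ ≤ ‖x - y‖ ^ α := by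
    intro n x y hx hy
    rw [← mul_add, ← inv_rpow_mul_dist_rpow (α := α) (hr n) (o n) x y]
    refine mul_le_mul_of_nonneg_left ?_ (inv_nonneg.2 (hrα n).le)
    simpa using hH n _ hx _ hy
  have hP : ∀ n x y, o n + r n • x ∈ Obar p₀ → o n + r n • y ∈ Obar p₀ →
      (r n ^ α)⁻¹ * ‖P n (o n + r n • x) - P n (o n + r n • y)‖ ≤ ‖x - y‖ ^ α := fun n x y hx hy =>
    (le_add_of_nonneg_right (mul_nonneg (inv_nonneg.2 (hrα n).le) (norm_nonneg _))).trans
      (hPR n x y hx hy)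
  have hR : ∀ n x y, o n + r n • x ∈ Obar p₀ → o n + r n • y ∈ Obar p₀ →
      (r n ^ α)⁻¹ * ‖R n (o n + r n • x) - R n (o n + r n • y)‖ ≤ ‖x - y‖ ^ α := fun n x y hx hy =>
    (le_add_of_nonneg_left (mul_nonneg (inv_nonneg.2 (hrα n).le) (norm_nonneg _))).trans
      (hPR n x y hx hy)
  have hT : ∀ n x y, o n + r n • x ∈ Obar p₀ → o n + r n • y ∈ Obar p₀ →
      ‖((r n ^ α)⁻¹ * (r n)⁻¹) • (W n (o n + r n • y) - W n (o n + r n • x) -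
        ((r n * (y.1 - x.1)) • P n (o n + r n • x) + (r n * (y.2 - x.2)) • R n (o n + r n • x)))‖
        ≤ 2 * ‖y - x‖ ^ α * ‖y - x‖ := by
    intro n x y hx hy
    have h1 := (h n).taylor hα zero_le_one (hH n) hx hy
    have e1 : (o n + r n • y).1 - (o n + r n • x).1 = r n * (y.1 - x.1) := by
      simp only [Prod.fst_add, Prod.smul_fst, smul_eq_mul]; ring
    have e2 : (o n + r n • y).2 - (o n + r n • x).2 = r n * (y.2 - x.2) := by
      simp only [Prod.snd_add, Prod.smul_snd, smul_eq_mul]; ring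
    have e3 : o n + r n • y - (o n + r n • x) = r n • (y - x) := by module
    rw [e1, e2, e3, norm_smul, Real.norm_eq_abs, abs_of_pos (hr n),
      Real.mul_rpow (hr n).le (norm_nonneg _)] at h1
    rw [norm_smul, Real.norm_eq_abs, abs_of_pos (mul_pos (inv_pos.2 (hrα n)) (inv_pos.2 (hr n)))]
    refine (mul_le_mul_of_nonneg_left h1 (mul_pos (inv_pos.2 (hrα n)) (inv_pos.2 (hr n))).le).trans
      (le_of_eq ?_)
    have := hr n
    have := hrα n
    field_simp
  -- limits
  have ex : ∀ {E : Type} [NormedAddCommGroup E] [ProperSpace E] (f : ℕ → ℝ × ℝ → E)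
      (B : ℝ × ℝ → ℝ), (∀ z ∈ K, ∀ᶠ n in (U : Filter ℕ), ‖f n z‖ ≤ B z) →
      ∃ F : ℝ × ℝ → E, ∀ z ∈ K, Filter.Tendsto (fun n => f n z) U (𝓝 (F z)) := by
    intro E _ _ f B hf
    have : ∀ z, ∃ l, z ∈ K → Filter.Tendsto (fun n => f n z) U (𝓝 l) := fun z => by
      by_cases hz : z ∈ K
      · obtain ⟨l, hl⟩ := U.exists_tendsto_of_norm_le (hf z hz)
        exact ⟨l, fun _ => hl⟩
      · exact ⟨0, fun h => absurd h hz⟩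
    choose F hF using this
    exact ⟨F, hF⟩
  have o0 : ∀ n, o n + r n • (0 : ℝ × ℝ) = o n := fun n => by simp
  obtain ⟨P₀, hP₀⟩ := ex (fun n z => (r n ^ α)⁻¹ • (P n (o n + r n • z) - P n (o n)))
    (fun z => ‖z‖ ^ α) fun z hz => by
      filter_upwards [hK z hz] with n hn
      rw [norm_smul, Real.norm_eq_abs, abs_of_pos (inv_pos.2 (hrα n))]
      simpa [o0] using hP n z 0 hn (by rw [o0]; exact ho n)
  obtain ⟨R₀, hR₀⟩ := ex (fun n z => (r n ^ α)⁻¹ • (R n (o n + r n • z) - R n (o n)))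
    (fun z => ‖z‖ ^ α) fun z hz => by
      filter_upwards [hK z hz] with n hn
      rw [norm_smul, Real.norm_eq_abs, abs_of_pos (inv_pos.2 (hrα n))]
      simpa [o0] using hR n z 0 hn (by rw [o0]; exact ho n)
  obtain ⟨W₀, hW₀⟩ := ex (fun n z => ((r n ^ α)⁻¹ * (r n)⁻¹) • (W n (o n + r n • z) - W n (o n) -
      ((r n * z.1) • P n (o n) + (r n * z.2) • R n (o n))))
    (fun z => 2 * ‖z‖ ^ α * ‖z‖) fun z hz => by
      filter_upwards [hK z hz] with n hn
      simpa [o0] using hT n 0 z (by rw [o0]; exact ho n) hn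
  obtain ⟨c₀, hc₀⟩ := U.exists_tendsto_of_norm_le (f := fun n => c n (o n)) (M := Λ)
    (Filter.Eventually.of_forall fun n => (h n).c_holder.1 _ (ho n))
  obtain ⟨s₀, hs₀⟩ := U.exists_tendsto_of_norm_le (f := fun n => s n (o n)) (M := Λ)
    (Filter.Eventually.of_forall fun n => (h n).s_holder.1 _ (ho n))
  obtain ⟨b₀, hb₀⟩ := U.exists_tendsto_of_norm_le (f := fun n => b n (o n)) (M := Λ)
    (Filter.Eventually.of_forall fun n => (h n).b_holder.1 _ (ho n))
  have hc₀' : 0 < c₀ := (inv_pos.2 hΛ).trans_le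
    (ge_of_tendsto hc₀ (Filter.Eventually.of_forall fun n => (h n).c_lower _ (ho n)))
  have hb₀' : 0 < b₀ := (inv_pos.2 hΛ).trans_le
    (ge_of_tendsto hb₀ (Filter.Eventually.of_forall fun n => (h n).b_lower _ (ho n)))
  refine ⟨c₀, s₀, b₀, W₀, P₀, R₀, hc₀', hb₀', ?_, ?_, ?_, ?_, hP₀, hR₀⟩
  · intro x hx y hy
    refine le_of_tendsto ((((hW₀ y hy).sub (hW₀ x hx)).sub
      (((hP₀ x hx).const_smul (y.1 - x.1)).add ((hR₀ x hx).const_smul (y.2 - x.2)))).norm) ?_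
    filter_upwards [hK x hx, hK y hy] with n hnx hny
    refine le_of_eq_of_le ?_ (hT n x y hnx hny)
    congr 1
    have := (hr n).ne'
    have e : ∀ t : ℝ, (r n ^ α)⁻¹ * (r n)⁻¹ * (r n * t) = (r n ^ α)⁻¹ * t := fun t => by
      field_simp
    simp only [smul_sub, smul_add, smul_smul, e]
    module
  · intro x hx y hy
    refine le_of_tendsto ((hP₀ x hx).sub (hP₀ y hy)).norm ?_
    filter_upwards [hK x hx, hK y hy] with n hnx hny
    have := hP n x y hnx hny
    rw [← smul_sub, norm_smul, Real.norm_eq_abs, abs_of_pos (inv_pos.2 (hrα n)),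
      sub_sub_sub_cancel_right]
    have h0 : 0 ≤ ‖x - y‖ ^ α := Real.rpow_nonneg (norm_nonneg _) _
    linarith
  · intro z hz
    have hd : ∀ {f : ℕ → ℝ × ℝ → ℝ} {M : ℕ → ℝ}, (∀ n, HolderBdd α (Obar p₀) (M n) (f n)) →
        ∀ᶠ n in (U : Filter ℕ),
          (r n ^ α)⁻¹ * |f n (o n + r n • z) - f n (o n)| ≤ M n * ‖z‖ ^ α := by
      intro f M hf
      filter_upwards [hK z hz] with n hn
      have h1 := (hf n).2 _ hn _ (ho n)
      have h2 := inv_rpow_mul_dist_rpow (α := α) (hr n) (o n) z 0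
      rw [o0, sub_zero] at h2
      calc (r n ^ α)⁻¹ * |f n (o n + r n • z) - f n (o n)|
          ≤ (r n ^ α)⁻¹ * (M n * dist (o n + r n • z) (o n) ^ α) :=
            mul_le_mul_of_nonneg_left h1 (inv_nonneg.2 (hrα n).le)
        _ = M n * ‖z‖ ^ α := by rw [← h2]; ring
    have hlim : ∀ {u : ℕ → ℝ} {l : ℝ}, Filter.Tendsto u U (𝓝 l) →
        (∀ ε > 0, ∀ᶠ n in (U : Filter ℕ), |u n| ≤
          (ε * ‖z‖ ^ α) * (1 + 2 * Λ + 4 * Λ ^ 2)) → l = 0 := by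
      intro u l hu hb
      have h1 : ∀ ε > 0, |l| ≤ (ε * ‖z‖ ^ α) * (1 + 2 * Λ + 4 * Λ ^ 2) := fun ε hε =>
        le_of_tendsto hu.abs (hb ε hε)
      have h2 : Filter.Tendsto (fun ε : ℝ => (ε * ‖z‖ ^ α) * (1 + 2 * Λ + 4 * Λ ^ 2)) (𝓝[>] 0)
          (𝓝 ((0 * ‖z‖ ^ α) * (1 + 2 * Λ + 4 * Λ ^ 2))) := by
        refine Filter.Tendsto.mono_left ?_ nhdsWithin_le_nhds
        exact (by fun_prop : Continuous fun ε : ℝ =>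
          (ε * ‖z‖ ^ α) * (1 + 2 * Λ + 4 * Λ ^ 2)).tendsto 0
      have h3 := ge_of_tendsto h2 (Filter.eventually_of_mem self_mem_nhdsWithin h1)
      simp only [zero_mul] at h3
      exact abs_eq_zero.1 (le_antisymm h3 (abs_nonneg _))
    have hz0 : 0 ≤ ‖z‖ ^ α := Real.rpow_nonneg (norm_nonneg _) _
    have re_lim : ∀ {f : ℕ → ℂ} {l : ℂ}, Filter.Tendsto f U (𝓝 l) →
        Filter.Tendsto (fun n => (f n).re) U (𝓝 l.re) := fun hf =>
      (Complex.continuous_re.tendsto _).comp hf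
    have im_lim : ∀ {f : ℕ → ℂ} {l : ℂ}, Filter.Tendsto f U (𝓝 l) →
        Filter.Tendsto (fun n => (f n).im) U (𝓝 l.im) := fun hf =>
      (Complex.continuous_im.tendsto _).comp hf
    have hP' := hP₀ z hz
    have hR' := hR₀ z hz
    have hprod : ∀ {d A a u ε : ℝ}, |d| ≤ A → |u| ≤ ε → 0 ≤ A → A = a → |d * u| ≤ a * ε := by
      intro d A a u ε h1 h2 h3 h4
      rw [abs_mul, ← h4]
      exact mul_le_mul h1 h2 (abs_nonneg _) h3
    have hsq : ∀ {u v : ℝ} {t : ℝ}, |u| ≤ Λ → |v| ≤ Λ → 0 ≤ t →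
        t * |u - v| ≤ Λ * ‖z‖ ^ α → |t * (u ^ 2 - v ^ 2)| ≤ 2 * Λ * (Λ * ‖z‖ ^ α) := by
      intro u v t hu hv ht h1
      have e : t * (u ^ 2 - v ^ 2) = (u + v) * (t * (u - v)) := by ring
      rw [e, abs_mul, abs_mul t, abs_of_nonneg ht]
      exact mul_le_mul ((abs_add_le _ _).trans (by linarith)) h1
        (mul_nonneg ht (abs_nonneg _)) (by linarith)
    have hAll : ∀ ε > 0, ∀ᶠ n in (U : Filter ℕ),
        |c n (o n) * ((r n ^ α)⁻¹ • (R n (o n + r n • z) - R n (o n))).re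
          - ((r n ^ α)⁻¹ • (P n (o n + r n • z) - P n (o n))).im
          + s n (o n) * ((r n ^ α)⁻¹ • (R n (o n + r n • z) - R n (o n))).im|
          ≤ (ε * ‖z‖ ^ α) * (1 + 2 * Λ + 4 * Λ ^ 2) ∧
        |c n (o n) * ((r n ^ α)⁻¹ • (P n (o n + r n • z) - P n (o n))).re
          - s n (o n) * ((r n ^ α)⁻¹ • (P n (o n + r n • z) - P n (o n))).im
          + (b n (o n) ^ 2 + s n (o n) ^ 2) *
            ((r n ^ α)⁻¹ • (R n (o n + r n • z) - R n (o n))).im|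
          ≤ (ε * ‖z‖ ^ α) * (1 + 2 * Λ + 4 * Λ ^ 2) := by
      intro ε hε
      have hNε : ∀ᶠ n in (U : Filter ℕ), N n ≤ ε :=
        (hN.eventually (gt_mem_nhds hε)).mono fun n hn => le_of_lt hn
      filter_upwards [hK z hz, hsmall ε hε, hNε, hd fun n => (h n).f₁_holder,
        hd fun n => (h n).f₂_holder, hd fun n => (h n).c_holder, hd fun n => (h n).s_holder,
        hd fun n => (h n).b_holder] with n hn hsm hNn h1 h2 hc hs hb
      have hx := hsm _ hn
      have E1 := (h n).eq₁ _ hn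
      have E1' := (h n).eq₁ _ (ho n)
      have E2 := (h n).eq₂ _ hn
      have E2' := (h n).eq₂ _ (ho n)
      have sx := (h n).s_holder.1 _ hn
      have so := (h n).s_holder.1 _ (ho n)
      have bx := (h n).b_holder.1 _ hn
      have bo := (h n).b_holder.1 _ (ho n)
      simp only [Complex.smul_re, Complex.smul_im, Complex.sub_re, Complex.sub_im, smul_eq_mul]
      have ht : 0 ≤ (r n ^ α)⁻¹ := inv_nonneg.2 (hrα n).le
      generalize (r n ^ α)⁻¹ = t at *
      generalize o n + r n • z = x at *
      have Pre := (Complex.abs_re_le_norm (P n x)).trans hx.1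
      have Pim := (Complex.abs_im_le_norm (P n x)).trans hx.1
      have Rre := (Complex.abs_re_le_norm (R n x)).trans hx.2
      have Rim := (Complex.abs_im_le_norm (R n x)).trans hx.2
      have hΛz : 0 ≤ Λ * ‖z‖ ^ α := mul_nonneg hΛ.le hz0
      have bs := hsq bx bo ht hb
      have ss := hsq sx so ht hs
      have hNz : N n * ‖z‖ ^ α ≤ ε * ‖z‖ ^ α := mul_le_mul_of_nonneg_right hNn hz0
      rw [← abs_of_nonneg ht, ← abs_mul] at h1 h2 hc hs
      have E3 : Λ * ‖z‖ ^ α * ε = Λ * (ε * ‖z‖ ^ α) := by ring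
      have E4 : 2 * Λ * (Λ * ‖z‖ ^ α) * ε = 2 * (Λ ^ 2 * (ε * ‖z‖ ^ α)) := by ring
      have q1 := (hprod hc Rre hΛz rfl).trans_eq (E3 : _ = Λ * (ε * ‖z‖ ^ α))
      have q2 := (hprod hs Rim hΛz rfl).trans_eq (E3 : _ = Λ * (ε * ‖z‖ ^ α))
      have q3 := (hprod hc Pre hΛz rfl).trans_eq (E3 : _ = Λ * (ε * ‖z‖ ^ α))
      have q4 := (hprod hs Pim hΛz rfl).trans_eq (E3 : _ = Λ * (ε * ‖z‖ ^ α))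
      have q5 := (hprod bs Rim (by positivity) rfl).trans_eq (E4 : _ = 2 * (Λ ^ 2 * (ε * ‖z‖ ^ α)))
      have q6 := (hprod ss Rim (by positivity) rfl).trans_eq (E4 : _ = 2 * (Λ ^ 2 * (ε * ‖z‖ ^ α)))
      have p1 : 0 ≤ ε * ‖z‖ ^ α := mul_nonneg hε.le hz0
      have p2 : 0 ≤ Λ ^ 2 * (ε * ‖z‖ ^ α) := by positivity
      have p3 : 0 ≤ Λ * (ε * ‖z‖ ^ α) := by positivity
      rw [abs_le] at h1 h2 q1 q2 q3 q4 q5 q6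
      have I1 : c n (o n) * (t * ((R n x).re - (R n (o n)).re))
          - t * ((P n x).im - (P n (o n)).im)
          + s n (o n) * (t * ((R n x).im - (R n (o n)).im))
          = t * (f₁ n x - f₁ n (o n)) - t * (c n x - c n (o n)) * (R n x).re
            - t * (s n x - s n (o n)) * (R n x).im := by
        linear_combination t * E1 - t * E1'
      have I2 : c n (o n) * (t * ((P n x).re - (P n (o n)).re))
          - s n (o n) * (t * ((P n x).im - (P n (o n)).im))
          + (b n (o n) ^ 2 + s n (o n) ^ 2) * (t * ((R n x).im - (R n (o n)).im))
          = t * (f₂ n x - f₂ n (o n)) - t * (c n x - c n (o n)) * (P n x).re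
            + t * (s n x - s n (o n)) * (P n x).im
            - t * (b n x ^ 2 - b n (o n) ^ 2) * (R n x).im
            - t * (s n x ^ 2 - s n (o n) ^ 2) * (R n x).im := by
        linear_combination t * E2 - t * E2'
      rw [I1, I2, abs_le, abs_le]
      have E5 : ε * ‖z‖ ^ α * (1 + 2 * Λ + 4 * Λ ^ 2) = ε * ‖z‖ ^ α + 2 * (Λ * (ε * ‖z‖ ^ α)) +
          4 * (Λ ^ 2 * (ε * ‖z‖ ^ α)) := by ring
      rw [E5]
      refine ⟨⟨?_, ?_⟩, ?_, ?_⟩ <;> linarith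
    constructor
    · have := hlim (((hc₀.mul (re_lim hR')).sub (im_lim hP')).add (hs₀.mul (im_lim hR')))
        fun ε hε => (hAll ε hε).mono fun n hn => hn.1
      linarith
    · have := hlim (((hc₀.mul (re_lim hP')).sub (hs₀.mul (im_lim hP'))).add
        (((hb₀.pow 2).add (hs₀.pow 2)).mul (im_lim hR')))
        fun ε hε => (hAll ε hε).mono fun n hn => hn.2
      linarith
  · have := hW₀ 0 hK0
    simp only [smul_zero, add_zero, sub_self, Prod.fst_zero, Prod.snd_zero, mul_zero,
      zero_smul] at this
    exact tendsto_nhds_unique this tendsto_const_nhds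

end Schauder

section Improvement

open Topology

theorem tendsto_rescaled {p₀ α : ℝ} (hα : 0 < α) {U : Ultrafilter ℕ} {F : ℕ → ℝ × ℝ → ℂ}
    {r : ℕ → ℝ} (hr : ∀ n, 0 < r n) {o : ℕ → ℝ × ℝ}
    (hF : ∀ n, ∀ x ∈ Obar p₀, ∀ y ∈ Obar p₀, ‖F n x - F n y‖ ≤ dist x y ^ α)
    {F₀ : ℂ} {ξ : ℝ × ℝ}
    (hξ : ∀ᶠ n in (U : Filter ℕ), o n + r n • ξ ∈ Obar p₀)
    (hF₀ : Filter.Tendsto (fun n => (r n ^ α)⁻¹ • (F n (o n + r n • ξ) - F n (o n))) U (𝓝 F₀))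
    {x : ℕ → ℝ × ℝ} (hx : ∀ n, x n ∈ Obar p₀)
    (hxξ : Filter.Tendsto (fun n => (r n)⁻¹ • (x n - o n)) U (𝓝 ξ)) :
    Filter.Tendsto (fun n => (r n ^ α)⁻¹ • (F n (x n) - F n (o n))) U (𝓝 F₀) := by
  have h0 : Filter.Tendsto (fun n => ‖(r n)⁻¹ • (x n - o n) - ξ‖ ^ α) U (𝓝 0) := by
    have := (hxξ.sub_const ξ).norm.rpow_const (p := α) (Or.inr hα.le)
    simpa [Real.zero_rpow hα.ne'] using this
  have h1 : Filter.Tendsto (fun n => (r n ^ α)⁻¹ • (F n (x n) - F n (o n)) -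
      (r n ^ α)⁻¹ • (F n (o n + r n • ξ) - F n (o n))) U (𝓝 0) := by
    refine squeeze_zero_norm' ?_ h0
    filter_upwards [hξ] with n hn
    have hrα : 0 < r n ^ α := Real.rpow_pos_of_pos (hr n) α
    have e : o n + r n • ((r n)⁻¹ • (x n - o n)) = x n := by
      rw [smul_smul, mul_inv_cancel₀ (hr n).ne', one_smul]; abel
    rw [← smul_sub, sub_sub_sub_cancel_right, norm_smul, Real.norm_eq_abs,
      abs_of_pos (inv_pos.2 hrα), ← inv_rpow_mul_dist_rpow (hr n) (o n), e]
    exact mul_le_mul_of_nonneg_left (hF n _ (hx n) _ hn) (inv_pos.2 hrα).le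
  simpa using h1.add hF₀

theorem LinSol.false_of_blowup {p₀ α Λ : ℝ} (hα : 0 < α) (hΛ : 0 < Λ)
    {U : Ultrafilter ℕ} {N : ℕ → ℝ} (hN : Filter.Tendsto N U (𝓝 0))
    {c s b f₁ f₂ : ℕ → ℝ × ℝ → ℝ} {W P R : ℕ → ℝ × ℝ → ℂ}
    (h : ∀ n, LinSol p₀ α Λ (N n) (c n) (s n) (b n) (f₁ n) (f₂ n) (W n) (P n) (R n))
    (hH : ∀ n, GradHolder p₀ α 1 (P n) (R n))
    (hsmall : ∀ ε > 0, ∀ᶠ n in (U : Filter ℕ), ∀ x ∈ Obar p₀, ‖P n x‖ ≤ ε ∧ ‖R n x‖ ≤ ε)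
    {x y : ℕ → ℝ × ℝ} (hx : ∀ n, x n ∈ Obar p₀) (hy : ∀ n, y n ∈ Obar p₀)
    (hr : ∀ n, 0 < dist (x n) (y n))
    (hv : ∀ n, 1 / 2 * dist (x n) (y n) ^ α < ‖P n (x n) - P n (y n)‖ + ‖R n (x n) - R n (y n)‖)
    {o : ℕ → ℝ × ℝ} (ho : ∀ n, o n ∈ Obar p₀)
    {K : Set (ℝ × ℝ)} (hKc : IsClosed K) (hK0 : (0 : ℝ × ℝ) ∈ K)
    (hK : ∀ z ∈ K, ∀ᶠ n in (U : Filter ℕ), o n + dist (x n) (y n) • z ∈ Obar p₀)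
    (hxK : ∀ n, (dist (x n) (y n))⁻¹ • (x n - o n) ∈ K)
    (hyK : ∀ n, (dist (x n) (y n))⁻¹ • (y n - o n) ∈ K)
    {M : ℝ} (hM : ∀ᶠ n in (U : Filter ℕ), ‖(dist (x n) (y n))⁻¹ • (x n - o n)‖ ≤ M)
    (hLiouville : ∀ (c₀ s₀ b₀ : ℝ) (W₀ P₀ R₀ : ℝ × ℝ → ℂ), 0 < c₀ → 0 < b₀ →
      (∀ x ∈ K, ∀ y ∈ K, ‖W₀ y - W₀ x - ((y.1 - x.1) • P₀ x + (y.2 - x.2) • R₀ x)‖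
        ≤ 2 * ‖y - x‖ ^ α * ‖y - x‖) →
      (∀ x ∈ K, ∀ y ∈ K, ‖P₀ x - P₀ y‖ ≤ 2 * ‖x - y‖ ^ α) →
      (∀ x ∈ K, EllipticRel c₀ s₀ b₀ (P₀ x) (R₀ x)) → W₀ 0 = 0 →
      (∀ z ∈ K, Filter.Tendsto (fun n => (dist (x n) (y n) ^ α)⁻¹ •
        (P n (o n + dist (x n) (y n) • z) - P n (o n))) U (𝓝 (P₀ z))) →
      ∀ z ∈ K, P₀ z = P₀ 0 ∧ R₀ z = R₀ 0) : False := by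
  obtain ⟨c₀, s₀, b₀, W₀, P₀, R₀, hc₀, hb₀, hT, hP, hE, hW, hPt, hRt⟩ :=
    LinSol.exists_blowup_limit hα hΛ hN h hH hsmall ho hr hK0 hK
  have hconst := hLiouville c₀ s₀ b₀ W₀ P₀ R₀ hc₀ hb₀ hT hP hE hW hPt
  have hM' : ∀ᶠ n in (U : Filter ℕ), ‖(dist (x n) (y n))⁻¹ • (y n - o n)‖ ≤ M + 1 := by
    filter_upwards [hM] with n hn
    have e : (dist (x n) (y n))⁻¹ • (y n - o n) =
        (dist (x n) (y n))⁻¹ • (x n - o n) - (dist (x n) (y n))⁻¹ • (x n - y n) := by module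
    rw [e]
    refine (norm_sub_le _ _).trans (add_le_add hn (le_of_eq ?_))
    rw [norm_smul, ← dist_eq_norm, Real.norm_eq_abs, abs_of_pos (inv_pos.2 (hr n)),
      inv_mul_cancel₀ (hr n).ne']
  obtain ⟨ξ, hξ⟩ := U.exists_tendsto_of_norm_le hM
  obtain ⟨η, hη⟩ := U.exists_tendsto_of_norm_le hM'
  have hξK : ξ ∈ K := hKc.mem_of_tendsto hξ (Filter.Eventually.of_forall hxK)
  have hηK : η ∈ K := hKc.mem_of_tendsto hη (Filter.Eventually.of_forall hyK)
  have hPn : ∀ n, ∀ x ∈ Obar p₀, ∀ y ∈ Obar p₀, ‖P n x - P n y‖ ≤ dist x y ^ α :=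
    fun n x hx y hy => (le_add_of_nonneg_right (norm_nonneg _)).trans
      ((hH n x hx y hy).trans_eq (one_mul _))
  have hRn : ∀ n, ∀ x ∈ Obar p₀, ∀ y ∈ Obar p₀, ‖R n x - R n y‖ ≤ dist x y ^ α :=
    fun n x hx y hy => (le_add_of_nonneg_left (norm_nonneg _)).trans
      ((hH n x hx y hy).trans_eq (one_mul _))
  have l1 := tendsto_rescaled hα hr hPn (hK ξ hξK) (hPt ξ hξK) hx hξ
  have l2 := tendsto_rescaled hα hr hPn (hK η hηK) (hPt η hηK) hy hη
  have l3 := tendsto_rescaled hα hr hRn (hK ξ hξK) (hRt ξ hξK) hx hξ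
  have l4 := tendsto_rescaled hα hr hRn (hK η hηK) (hRt η hηK) hy hη
  have lim := (l1.sub l2).norm.add (l3.sub l4).norm
  rw [(hconst ξ hξK).1, (hconst ξ hξK).2, (hconst η hηK).1, (hconst η hηK).2] at lim
  simp only [sub_self, norm_zero, add_zero] at lim
  have : (1 / 2 : ℝ) ≤ 0 := by
    refine ge_of_tendsto lim (Filter.Eventually.of_forall fun n => ?_)
    have hrα : 0 < dist (x n) (y n) ^ α := Real.rpow_pos_of_pos (hr n) α
    rw [← smul_sub, ← smul_sub, sub_sub_sub_cancel_right, sub_sub_sub_cancel_right, norm_smul,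
      norm_smul, Real.norm_eq_abs, abs_of_pos (inv_pos.2 hrα), ← mul_add, inv_mul_eq_div,
      le_div_iff₀ hrα]
    exact (hv n).le
  norm_num at this

theorem LinSol.eventually_grad_small {p₀ α Λ : ℝ} (hp₀ : p₀ < 0) (hα : 0 < α)
    {U : Ultrafilter ℕ} {N : ℕ → ℝ} (hN : Filter.Tendsto N U (𝓝 0))
    {c s b f₁ f₂ : ℕ → ℝ × ℝ → ℝ} {W P R : ℕ → ℝ × ℝ → ℂ}
    (h : ∀ n, LinSol p₀ α Λ (N n) (c n) (s n) (b n) (f₁ n) (f₂ n) (W n) (P n) (R n))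
    (hH : ∀ n, GradHolder p₀ α 1 (P n) (R n)) (ε : ℝ) (hε : 0 < ε) :
    ∀ᶠ n in (U : Filter ℕ), ∀ x ∈ Obar p₀, ‖P n x‖ ≤ ε ∧ ‖R n x‖ ≤ ε := by
  have h1 : Filter.Tendsto (fun l : ℝ => 2 * 1 * l ^ α) (𝓝[>] 0) (𝓝 0) := by
    have : ContinuousAt (fun l : ℝ => 2 * 1 * l ^ α) 0 :=
      continuousAt_const.mul (continuousAt_id.rpow_const (Or.inr hα.le))
    have := this.tendsto
    simp only [Real.zero_rpow hα.ne', mul_zero] at this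
    exact this.mono_left nhdsWithin_le_nhds
  have h2 : ∀ᶠ l : ℝ in 𝓝[>] 0, l < -p₀ / 2 :=
    nhdsWithin_le_nhds (gt_mem_nhds (by linarith))
  obtain ⟨l, hl1, hl2, hl3⟩ := ((h1.eventually (gt_mem_nhds (half_pos hε))).and
    (h2.and self_mem_nhdsWithin)).exists
  have hl0 : 0 < l := hl3
  have h3 : Filter.Tendsto (fun n => 2 * N n / l) U (𝓝 0) := by
    simpa using (hN.const_mul 2).div_const l
  filter_upwards [h3.eventually (gt_mem_nhds (half_pos hε))] with n hn x hx
  have := (h n).norm_grad_le hα zero_le_one (hH n) hl0 (by linarith) hx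
  exact ⟨this.1.trans (by linarith), this.2.trans (by linarith)⟩

theorem LinSol.exists_improvement {p₀ α Λ : ℝ} (hp₀ : p₀ < 0) (hα0 : 0 < α) (hα1 : α < 1)
    (hΛ : 0 < Λ) : ∃ η > 0, ∀ (c s b f₁ f₂ : ℝ × ℝ → ℝ) (W P R : ℝ × ℝ → ℂ),
      LinSol p₀ α Λ η c s b f₁ f₂ W P R → GradHolder p₀ α 1 P R →
      GradHolder p₀ α (1 / 2) P R := by
  by_contra! hcon
  choose c s b f₁ f₂ W P R h hH hnot using fun n : ℕ =>
    hcon (1 / ((n : ℝ) + 1)) Nat.one_div_pos_of_nat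
  simp only [GradHolder, not_forall, not_le] at hnot
  choose x hx y hy hv using hnot
  have hr : ∀ n, 0 < dist (x n) (y n) := fun n => by
    refine dist_pos.2 fun e => ?_
    have := hv n
    simp [e, Real.zero_rpow hα0.ne'] at this
  set U : Ultrafilter ℕ := Filter.hyperfilter ℕ
  have hN : Filter.Tendsto (fun n : ℕ => 1 / ((n : ℝ) + 1)) U (𝓝 0) :=
    tendsto_one_div_add_atTop_nhds_zero_nat.mono_left Nat.hyperfilter_le_atTop
  have hsmall := LinSol.eventually_grad_small hp₀ hα0 hN h hH
  have hr0 : ∀ δ > 0, ∀ᶠ n in (U : Filter ℕ), dist (x n) (y n) < δ := by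
    intro δ hδ
    have hδα : 0 < δ ^ α := Real.rpow_pos_of_pos hδ α
    filter_upwards [hsmall (δ ^ α / 8) (by positivity)] with n hn
    refine lt_of_not_ge fun hge => ?_
    have h1 := Real.rpow_le_rpow hδ.le hge hα0.le
    have h2 := hv n
    have h3 := norm_sub_le (P n (x n)) (P n (y n))
    have h4 := norm_sub_le (R n (x n)) (R n (y n))
    have h5 := hn _ (hx n)
    have h6 := hn _ (hy n)
    linarith
  have hx2 : ∀ n, (x n).2 ∈ Set.Icc p₀ 0 := fun n => (hx n).2
  have hy2 : ∀ n, (y n).2 ∈ Set.Icc p₀ 0 := fun n => (hy n).2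
  by_cases hA : ∃ M : ℝ, ∀ᶠ n in (U : Filter ℕ), (x n).2 - p₀ ≤ M * dist (x n) (y n)
  · obtain ⟨M, hM⟩ := hA
    have hin : ∀ n (z : ℝ × ℝ), (((x n).1, p₀) + dist (x n) (y n) • z : ℝ × ℝ) =
      ((x n).1 + dist (x n) (y n) * z.1, p₀ + dist (x n) (y n) * z.2) := fun n z => rfl
    refine LinSol.false_of_blowup hα0 hΛ hN h hH hsmall hx hy hr hv (o := fun n => ((x n).1, p₀))
      (fun n => ⟨trivial, Set.left_mem_Icc.2 hp₀.le⟩) (K := {z | 0 ≤ z.2})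
      (isClosed_le continuous_const continuous_snd) (le_refl (0 : ℝ)) ?_ ?_ ?_ (M := M) ?_ ?_
    · intro z (hz : 0 ≤ z.2)
      filter_upwards [hr0 (-p₀ / (z.2 + 1)) (div_pos (by linarith) (by linarith))] with n hn
      rw [hin]
      refine ⟨trivial, ?_, ?_⟩
      · have := mul_nonneg (hr n).le hz
        simpa using this
      · rw [lt_div_iff₀ (by linarith)] at hn
        have := hr n
        change p₀ + dist (x n) (y n) * z.2 ≤ 0
        linarith
    · intro n
      exact mul_nonneg (inv_pos.2 (hr n)).le (sub_nonneg.2 (hx2 n).1)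
    · intro n
      exact mul_nonneg (inv_pos.2 (hr n)).le (sub_nonneg.2 (hy2 n).1)
    · filter_upwards [hM] with n hn
      have e : x n - ((x n).1, p₀) = (0, (x n).2 - p₀) := by
        ext <;> simp
      rw [e, norm_smul, Real.norm_eq_abs, abs_of_pos (inv_pos.2 (hr n)), inv_mul_eq_div,
        div_le_iff₀ (hr n)]
      have := (hx2 n).1
      simpa [Prod.norm_def, abs_of_nonneg, this] using hn
    · intro c₀ s₀ b₀ W₀ P₀ R₀ hc₀ hb₀ hT hP hE hW hPt
      refine fun z hz => elliptic_liouville_upper hα0 hα1 zero_le_two hc₀ hb₀ hT hP hE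
        (Or.inl fun t => ?_) hW z hz
      have h1 := (Complex.continuous_im.tendsto _).comp (hPt (t, 0) (le_refl (0 : ℝ)))
      refine tendsto_nhds_unique (h1.congr fun n => ?_) tendsto_const_nhds
      rw [Function.comp_apply, hin]
      simp [(h n).bottom]
  by_cases hB : ∃ M : ℝ, ∀ᶠ n in (U : Filter ℕ), -(x n).2 ≤ M * dist (x n) (y n)
  · obtain ⟨M, hM⟩ := hB
    have hin : ∀ n (z : ℝ × ℝ), (((x n).1, 0) + dist (x n) (y n) • z : ℝ × ℝ) =
      ((x n).1 + dist (x n) (y n) * z.1, 0 + dist (x n) (y n) * z.2) := fun n z => rfl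
    refine LinSol.false_of_blowup hα0 hΛ hN h hH hsmall hx hy hr hv (o := fun n => ((x n).1, 0))
      (fun n => ⟨trivial, Set.right_mem_Icc.2 hp₀.le⟩) (K := {z | z.2 ≤ 0})
      (isClosed_le continuous_snd continuous_const) (le_refl (0 : ℝ)) ?_ ?_ ?_ (M := M) ?_ ?_
    · intro z (hz : z.2 ≤ 0)
      filter_upwards [hr0 (-p₀ / (-z.2 + 1)) (div_pos (by linarith) (by linarith))] with n hn
      rw [hin]
      refine ⟨trivial, ?_, ?_⟩
      · rw [lt_div_iff₀ (by linarith)] at hn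
        have := hr n
        change p₀ ≤ 0 + dist (x n) (y n) * z.2
        linarith
      · have := mul_nonpos_of_nonneg_of_nonpos (hr n).le hz
        simpa using this
    · intro n
      exact mul_nonpos_of_nonneg_of_nonpos (inv_pos.2 (hr n)).le (sub_nonpos.2 (hx2 n).2)
    · intro n
      exact mul_nonpos_of_nonneg_of_nonpos (inv_pos.2 (hr n)).le (sub_nonpos.2 (hy2 n).2)
    · filter_upwards [hM] with n hn
      have e : x n - ((x n).1, 0) = (0, (x n).2) := by
        ext <;> simp
      rw [e, norm_smul, Real.norm_eq_abs, abs_of_pos (inv_pos.2 (hr n)), inv_mul_eq_div,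
        div_le_iff₀ (hr n)]
      have := (hx2 n).2
      simpa [Prod.norm_def, abs_of_nonpos, this] using hn
    · intro c₀ s₀ b₀ W₀ P₀ R₀ hc₀ hb₀ hT hP hE hW hPt
      refine fun z hz => elliptic_liouville_lower hα0 hα1 zero_le_two hc₀ hb₀ hT hP hE
        (Or.inr fun t => ?_) hW z hz
      have h1 := (Complex.continuous_re.tendsto _).comp (hPt (t, 0) (le_refl (0 : ℝ)))
      refine tendsto_nhds_unique h1 (squeeze_zero_norm (fun n => ?_)
        (by simpa using hN.mul_const (|t| ^ α)))
      have hrα : 0 < dist (x n) (y n) ^ α := Real.rpow_pos_of_pos (hr n) α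
      rw [Function.comp_apply, hin, Complex.smul_re, Complex.sub_re, norm_smul, Real.norm_eq_abs,
        Real.norm_eq_abs, abs_of_pos (inv_pos.2 hrα), inv_mul_eq_div, div_le_iff₀ hrα]
      have := (h n).top ((x n).1 + dist (x n) (y n) * t) (x n).1
      rw [add_sub_cancel_left, abs_mul, abs_of_pos (hr n),
        Real.mul_rpow (hr n).le (abs_nonneg _)] at this
      simp only [mul_zero, add_zero]
      refine this.trans (le_of_eq ?_)
      ring
  · push Not at hA hB
    refine LinSol.false_of_blowup hα0 hΛ hN h hH hsmall hx hy hr hv (o := x) hx (K := Set.univ)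
      isClosed_univ trivial ?_ (fun _ => trivial) (fun _ => trivial) (M := 0) ?_ ?_
    · intro z _
      filter_upwards [hA ‖z‖, hB ‖z‖] with n h1 h2
      have h3 : |z.2| ≤ ‖z‖ := norm_snd_le z
      rw [abs_le] at h3
      have h4 := mul_le_mul_of_nonneg_left h3.1 (hr n).le
      have h5 := mul_le_mul_of_nonneg_left h3.2 (hr n).le
      refine ⟨trivial, ?_, ?_⟩
      · change p₀ ≤ (x n).2 + dist (x n) (y n) * z.2
        linarith
      · change (x n).2 + dist (x n) (y n) * z.2 ≤ 0
        linarith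
    · simp
    · intro c₀ s₀ b₀ W₀ P₀ R₀ hc₀ hb₀ hT hP hE hW hPt z _
      exact elliptic_liouville_plane hα0 hα1 zero_le_two hc₀ hb₀ (fun x y => hT x trivial y trivial)
        (fun x y => hP x trivial y trivial) (fun x => hE x trivial) z

theorem GradHolder.mono {p₀ α K K' : ℝ} {P R : ℝ × ℝ → ℂ} (h : GradHolder p₀ α K P R)
    (hK : K ≤ K') : GradHolder p₀ α K' P R := fun x hx y hy =>
  (h x hx y hy).trans (mul_le_mul_of_nonneg_right hK (Real.rpow_nonneg dist_nonneg _))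

theorem GradHolder.smul {p₀ α K t : ℝ} {P R : ℝ × ℝ → ℂ} (ht : 0 ≤ t)
    (h : GradHolder p₀ α K P R) :
    GradHolder p₀ α (t * K) (fun x => t • P x) (fun x => t • R x) := fun x hx y hy => by
  rw [← smul_sub, ← smul_sub, norm_smul, norm_smul, Real.norm_eq_abs, abs_of_nonneg ht,
    ← mul_add, mul_assoc]
  exact mul_le_mul_of_nonneg_left (h x hx y hy) ht

theorem HolderBdd.const_smul_of_le {E : Type*} [NormedAddCommGroup E] [NormedSpace ℝ E]
    {α N N' t : ℝ} {s : Set (ℝ × ℝ)} {f : ℝ × ℝ → E} (ht : 0 ≤ t) (h : HolderBdd α s N f)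
    (hN : t * N ≤ N') : HolderBdd α s N' (fun x => t • f x) := by
  refine ⟨fun x hx => ?_, fun x hx y hy => ?_⟩
  · rw [norm_smul, Real.norm_eq_abs, abs_of_nonneg ht]
    exact (mul_le_mul_of_nonneg_left (h.1 x hx) ht).trans hN
  · rw [← smul_sub, norm_smul, Real.norm_eq_abs, abs_of_nonneg ht]
    refine (mul_le_mul_of_nonneg_left (h.2 x hx y hy) ht).trans ?_
    rw [← mul_assoc]
    exact mul_le_mul_of_nonneg_right hN (Real.rpow_nonneg dist_nonneg _)

theorem LinSol.smul {p₀ α Λ N N' t : ℝ} {c s b f₁ f₂ : ℝ × ℝ → ℝ} {W P R : ℝ × ℝ → ℂ}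
    (ht : 0 ≤ t) (hN : t * N ≤ N') (h : LinSol p₀ α Λ N c s b f₁ f₂ W P R) :
    LinSol p₀ α Λ N' c s b (fun x => t • f₁ x) (fun x => t • f₂ x) (fun x => t • W x)
      (fun x => t • P x) (fun x => t • R x) where
  c_lower := h.c_lower
  b_lower := h.b_lower
  c_holder := h.c_holder
  s_holder := h.s_holder
  b_holder := h.b_holder
  f₁_holder := h.f₁_holder.const_smul_of_le ht hN
  f₂_holder := h.f₂_holder.const_smul_of_le ht hN
  bound x hx := by
    rw [norm_smul, Real.norm_eq_abs, abs_of_nonneg ht]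
    exact (mul_le_mul_of_nonneg_left (h.bound x hx) ht).trans hN
  deriv_q x hx := (h.deriv_q x hx).const_smul t
  deriv_p x hx := (h.deriv_p x hx).const_smul t
  eq₁ x hx := by
    simp only [Complex.smul_re, Complex.smul_im, smul_eq_mul]
    linear_combination t * h.eq₁ x hx
  eq₂ x hx := by
    simp only [Complex.smul_re, Complex.smul_im, smul_eq_mul]
    linear_combination t * h.eq₂ x hx
  bottom q := by simp [h.bottom q]
  top q q' := by
    simp only [Complex.smul_re, smul_eq_mul]
    rw [← mul_sub, abs_mul, abs_of_nonneg ht]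
    refine (mul_le_mul_of_nonneg_left (h.top q q') ht).trans ?_
    rw [← mul_assoc]
    exact mul_le_mul_of_nonneg_right hN (Real.rpow_nonneg (abs_nonneg _) _)

/-- The a priori Schauder estimate for the linear system. -/
theorem LinSol.schauder {p₀ α Λ : ℝ} (hp₀ : p₀ < 0) (hα0 : 0 < α) (hα1 : α < 1)
    (hΛ : 0 < Λ) : ∃ C > 0, ∀ (N K : ℝ) (c s b f₁ f₂ : ℝ × ℝ → ℝ) (W P R : ℝ × ℝ → ℂ), 0 < N →
      LinSol p₀ α Λ N c s b f₁ f₂ W P R → GradHolder p₀ α K P R →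
      HolderBdd α (Obar p₀) (C * N) P ∧ HolderBdd α (Obar p₀) (C * N) R := by
  obtain ⟨η, hη, himp⟩ := LinSol.exists_improvement hp₀ hα0 hα1 hΛ
  set l := -p₀ / 2 with hl
  have hl0 : 0 < l := by rw [hl]; linarith
  set C := 1 / η + (2 / l + 2 * (1 / η) * l ^ α) with hC
  have hlα : 0 < l ^ α := Real.rpow_pos_of_pos hl0 α
  have hη' : 0 < 1 / η := by positivity
  have hC2 : 0 ≤ 2 / l + 2 * (1 / η) * l ^ α := by positivity
  refine ⟨C, by positivity, fun N K c s b f₁ f₂ W P R hN h hG => ?_⟩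
  have half : ∀ K, 0 < K → N ≤ η * K → GradHolder p₀ α K P R → GradHolder p₀ α (K / 2) P R := by
    intro K hK hNK hGK
    have h1 := h.smul (t := K⁻¹) (N' := η) (inv_pos.2 hK).le (by
      rw [inv_mul_eq_div, div_le_iff₀ hK]; exact hNK)
    have h2 := hGK.smul (t := K⁻¹) (inv_pos.2 hK).le
    rw [inv_mul_cancel₀ hK.ne'] at h2
    have h3 := (himp _ _ _ _ _ _ _ _ h1 h2).smul hK.le
    simp only [smul_smul, mul_inv_cancel₀ hK.ne', one_smul] at h3
    exact h3.mono (le_of_eq (by ring))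
  have key : GradHolder p₀ α (N / η) P R := by
    have hNη : 0 < N / η := by positivity
    set K' := max K (N / η)
    have hind : ∀ n : ℕ, GradHolder p₀ α (max (K' / 2 ^ n) (N / η)) P R := by
      intro n
      induction n with
      | zero => exact hG.mono (by simp [K'])
      | succ n ih =>
        rcases le_total (N / η) (K' / 2 ^ n) with hc | hc
        · rw [max_eq_left hc] at ih
          refine (half _ (hNη.trans_le hc) ?_ ih).mono ?_
          · rwa [mul_comm, ← div_le_iff₀ hη]
          · refine le_trans (le_of_eq ?_) (le_max_left _ _)
            rw [pow_succ]; field_simp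
        · rw [max_eq_right hc] at ih
          exact ih.mono (le_max_right _ _)
    obtain ⟨n, hn⟩ := pow_unbounded_of_one_lt (K' / (N / η)) one_lt_two
    refine (hind n).mono (max_le ?_ le_rfl)
    rw [div_lt_iff₀ hNη] at hn
    rw [div_le_iff₀ (by positivity)]
    linarith
  have hH : ∀ x ∈ Obar p₀, ∀ y ∈ Obar p₀, ‖P x - P y‖ + ‖R x - R y‖ ≤ C * N * dist x y ^ α :=
    key.mono (by rw [hC, add_mul, one_div_mul_eq_div]; nlinarith)
  have hS : ∀ x ∈ Obar p₀, ‖P x‖ ≤ C * N ∧ ‖R x‖ ≤ C * N := by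
    intro x hx
    have e : 2 * N / l + 2 * (N / η) * l ^ α ≤ C * N := by
      have : 2 * N / l + 2 * (N / η) * l ^ α = (2 / l + 2 * (1 / η) * l ^ α) * N := by ring
      rw [this]
      exact mul_le_mul_of_nonneg_right (by rw [hC]; linarith) hN.le
    have := h.norm_grad_le hα0 (by positivity) key hl0 (by rw [hl]; linarith) hx
    exact ⟨this.1.trans e, this.2.trans e⟩
  exact ⟨⟨fun x hx => (hS x hx).1, fun x hx y hy =>
      (le_add_of_nonneg_right (norm_nonneg _)).trans (hH x hx y hy)⟩,
    fun x hx => (hS x hx).2, fun x hx y hy =>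
      (le_add_of_nonneg_left (norm_nonneg _)).trans (hH x hx y hy)⟩

end Improvement

section Potential

open Topology

theorem sub_eq_integral_of_forall_test {s : Set ℝ} (hs : IsOpen s) (hs' : s.OrdConnected)
    {u v : ℝ → ℝ} (hu : Continuous u) (hv : Continuous v)
    (h : ∀ θ : ℝ → ℝ, ContDiff ℝ 1 θ → HasCompactSupport θ → tsupport θ ⊆ s →
      ∫ t, (u t * deriv θ t + v t * θ t) = 0) {x y : ℝ} (hx : x ∈ s) (hy : y ∈ s) :
    u y - u x = ∫ t in x..y, v t := by
  set V : ℝ → ℝ := fun t => ∫ τ in x..t, v τ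
  have hV : ∀ t, HasDerivAt V (v t) t := fun t => hv.integral_hasStrictDerivAt x t |>.hasDerivAt
  have hVc : Continuous V := continuous_iff_continuousAt.2 fun t => (hV t).continuousAt
  set w : ℝ → ℝ := fun t => u t - V t
  have hw : Continuous w := hu.sub hVc
  have htest : ∀ θ : ℝ → ℝ, ContDiff ℝ 1 θ → HasCompactSupport θ → tsupport θ ⊆ s →
      ∫ t, deriv θ t * w t = 0 := by
    intro θ h1 h2 h3
    have hd : Continuous (deriv θ) := h1.continuous_deriv le_rfl
    have hdc : HasCompactSupport (deriv θ) := h2.deriv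
    have i1 : Integrable fun t => v t * θ t + V t * deriv θ t :=
      ((hv.mul h1.continuous).integrable_of_hasCompactSupport h2.mul_left).add
        ((hVc.mul hd).integrable_of_hasCompactSupport hdc.mul_left)
    have i2 : Integrable fun t => u t * deriv θ t + v t * θ t :=
      ((hu.mul hd).integrable_of_hasCompactSupport hdc.mul_left).add
        ((hv.mul h1.continuous).integrable_of_hasCompactSupport h2.mul_left)
    have e := integral_eq_zero_of_hasDerivAt_of_integrable
      (f := fun t => V t * θ t) (f' := fun t => v t * θ t + V t * deriv θ t)
      (fun t => (hV t).mul ((h1.differentiable one_ne_zero) t).hasDerivAt) i1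
      ((hVc.mul h1.continuous).integrable_of_hasCompactSupport h2.mul_left)
    have := integral_sub i2 i1
    rw [h θ h1 h2 h3, e, sub_zero] at this
    rw [← this]
    exact integral_congr_ae (Filter.Eventually.of_forall fun t => by simp only [w]; ring)
  have hmean : ∀ G : ℝ → ℝ, Continuous G → HasCompactSupport G → tsupport G ⊆ s →
      ∫ t, G t = 0 → ∫ t, G t * w t = 0 := by
    intro G hG hGc hGs hG0
    rcases (tsupport G).eq_empty_or_nonempty with hemp | hne
    · have : G = 0 := by simpa [tsupport_eq_empty_iff] using hemp
      simp [this]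
    have hK : IsCompact (tsupport G) := hGc
    set c := sInf (tsupport G)
    set d := sSup (tsupport G)
    have hcd : Set.Icc c d ⊆ s := hs'.out (hGs (hK.sInf_mem hne)) (hGs (hK.sSup_mem hne))
    have hsub : tsupport G ⊆ Set.Icc c d := fun t ht =>
      ⟨csInf_le hK.bddBelow ht, le_csSup hK.bddAbove ht⟩
    have hlow : ∀ t, t < c → G t = 0 := fun t ht =>
      image_eq_zero_of_notMem_tsupport fun h => absurd (hsub h).1 (not_le.2 ht)
    have hhigh : ∀ t, d < t → G t = 0 := fun t ht =>
      image_eq_zero_of_notMem_tsupport fun h => absurd (hsub h).2 (not_le.2 ht)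
    set θ : ℝ → ℝ := fun t => ∫ τ in c..t, G τ
    have hθ : ∀ t, HasDerivAt θ (G t) t := fun t => hG.integral_hasStrictDerivAt c t |>.hasDerivAt
    have hdθ : deriv θ = G := funext fun t => (hθ t).deriv
    have hint : Integrable G := hG.integrable_of_hasCompactSupport hGc
    have hsupp : Function.support θ ⊆ Set.Icc c d := by
      intro t ht
      by_contra hcon
      apply ht
      rw [Set.mem_Icc, not_and_or, not_le, not_le] at hcon
      rcases hcon with h1 | h1
      · change ∫ τ in c..t, G τ = 0
        rw [intervalIntegral.integral_symm, intervalIntegral.integral_of_le h1.le,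
          ← integral_Ico_eq_integral_Ioc, setIntegral_eq_zero_of_forall_eq_zero, neg_zero]
        exact fun τ hτ => hlow τ hτ.2
      · change ∫ τ in c..t, G τ = 0
        rw [← hG0, ← intervalIntegral.integral_Iic_sub_Iic hint.integrableOn hint.integrableOn,
          ← intervalIntegral.integral_Iic_add_Ioi (b := t) hint.integrableOn hint.integrableOn,
          setIntegral_eq_zero_of_forall_eq_zero (t := Set.Ioi t)
            (fun τ hτ => hhigh τ (h1.trans hτ)), integral_Iic_eq_integral_Iio (x := c),
          setIntegral_eq_zero_of_forall_eq_zero (t := Set.Iio c) (fun τ hτ => hlow τ hτ)]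
        simp
    have hts : tsupport θ ⊆ Set.Icc c d := closure_minimal hsupp isClosed_Icc
    rw [← hdθ]
    refine htest θ ?_ (isCompact_Icc.of_isClosed_subset (isClosed_tsupport θ) hts) (hts.trans hcd)
    rw [contDiff_one_iff_deriv]
    exact ⟨fun t => (hθ t).differentiableAt, hdθ ▸ hG⟩
  obtain ⟨g₀, g₀s, g₀c, g₀d, g₀r, g₀x⟩ := exists_contDiff_tsupport_subset (n := 0)
    (hs.mem_nhds hx)
  have g₀pos : 0 < ∫ t, g₀ t := g₀d.continuous.integral_pos_of_hasCompactSupport_nonneg_nonzero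
    g₀c (fun t => (g₀r ⟨t, rfl⟩).1) (x := x) (by simp [g₀x])
  set I₀ := ∫ t, g₀ t
  set κ := (∫ t, g₀ t * w t) / I₀
  have hae : ∀ᵐ t, t ∈ s → w t - κ = 0 := by
    refine hs.ae_eq_zero_of_integral_contDiff_smul_eq_zero
      ((hw.sub continuous_const).locallyIntegrable.locallyIntegrableOn s) fun g gd gc gs => ?_
    have gi : Integrable g := gd.continuous.integrable_of_hasCompactSupport gc
    have g₀i : Integrable g₀ := g₀d.continuous.integrable_of_hasCompactSupport g₀c
    have gwi : Integrable fun t => g t * w t :=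
      (gd.continuous.mul hw).integrable_of_hasCompactSupport gc.mul_right
    have g₀wi : Integrable fun t => g₀ t * w t :=
      (g₀d.continuous.mul hw).integrable_of_hasCompactSupport g₀c.mul_right
    set a := (∫ t, g t) / I₀ with ha
    have hsupp : tsupport (fun t => g t - a * g₀ t) ⊆ s := by
      refine (tsupport_sub g fun t => a * g₀ t).trans (Set.union_subset gs ?_)
      exact (tsupport_mul_subset_right (f := fun _ => a) (g := g₀)).trans g₀s
    have h1 := hmean (fun t => g t - a * g₀ t) (gd.continuous.sub (g₀d.continuous.const_mul a))
      (gc.sub g₀c.mul_left) hsupp (by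
        rw [integral_sub gi (g₀i.const_mul a), integral_const_mul, ha]
        field_simp
        simp [I₀])
    have h2 : ∫ t, (g t - a * g₀ t) * w t = (∫ t, g t * w t) - a * ∫ t, g₀ t * w t := by
      rw [← integral_const_mul, ← integral_sub gwi (g₀wi.const_mul a)]
      exact integral_congr_ae (Filter.Eventually.of_forall fun t => by simp only []; ring)
    have h3 : ∫ t, g t • (w t - κ) = (∫ t, g t * w t) - κ * ∫ t, g t := by
      rw [← integral_const_mul, ← integral_sub gwi (gi.const_mul κ)]
      exact integral_congr_ae (Filter.Eventually.of_forall fun t => by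
        simp only [smul_eq_mul]; ring)
    rw [h3, ← h1, h2, ha]
    simp only [κ]
    ring
  have heq : Set.EqOn w (fun _ => κ) s := by
    refine MeasureTheory.Measure.eqOn_open_of_ae_eq (μ := volume) ?_ hs hw.continuousOn
      continuousOn_const
    rw [Filter.EventuallyEq, ae_restrict_iff' hs.measurableSet]
    filter_upwards [hae] with t ht hts
    linarith [ht hts]
  have h1 := heq hx
  have h2 := heq hy
  simp only [w, V, intervalIntegral.integral_same] at h1 h2
  linarith

theorem exists_potential {p₀ : ℝ} (hp₀ : p₀ < 0) {Φ₁ Φ₂ : ℝ × ℝ → ℝ} (h₁ : Continuous Φ₁)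
    (h₂ : Continuous Φ₂)
    (hw : ∀ θ χ : ℝ → ℝ, ContDiff ℝ 1 θ → HasCompactSupport θ → ContDiff ℝ 1 χ →
      HasCompactSupport χ → tsupport χ ⊆ Set.Ioo p₀ 0 →
      ∫ q, ∫ p in p₀..0, (Φ₁ (q, p) * (deriv θ q * χ p) - Φ₂ (q, p) * (θ q * deriv χ p)) = 0) :
    ∃ S : ℝ × ℝ → ℝ, (∀ x, HasDerivAt (fun p => S (x.1, p)) (Φ₁ x) x.2) ∧
      ∀ x ∈ Obar p₀, HasDerivAt (fun q => S (q, x.2)) (Φ₂ x) x.1 := by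
  have stage1 : ∀ χ : ℝ → ℝ, ContDiff ℝ 1 χ → HasCompactSupport χ → tsupport χ ⊆ Set.Ioo p₀ 0 →
      ∀ q : ℝ, (∫ p in p₀..0, Φ₁ (q, p) * χ p) - (∫ p in p₀..0, Φ₁ (0, p) * χ p) =
        ∫ t in (0 : ℝ)..q, -∫ p in p₀..0, Φ₂ (t, p) * deriv χ p := by
    intro χ χd χc χs q
    have χ' : Continuous (deriv χ) := χd.continuous_deriv le_rfl
    have χ0 : Continuous χ := χd.continuous
    refine sub_eq_integral_of_forall_test (s := Set.univ) isOpen_univ Set.ordConnected_univ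
      (u := fun q => ∫ p in p₀..0, Φ₁ (q, p) * χ p)
      (v := fun q => -∫ p in p₀..0, Φ₂ (q, p) * deriv χ p) (by fun_prop) (by fun_prop)
      (fun θ θd θc _ => ?_) trivial trivial
    refine Eq.trans ?_ (hw θ χ θd θc χd χc χs)
    refine integral_congr_ae (Filter.Eventually.of_forall fun t => ?_)
    have c1 : Continuous fun p => Φ₁ (t, p) * (deriv θ t * χ p) := by fun_prop
    have c2 : Continuous fun p => Φ₂ (t, p) * (θ t * deriv χ p) := by fun_prop
    simp only
    rw [intervalIntegral.integral_sub (c1.intervalIntegrable _ _) (c2.intervalIntegrable _ _),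
      neg_mul, ← sub_eq_add_neg, ← intervalIntegral.integral_mul_const,
      ← intervalIntegral.integral_mul_const]
    congr 1 <;> exact intervalIntegral.integral_congr fun p _ => by ring
  have hle : Set.uIcc p₀ 0 = Set.Icc p₀ 0 := Set.uIcc_of_le hp₀.le
  have stage2 : ∀ q : ℝ, ∀ p₁ ∈ Set.Ioo p₀ 0, ∀ p₂ ∈ Set.Ioo p₀ 0,
      (∫ t in (0 : ℝ)..q, Φ₂ (t, p₂)) - (∫ t in (0 : ℝ)..q, Φ₂ (t, p₁)) =
        ∫ p in p₁..p₂, (Φ₁ (q, p) - Φ₁ (0, p)) := by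
    intro q p₁ hp₁ p₂ hp₂
    refine sub_eq_integral_of_forall_test (s := Set.Ioo p₀ 0) isOpen_Ioo Set.ordConnected_Ioo
      (u := fun p => ∫ t in (0 : ℝ)..q, Φ₂ (t, p)) (v := fun p => Φ₁ (q, p) - Φ₁ (0, p))
      (by fun_prop) (by fun_prop) (fun χ χd χc χs => ?_) hp₁ hp₂
    have χ' : Continuous (deriv χ) := χd.continuous_deriv le_rfl
    have χ0 : Continuous χ := χd.continuous
    have e1 := stage1 χ χd χc χs q
    have hout : ∀ p ∉ Set.Ioc p₀ 0, χ p = 0 ∧ deriv χ p = 0 := by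
      intro p hp
      have h1 : p ∉ tsupport χ := fun h => hp (Set.Ioo_subset_Ioc_self (χs h))
      exact ⟨image_eq_zero_of_notMem_tsupport h1,
        image_eq_zero_of_notMem_tsupport fun h => h1 (tsupport_deriv_subset h)⟩
    have e2 : ∫ p, ((∫ t in (0 : ℝ)..q, Φ₂ (t, p)) * deriv χ p + (Φ₁ (q, p) - Φ₁ (0, p)) * χ p)
        = ∫ p in p₀..0,
          ((∫ t in (0 : ℝ)..q, Φ₂ (t, p)) * deriv χ p + (Φ₁ (q, p) - Φ₁ (0, p)) * χ p) := by
      rw [intervalIntegral.integral_of_le hp₀.le]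
      refine (setIntegral_eq_integral_of_forall_compl_eq_zero fun p hp => ?_).symm
      simp [hout p hp]
    have c1 : Continuous fun p => (∫ t in (0 : ℝ)..q, Φ₂ (t, p)) * deriv χ p := by fun_prop
    have c2 : Continuous fun p => (Φ₁ (q, p) - Φ₁ (0, p)) * χ p := by fun_prop
    have c3 : Continuous fun p => Φ₁ (q, p) * χ p := by fun_prop
    have c4 : Continuous fun p => Φ₁ (0, p) * χ p := by fun_prop
    rw [e2, intervalIntegral.integral_add (c1.intervalIntegrable _ _) (c2.intervalIntegrable _ _)]
    simp only [sub_mul]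
    rw [intervalIntegral.integral_sub (c3.intervalIntegrable _ _) (c4.intervalIntegrable _ _), e1,
      intervalIntegral.integral_neg, intervalIntegral_intervalIntegral_swap, add_neg_eq_zero]
    · simp only [intervalIntegral.integral_mul_const]
    · have : Continuous (Function.uncurry fun t p => Φ₂ (t, p) * deriv χ p) := by
        unfold Function.uncurry; fun_prop
      refine (this.continuousOn.integrableOn_compact
        (isCompact_uIcc.prod isCompact_uIcc)).mono_set
        (Set.prod_mono Set.uIoc_subset_uIcc Set.uIoc_subset_uIcc)
  set T : ℝ → ℝ → ℝ := fun q p => (∫ t in (0 : ℝ)..q, Φ₂ (t, p)) -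
    ∫ s in p₀..p, (Φ₁ (q, s) - Φ₁ (0, s)) with hT
  have hTc : ∀ q, Continuous (T q) := fun q => by
    have h3 : Continuous fun s => Φ₁ (q, s) - Φ₁ (0, s) := by fun_prop
    have : Continuous fun p => ∫ s in p₀..p, (Φ₁ (q, s) - Φ₁ (0, s)) :=
      intervalIntegral.continuous_primitive (fun a b => h3.intervalIntegrable a b) _
    have h4 : Continuous fun p => ∫ t in (0 : ℝ)..q, Φ₂ (t, p) := by fun_prop
    exact h4.sub this
  have hTconst : ∀ q, ∀ p ∈ Set.Icc p₀ 0, T q p = T q (p₀ / 2) := by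
    intro q
    have : Set.EqOn (T q) (fun _ => T q (p₀ / 2)) (Set.Ioo p₀ 0) := by
      intro p hp
      have h3 : Continuous fun s => Φ₁ (q, s) - Φ₁ (0, s) := by fun_prop
      have e := stage2 q (p₀ / 2) ⟨by linarith, by linarith⟩ p hp
      have e2 := intervalIntegral.integral_add_adjacent_intervals (μ := volume)
        (h3.intervalIntegrable p₀ (p₀ / 2)) (h3.intervalIntegrable (p₀ / 2) p)
      simp only [hT]
      linarith
    have := this.closure (hTc q) continuous_const
    rwa [closure_Ioo hp₀.ne] at this
  refine ⟨fun x => (∫ t in (0 : ℝ)..x.1, Φ₂ (t, p₀)) + ∫ s in p₀..x.2, Φ₁ (x.1, s), ?_, ?_⟩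
  · intro x
    have h3 : Continuous fun s => Φ₁ (x.1, s) := by fun_prop
    exact ((h3.integral_hasStrictDerivAt p₀ x.2).hasDerivAt).const_add
      (∫ t in (0 : ℝ)..x.1, Φ₂ (t, p₀))
  · intro x hx
    have h3 : Continuous fun t => Φ₂ (t, x.2) := by fun_prop
    have e : (fun q => (∫ t in (0 : ℝ)..q, Φ₂ (t, p₀)) + ∫ s in p₀..x.2, Φ₁ (q, s)) =
        fun q => (∫ t in (0 : ℝ)..q, Φ₂ (t, x.2)) + ∫ s in p₀..x.2, Φ₁ (0, s) := by
      funext q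
      have e1 := (hTconst q x.2 hx.2).trans (hTconst q p₀ (Set.left_mem_Icc.2 hp₀.le)).symm
      have h4 : Continuous fun s => Φ₁ (q, s) := by fun_prop
      have h5 : Continuous fun s => Φ₁ (0, s) := by fun_prop
      simp only [hT, intervalIntegral.integral_same] at e1
      rw [intervalIntegral.integral_sub (h4.intervalIntegrable _ _)
        (h5.intervalIntegrable _ _)] at e1
      linarith
    simp only [e]
    exact ((h3.integral_hasStrictDerivAt 0 x.1).hasDerivAt).add_const _

end Potential

section HolderAlgebra

open Topology

variable {p₀ α : ℝ}

theorem HolderBdd.nonneg {s : Set (ℝ × ℝ)} {E : Type*} [SeminormedAddCommGroup E] {N : ℝ}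
    {f : ℝ × ℝ → E} (hf : HolderBdd α s N f) {x : ℝ × ℝ} (hx : x ∈ s) : 0 ≤ N :=
  (norm_nonneg _).trans (hf.1 x hx)

theorem HolderBdd.mono {s : Set (ℝ × ℝ)} {E : Type*} [SeminormedAddCommGroup E] {N N' : ℝ}
    {f : ℝ × ℝ → E} (hf : HolderBdd α s N f) (h : N ≤ N') : HolderBdd α s N' f :=
  ⟨fun x hx => (hf.1 x hx).trans h, fun x hx y hy => (hf.2 x hx y hy).trans
    (mul_le_mul_of_nonneg_right h (Real.rpow_nonneg dist_nonneg _))⟩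

theorem HolderBdd.congr {s : Set (ℝ × ℝ)} {E : Type*} [SeminormedAddCommGroup E] {N : ℝ}
    {f f' : ℝ × ℝ → E} (hf : HolderBdd α s N f) (h : ∀ x ∈ s, f x = f' x) :
    HolderBdd α s N f' :=
  ⟨fun x hx => h x hx ▸ hf.1 x hx, fun x hx y hy => h x hx ▸ h y hy ▸ hf.2 x hx y hy⟩

theorem HolderBdd.add {s : Set (ℝ × ℝ)} {E : Type*} [SeminormedAddCommGroup E] {N N' : ℝ}
    {f f' : ℝ × ℝ → E} (hf : HolderBdd α s N f) (hf' : HolderBdd α s N' f') :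
    HolderBdd α s (N + N') (fun x => f x + f' x) := by
  refine ⟨fun x hx => (norm_add_le _ _).trans (add_le_add (hf.1 x hx) (hf'.1 x hx)),
    fun x hx y hy => ?_⟩
  rw [add_sub_add_comm, add_mul]
  exact (norm_add_le _ _).trans (add_le_add (hf.2 x hx y hy) (hf'.2 x hx y hy))

theorem HolderBdd.neg {s : Set (ℝ × ℝ)} {E : Type*} [SeminormedAddCommGroup E] {N : ℝ}
    {f : ℝ × ℝ → E} (hf : HolderBdd α s N f) : HolderBdd α s N (fun x => -f x) := by
  refine ⟨fun x hx => by simpa using hf.1 x hx, fun x hx y hy => ?_⟩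
  rw [neg_sub_neg, norm_sub_rev]
  exact hf.2 x hx y hy

theorem HolderBdd.sum {s : Set (ℝ × ℝ)} {E ι : Type*} [SeminormedAddCommGroup E] {t : Finset ι}
    {N : ι → ℝ} {f : ι → ℝ × ℝ → E} (hf : ∀ i ∈ t, HolderBdd α s (N i) (f i)) :
    HolderBdd α s (∑ i ∈ t, N i) (fun x => ∑ i ∈ t, f i x) := by
  refine ⟨fun x hx => norm_sum_le_of_le _ fun i hi => (hf i hi).1 x hx, fun x hx y hy => ?_⟩
  rw [← Finset.sum_sub_distrib, Finset.sum_mul]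
  exact norm_sum_le_of_le _ fun i hi => (hf i hi).2 x hx y hy

theorem HolderBdd.mul {s : Set (ℝ × ℝ)} {N N' : ℝ} {f f' : ℝ × ℝ → ℝ}
    (hf : HolderBdd α s N f) (hf' : HolderBdd α s N' f') :
    HolderBdd α s (2 * (N * N')) (fun x => f x * f' x) := by
  refine ⟨fun x hx => ?_, fun x hx y hy => ?_⟩
  · have h0 := hf.nonneg hx
    have h0' := hf'.nonneg hx
    rw [norm_mul]
    have := mul_le_mul (hf.1 x hx) (hf'.1 x hx) (norm_nonneg _) h0
    linarith [mul_nonneg h0 h0']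
  · have h0 := hf.nonneg hx
    have h0' := hf'.nonneg hx
    have e : f x * f' x - f y * f' y = f x * (f' x - f' y) + (f x - f y) * f' y := by ring
    rw [e]
    refine (norm_add_le _ _).trans ?_
    rw [norm_mul, norm_mul]
    have h1 := mul_le_mul (hf.1 x hx) (hf'.2 x hx y hy) (norm_nonneg _) h0
    have h2 := mul_le_mul (hf.2 x hx y hy) (hf'.1 y hy) (norm_nonneg _)
      ((norm_nonneg _).trans (hf.2 x hx y hy))
    linarith

theorem HolderBdd.const_mul {s : Set (ℝ × ℝ)} {N : ℝ} {f : ℝ × ℝ → ℝ}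
    (hf : HolderBdd α s N f) (a : ℝ) : HolderBdd α s (|a| * N) (fun x => a * f x) := by
  refine ⟨fun x hx => ?_, fun x hx y hy => ?_⟩
  · rw [norm_mul, Real.norm_eq_abs]
    exact mul_le_mul_of_nonneg_left (hf.1 x hx) (abs_nonneg a)
  · rw [← mul_sub, norm_mul, Real.norm_eq_abs, mul_assoc]
    exact mul_le_mul_of_nonneg_left (hf.2 x hx y hy) (abs_nonneg a)

/-- A quotient of Hölder functions is Hölder. -/
theorem HolderBdd.of_mul_eq {s : Set (ℝ × ℝ)} {N Λ : ℝ} (hΛ : 0 < Λ) {f u w : ℝ × ℝ → ℝ}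
    (hf : HolderBdd α s Λ f) (hf0 : ∀ x ∈ s, Λ⁻¹ ≤ f x) (hw : HolderBdd α s N w)
    (h : ∀ x ∈ s, f x * u x = w x) : HolderBdd α s ((Λ + Λ ^ 3) * N) u := by
  have hu : ∀ x ∈ s, ‖u x‖ ≤ Λ * N := by
    intro x hx
    have h1 : Λ⁻¹ * ‖u x‖ ≤ N := by
      refine le_trans ?_ (hw.1 x hx)
      rw [← h x hx, norm_mul]
      exact mul_le_mul_of_nonneg_right ((hf0 x hx).trans (le_abs_self _)) (norm_nonneg _)
    calc ‖u x‖ = Λ * (Λ⁻¹ * ‖u x‖) := by field_simp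
      _ ≤ Λ * N := mul_le_mul_of_nonneg_left h1 hΛ.le
  refine ⟨fun x hx => (hu x hx).trans ?_, fun x hx y hy => ?_⟩
  · have := hw.nonneg hx
    nlinarith [mul_nonneg (pow_nonneg hΛ.le 3) this]
  · have e : f x * (u x - u y) = (w x - w y) - (f x - f y) * u y := by
      rw [← h x hx, ← h y hy]; ring
    have h0 : 0 ≤ dist x y ^ α := Real.rpow_nonneg dist_nonneg _
    have h1 : Λ⁻¹ * ‖u x - u y‖ ≤ N * dist x y ^ α + Λ * dist x y ^ α * (Λ * N) := by
      calc Λ⁻¹ * ‖u x - u y‖ ≤ ‖f x * (u x - u y)‖ := by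
            rw [norm_mul]
            exact mul_le_mul_of_nonneg_right ((hf0 x hx).trans (le_abs_self _)) (norm_nonneg _)
        _ ≤ ‖w x - w y‖ + ‖(f x - f y) * u y‖ := by rw [e]; exact norm_sub_le _ _
        _ ≤ _ := by
          rw [norm_mul]
          exact add_le_add (hw.2 x hx y hy) (mul_le_mul (hf.2 x hx y hy) (hu y hy) (norm_nonneg _)
            (mul_nonneg hΛ.le h0))
    calc ‖u x - u y‖ = Λ * (Λ⁻¹ * ‖u x - u y‖) := by field_simp
      _ ≤ Λ * (N * dist x y ^ α + Λ * dist x y ^ α * (Λ * N)) :=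
        mul_le_mul_of_nonneg_left h1 hΛ.le
      _ = (Λ + Λ ^ 3) * N * dist x y ^ α := by ring

theorem HolderBdd.of_tendsto {s : Set (ℝ × ℝ)} {E ι : Type*} [SeminormedAddCommGroup E]
    {l : Filter ι} [l.NeBot] {N : ℝ} {F : ι → ℝ × ℝ → E} {f : ℝ × ℝ → E}
    (hF : ∀ᶠ i in l, HolderBdd α s N (F i))
    (h : ∀ x ∈ s, Filter.Tendsto (fun i => F i x) l (𝓝 (f x))) : HolderBdd α s N f :=
  ⟨fun x hx => le_of_tendsto (h x hx).norm (hF.mono fun _ hi => hi.1 x hx),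
    fun x hx y hy => le_of_tendsto ((h x hx).sub (h y hy)).norm
      (hF.mono fun _ hi => hi.2 x hx y hy)⟩

theorem HolderBdd.continuousOn {s : Set (ℝ × ℝ)} {E : Type*} [SeminormedAddCommGroup E]
    (hα : 0 < α) {N : ℝ} {f : ℝ × ℝ → E} (hf : HolderBdd α s N f) : ContinuousOn f s := by
  intro x hx
  refine tendsto_iff_norm_sub_tendsto_zero.2 ?_
  have h1 : Filter.Tendsto (fun y => N * dist y x ^ α) (𝓝[s] x) (𝓝 0) := by
    have h2 : Continuous fun y : ℝ × ℝ => N * dist y x ^ α := by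
      have := hα.le
      fun_prop (disch := assumption)
    have h3 := (h2.tendsto x).mono_left (nhdsWithin_le_nhds (s := s))
    simpa [Real.zero_rpow hα.ne'] using h3
  exact squeeze_zero' (Filter.Eventually.of_forall fun _ => norm_nonneg _)
    (eventually_nhdsWithin_of_forall fun y hy => hf.2 y hy x hx) h1

end HolderAlgebra

section DifferenceQuotients

open Topology

variable {p₀ α : ℝ}

/-- The iterated partial derivative `∂_q^m f`. -/
noncomputable def qIter (m : ℕ) (f : ℝ × ℝ → ℝ) (x : ℝ × ℝ) : ℝ :=
  iteratedDeriv m (fun q => f (q, x.2)) x.1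

/-- The difference quotient in the horizontal direction. -/
noncomputable def dq (ε : ℝ) (f : ℝ × ℝ → ℝ) (x : ℝ × ℝ) : ℝ := ε⁻¹ * (f (x.1 + ε, x.2) - f x)

/-- The average of a function and its horizontal translate. -/
noncomputable def av (ε : ℝ) (f : ℝ × ℝ → ℝ) (x : ℝ × ℝ) : ℝ := (f (x.1 + ε, x.2) + f x) / 2

theorem mem_Obar {x : ℝ × ℝ} : x ∈ Obar p₀ ↔ x.2 ∈ Set.Icc p₀ 0 := by
  simp [Obar]

theorem pd_q_iter_eq_qIter (m : ℕ) (f : ℝ × ℝ → ℝ) : pd_q_iter m f = qIter m f := by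
  induction m with
  | zero => rfl
  | succ m ih =>
    funext x
    rw [pd_q_iter, Function.iterate_succ_apply', ← pd_q_iter, ih, qIter, iteratedDeriv_succ]
    rfl

theorem qIter_congr {m : ℕ} {f f' : ℝ × ℝ → ℝ} (h : ∀ x ∈ Obar p₀, f x = f' x) {x : ℝ × ℝ}
    (hx : x ∈ Obar p₀) : qIter m f x = qIter m f' x := by
  have : (fun q => f (q, x.2)) = fun q => f' (q, x.2) :=
    funext fun q => h _ (mem_Obar.2 (mem_Obar.1 hx))
  rw [qIter, qIter, this]

theorem HolderBdd.shift {N : ℝ} {f : ℝ × ℝ → ℝ} (hf : HolderBdd α (Obar p₀) N f) (t : ℝ) :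
    HolderBdd α (Obar p₀) N (fun x => f (x.1 + t, x.2)) := by
  refine ⟨fun x hx => hf.1 _ hx, fun x hx y hy => ?_⟩
  have := hf.2 (x.1 + t, x.2) hx (y.1 + t, y.2) hy
  simpa [Prod.dist_eq] using this

theorem HolderBdd.av {N : ℝ} {f : ℝ × ℝ → ℝ} (hf : HolderBdd α (Obar p₀) N f) (ε : ℝ) :
    HolderBdd α (Obar p₀) N (av ε f) := by
  have := ((hf.shift ε).add hf).const_mul (1 / 2)
  refine (this.mono (le_of_eq ?_)).congr fun x _ => ?_
  · rw [abs_of_pos (by norm_num)]; ring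
  · rw [_root_.av]; ring

theorem HolderBdd.dq {N : ℝ} {f f' : ℝ × ℝ → ℝ} (hf' : HolderBdd α (Obar p₀) N f')
    (h : ∀ x ∈ Obar p₀, HasDerivAt (fun q => f (q, x.2)) (f' x) x.1) {ε : ℝ} (hε : ε ≠ 0) :
    HolderBdd α (Obar p₀) N (dq ε f) := by
  have hsh : ∀ x ∈ Obar p₀, ∀ t : ℝ,
      HasDerivAt (fun t => f (x.1 + t, x.2)) (f' (x.1 + t, x.2)) t := fun x hx t =>
    (h (x.1 + t, x.2) hx).comp_const_add x.1 t
  have hε' : 0 < |ε| := abs_pos.2 hε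
  refine ⟨fun x hx => ?_, fun x hx y hy => ?_⟩
  · have := Convex.norm_image_sub_le_of_norm_hasDerivWithin_le (C := N)
      (fun t _ => (hsh x hx t).hasDerivWithinAt (s := Set.univ))
      (fun t _ => hf'.1 _ hx) convex_univ (Set.mem_univ (0 : ℝ)) (Set.mem_univ ε)
    rw [_root_.dq, norm_mul, norm_inv, Real.norm_eq_abs ε, inv_mul_le_iff₀ hε']
    simpa [mul_comm] using this
  · have := Convex.norm_image_sub_le_of_norm_hasDerivWithin_le (C := N * dist x y ^ α)
      (fun t _ => ((hsh x hx t).fun_sub (hsh y hy t)).hasDerivWithinAt (s := Set.univ))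
      (fun t _ => (hf'.shift t).2 x hx y hy) convex_univ (Set.mem_univ (0 : ℝ)) (Set.mem_univ ε)
    rw [_root_.dq, _root_.dq, ← mul_sub, norm_mul, norm_inv, Real.norm_eq_abs ε,
      inv_mul_le_iff₀ hε', mul_comm |ε|]
    simp only [add_zero, sub_zero, Real.norm_eq_abs] at this
    rw [sub_sub_sub_comm, Real.norm_eq_abs]
    exact this

theorem HolderBdd.dq_of_ne_zero {N : ℝ} {f : ℝ × ℝ → ℝ} (hf : HolderBdd α (Obar p₀) N f)
    (ε : ℝ) : HolderBdd α (Obar p₀) (|ε⁻¹| * (N + N)) (_root_.dq ε f) := by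
  refine ((hf.shift ε).add hf.neg).const_mul ε⁻¹ |>.congr fun x _ => ?_
  rw [_root_.dq]; ring

theorem tendsto_dq {f : ℝ × ℝ → ℝ} {x : ℝ × ℝ} {f' : ℝ}
    (h : HasDerivAt (fun q => f (q, x.2)) f' x.1) :
    Filter.Tendsto (fun ε => dq ε f x) (𝓝[≠] 0) (𝓝 f') := by
  simpa [dq] using h.tendsto_slope_zero

/-- Regularity of order `m` in the horizontal variable, with Hölder bounds `y`. -/
structure QReg (p₀ α : ℝ) (y : ℕ → ℝ) (m : ℕ) (f : ℝ × ℝ → ℝ) : Prop where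
  smooth : ∀ p ∈ Set.Icc p₀ 0, ContDiff ℝ m (fun q => f (q, p))
  holder : ∀ k ≤ m, HolderBdd α (Obar p₀) (y k) (qIter k f)

theorem hasDerivAt_qIter {m k : ℕ} {f : ℝ × ℝ → ℝ} {x : ℝ × ℝ}
    (h : ContDiff ℝ m (fun q => f (q, x.2))) (hk : k < m) :
    HasDerivAt (fun q => qIter k f (q, x.2)) (qIter (k + 1) f x) x.1 := by
  have := (h.differentiable_iteratedDeriv k (by exact_mod_cast hk) x.1).hasDerivAt
  rwa [← iteratedDeriv_succ] at this

theorem qIter_succ_of_hasDerivAt {k : ℕ} {F f : ℝ × ℝ → ℝ}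
    (h : ∀ x ∈ Obar p₀, HasDerivAt (fun q => F (q, x.2)) (f x) x.1) {x : ℝ × ℝ}
    (hx : x ∈ Obar p₀) : qIter (k + 1) F x = qIter k f x := by
  rw [qIter, iteratedDeriv_succ']
  have : deriv (fun q => F (q, x.2)) = fun q => f (q, x.2) :=
    funext fun q => (h (q, x.2) hx).deriv
  rw [this]; rfl

theorem hasDerivAt_qIter_of_hasDerivAt {k : ℕ} {F f : ℝ × ℝ → ℝ}
    (h : ∀ x ∈ Obar p₀, HasDerivAt (fun q => F (q, x.2)) (f x) x.1)
    (hf : ∀ p ∈ Set.Icc p₀ 0, ContDiff ℝ k (fun q => f (q, p))) {x : ℝ × ℝ}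
    (hx : x ∈ Obar p₀) : HasDerivAt (fun q => qIter k F (q, x.2)) (qIter k f x) x.1 := by
  rw [← qIter_succ_of_hasDerivAt h hx]
  refine hasDerivAt_qIter (m := k + 1) ?_ (Nat.lt_succ_self k)
  have e : deriv (fun q => F (q, x.2)) = fun q => f (q, x.2) :=
    funext fun q => (h (q, x.2) hx).deriv
  rw [Nat.cast_add, Nat.cast_one, contDiff_succ_iff_deriv, e]
  exact ⟨fun q => (h (q, x.2) hx).differentiableAt, by simp, hf _ (mem_Obar.1 hx)⟩

/-- Uniform bounds on difference quotients raise the order of regularity. -/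
theorem QReg.succ (hα : 0 < α) {y : ℕ → ℝ} {m : ℕ} {f : ℝ × ℝ → ℝ} (hf : QReg p₀ α y m f)
    (hd : ∀ x ∈ Obar p₀, DifferentiableAt ℝ (fun q => qIter m f (q, x.2)) x.1)
    (hb : ∀ ε ≠ 0, HolderBdd α (Obar p₀) (y (m + 1)) (dq ε (qIter m f))) :
    QReg p₀ α y (m + 1) f := by
  have hder : ∀ x ∈ Obar p₀, HasDerivAt (fun q => qIter m f (q, x.2)) (qIter (m + 1) f x) x.1 := by
    intro x hx
    have := (hd x hx).hasDerivAt
    rwa [show deriv (fun q => qIter m f (q, x.2)) x.1 = qIter (m + 1) f x by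
      rw [qIter, iteratedDeriv_succ]; rfl] at this
  have hH : HolderBdd α (Obar p₀) (y (m + 1)) (qIter (m + 1) f) :=
    HolderBdd.of_tendsto (l := 𝓝[≠] (0 : ℝ)) (eventually_nhdsWithin_of_forall hb)
      fun x hx => tendsto_dq (hder x hx)
  refine ⟨fun p hp => ?_, fun k hk => ?_⟩
  · rw [contDiff_nat_iff_iteratedDeriv]
    have h0 := contDiff_nat_iff_iteratedDeriv.1 (hf.smooth p hp)
    refine ⟨fun k hk => ?_, fun k hk => ?_⟩
    · rcases Nat.le_succ_iff.1 hk with h | rfl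
      · exact h0.1 k h
      · refine continuous_iff_continuousAt.2 fun q => ?_
        have h1 := hH.continuousOn hα (q, p) (mem_Obar.2 hp)
        have h2 : Filter.Tendsto (fun t : ℝ => (t, p)) (𝓝 q) (𝓝[Obar p₀] (q, p)) :=
          tendsto_nhdsWithin_iff.2 ⟨(by fun_prop : Continuous fun t : ℝ => (t, p)).tendsto q,
            Filter.Eventually.of_forall fun t => mem_Obar.2 hp⟩
        have h3 := h1.tendsto.comp h2
        simpa only [ContinuousAt, Function.comp_def, qIter] using h3
    · rcases Nat.lt_succ_iff_lt_or_eq.1 hk with h | rfl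
      · exact h0.2 k h
      · intro q
        have h1 := hd (q, p) (mem_Obar.2 hp)
        simpa only [qIter] using h1
  · rcases Nat.le_succ_iff.1 hk with h | rfl
    · exact hf.holder k h
    · exact hH

end DifferenceQuotients

section Leibniz

open Topology

variable {p₀ α : ℝ}

/-- The lower order terms in the difference quotient of `∂_q^m (f g)`. -/
noncomputable def leibnizRem (ε : ℝ) (m : ℕ) (f g : ℝ × ℝ → ℝ) (x : ℝ × ℝ) : ℝ :=
  ∑ j ∈ Finset.range m, (m.choose j : ℝ) *
    (dq ε (qIter j f) x * av ε (qIter (m - j) g) x + av ε (qIter (m - j) f) x * dq ε (qIter j g) x)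

/-- The bound for the lower order terms `leibnizRem`. -/
def leibnizSum (y : ℕ → ℝ) (m : ℕ) : ℝ :=
  ∑ j ∈ Finset.range m, (m.choose j : ℝ) * (y (j + 1) * y (m - j))

theorem qIter_mul {m : ℕ} {f g k : ℝ × ℝ → ℝ}
    (hf : ∀ p ∈ Set.Icc p₀ 0, ContDiff ℝ m (fun q => f (q, p)))
    (hg : ∀ p ∈ Set.Icc p₀ 0, ContDiff ℝ m (fun q => g (q, p)))
    (h : ∀ x ∈ Obar p₀, f x * g x = k x) {x : ℝ × ℝ} (hx : x ∈ Obar p₀) :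
    qIter m k x = ∑ i ∈ Finset.range (m + 1),
      (m.choose i : ℝ) * qIter i f x * qIter (m - i) g x := by
  rw [← qIter_congr h hx]
  have hx' := mem_Obar.1 hx
  exact iteratedDeriv_fun_mul (hf _ hx').contDiffAt (hg _ hx').contDiffAt

theorem dq_qIter_mul {m : ℕ} {f g k : ℝ × ℝ → ℝ}
    (hf : ∀ p ∈ Set.Icc p₀ 0, ContDiff ℝ m (fun q => f (q, p)))
    (hg : ∀ p ∈ Set.Icc p₀ 0, ContDiff ℝ m (fun q => g (q, p)))
    (h : ∀ x ∈ Obar p₀, f x * g x = k x) (ε : ℝ) {x : ℝ × ℝ} (hx : x ∈ Obar p₀) :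
    dq ε (qIter m k) x = av ε g x * dq ε (qIter m f) x + av ε f x * dq ε (qIter m g) x +
      leibnizRem ε m f g x := by
  have h1 : dq ε (qIter m k) x = ∑ i ∈ Finset.range (m + 1), (m.choose i : ℝ) *
      (dq ε (qIter i f) x * av ε (qIter (m - i) g) x) +
      ∑ i ∈ Finset.range (m + 1), (m.choose i : ℝ) *
      (av ε (qIter i f) x * dq ε (qIter (m - i) g) x) := by
    rw [dq, qIter_mul hf hg h hx, qIter_mul hf hg h (x := (x.1 + ε, x.2)) hx,
      ← Finset.sum_sub_distrib, Finset.mul_sum, ← Finset.sum_add_distrib]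
    refine Finset.sum_congr rfl fun i _ => ?_
    simp only [dq, av]
    ring
  have h2 : ∑ i ∈ Finset.range (m + 1), (m.choose i : ℝ) *
      (av ε (qIter i f) x * dq ε (qIter (m - i) g) x) =
      ∑ i ∈ Finset.range (m + 1), (m.choose i : ℝ) *
      (av ε (qIter (m - i) f) x * dq ε (qIter i g) x) := by
    rw [← Finset.sum_range_reflect]
    refine Finset.sum_congr rfl fun i hi => ?_
    have hi' : i ≤ m := Nat.lt_succ_iff.1 (Finset.mem_range.1 hi)
    have e1 : m + 1 - 1 - i = m - i := by omega
    have e2 : m - (m - i) = i := by omega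
    rw [e1, e2, Nat.choose_symm hi']
  have h0 : ∀ f : ℝ × ℝ → ℝ, qIter 0 f = f := fun f => by
    funext x; simp [qIter]
  rw [h1, h2, Finset.sum_range_succ, Finset.sum_range_succ, leibnizRem]
  simp only [mul_add, Finset.sum_add_distrib, Nat.choose_self, Nat.sub_self, h0]
  push_cast
  ring

theorem leibnizRem_holder {y : ℕ → ℝ} {m : ℕ} {f g : ℝ × ℝ → ℝ} (hf : QReg p₀ α y m f)
    (hg : QReg p₀ α y m g) {ε : ℝ} (hε : ε ≠ 0) :
    HolderBdd α (Obar p₀) (4 * leibnizSum y m) (leibnizRem ε m f g) := by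
  have hd : ∀ f : ℝ × ℝ → ℝ, QReg p₀ α y m f → ∀ j < m,
      HolderBdd α (Obar p₀) (y (j + 1)) (dq ε (qIter j f)) := fun f hf j hj =>
    (hf.holder (j + 1) hj).dq (fun x hx => hasDerivAt_qIter (hf.smooth _ (mem_Obar.1 hx)) hj) hε
  have key : HolderBdd α (Obar p₀) (∑ j ∈ Finset.range m, |(m.choose j : ℝ)| *
      (2 * (y (j + 1) * y (m - j)) + 2 * (y (m - j) * y (j + 1)))) (leibnizRem ε m f g) := by
    refine HolderBdd.sum fun j hj => ?_
    have hj := Finset.mem_range.1 hj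
    exact (((hd f hf j hj).mul ((hg.holder (m - j) (Nat.sub_le _ _)).av ε)).add
      (((hf.holder (m - j) (Nat.sub_le _ _)).av ε).mul (hd g hg j hj))).const_mul _
  refine key.mono (le_of_eq ?_)
  rw [leibnizSum, Finset.mul_sum]
  refine Finset.sum_congr rfl fun j _ => ?_
  rw [abs_of_nonneg (Nat.cast_nonneg _)]
  ring

end Leibniz

section Limits

open Topology

variable {p₀ α : ℝ}

/-- Uniform Hölder bounds for the difference quotients of the gradient of `V` yield second
derivatives of `V`. -/
theorem hasDeriv_of_dq_bound (hp₀ : p₀ < 0) (hα : 0 < α) {M : ℝ} {V Vq Vp : ℝ × ℝ → ℝ}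
    (hq : ∀ x ∈ Obar p₀, HasDerivAt (fun q => V (q, x.2)) (Vq x) x.1)
    (hp : ∀ x ∈ Obar p₀, HasDerivWithinAt (fun p => V (x.1, p)) (Vp x) (Set.Icc p₀ 0) x.2)
    (hbq : ∀ ε ≠ 0, HolderBdd α (Obar p₀) M (dq ε Vq))
    (hbp : ∀ ε ≠ 0, HolderBdd α (Obar p₀) M (dq ε Vp)) {x : ℝ × ℝ} (hx : x ∈ Obar p₀) :
    DifferentiableAt ℝ (fun q => Vq (q, x.2)) x.1 ∧
      DifferentiableAt ℝ (fun q => Vp (q, x.2)) x.1 ∧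
      HasDerivWithinAt (fun p => Vq (x.1, p)) (deriv (fun q => Vp (q, x.2)) x.1)
        (Set.Icc p₀ 0) x.2 := by
  have hM : 0 ≤ M := (hbq 1 one_ne_zero).nonneg hx
  have taylor : ∀ ε ≠ 0, ∀ y ∈ Obar p₀, ‖dq ε V y - dq ε V x - ((y.1 - x.1) • dq ε Vq x +
      (y.2 - x.2) • dq ε Vp x)‖ ≤ 2 * M * ‖y - x‖ ^ α * ‖y - x‖ := by
    intro ε hε y hy
    refine norm_sub_sub_smul_le_of_partials hα hM (W := dq ε V) (P := dq ε Vq) (R := dq ε Vp)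
      (fun z hz => ?_) (fun z hz => ?_) (hbq ε hε).2 (hbp ε hε).2 hx hy
    · exact (((hq (z.1 + ε, z.2) hz).comp_add_const z.1 ε).fun_sub (hq z hz)).const_mul ε⁻¹
    · exact ((hp (z.1 + ε, z.2) hz).fun_sub (hp z hz)).const_mul ε⁻¹
  have hU : ∀ U : Ultrafilter ℝ, (U : Filter ℝ) ≤ 𝓝[≠] 0 → ∃ A R,
      Filter.Tendsto (fun ε => dq ε Vq x) U (𝓝 A) ∧ Filter.Tendsto (fun ε => dq ε Vp x) U (𝓝 R) ∧
      HasDerivAt (fun q => Vq (q, x.2)) A x.1 ∧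
      HasDerivWithinAt (fun p => Vq (x.1, p)) R (Set.Icc p₀ 0) x.2 := by
    intro U hU
    have hne : ∀ᶠ ε in (U : Filter ℝ), ε ≠ 0 := hU self_mem_nhdsWithin
    obtain ⟨A, hA⟩ := U.exists_tendsto_of_norm_le (hne.mono fun ε hε => (hbq ε hε).1 x hx)
    obtain ⟨R, hR⟩ := U.exists_tendsto_of_norm_le (hne.mono fun ε hε => (hbp ε hε).1 x hx)
    have hT : ∀ y ∈ Obar p₀, ‖Vq y - Vq x - ((y.1 - x.1) • A + (y.2 - x.2) • R)‖
        ≤ 2 * M * ‖y - x‖ ^ α * ‖y - x‖ := by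
      intro y hy
      have h1 := (tendsto_dq (hq y hy)).mono_left hU
      have h2 := (tendsto_dq (hq x hx)).mono_left hU
      exact le_of_tendsto (((h1.sub h2).sub ((hA.const_smul (y.1 - x.1)).add
        (hR.const_smul (y.2 - x.2)))).norm) (hne.mono fun ε hε => taylor ε hε y hy)
    refine ⟨A, R, hA, hR, hasDerivAt_of_rpow_bound (C := 2 * M) hα fun t => ?_,
      hasDerivWithinAt_of_rpow_bound (C := 2 * M) hα fun t ht => ?_⟩
    · have := hT (t, x.2) hx
      have e : ‖(t, x.2) - x‖ = ‖t - x.1‖ := by simp [Prod.norm_def]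
      simpa [e] using this
    · have := hT (x.1, t) (mem_Obar.2 ht)
      have e : ‖(x.1, t) - x‖ = ‖t - x.2‖ := by simp [Prod.norm_def]
      simpa [e] using this
  obtain ⟨A, R, -, -, hA, hR⟩ := hU (Ultrafilter.of (𝓝[≠] 0)) (Ultrafilter.of_le _)
  have hlim : HasDerivAt (fun q => Vp (q, x.2)) R x.1 := by
    rw [hasDerivAt_iff_tendsto_slope_zero]
    refine (Filter.tendsto_iff_ultrafilter _ _ _).2 fun U hU' => ?_
    obtain ⟨A', R', -, h2, -, h4⟩ := hU U hU'
    have hu : UniqueDiffWithinAt ℝ (Set.Icc p₀ 0) x.2 :=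
      uniqueDiffOn_Icc hp₀ x.2 (mem_Obar.1 hx)
    rw [hu.eq_deriv _ hR h4]
    exact h2
  exact ⟨hA.differentiableAt, hlim.differentiableAt, hlim.deriv ▸ hR⟩

end Limits

section Flow

open Topology

variable {p₀ α g Q Λ : ℝ}

theorem HolderBdd.re {s : Set (ℝ × ℝ)} {N : ℝ} {f : ℝ × ℝ → ℂ} (hf : HolderBdd α s N f) :
    HolderBdd α s N (fun x => (f x).re) :=
  ⟨fun x hx => (Complex.abs_re_le_norm _).trans (hf.1 x hx), fun x hx y hy => by
    rw [← Complex.sub_re]; exact (Complex.abs_re_le_norm _).trans (hf.2 x hx y hy)⟩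

theorem HolderBdd.im {s : Set (ℝ × ℝ)} {N : ℝ} {f : ℝ × ℝ → ℂ} (hf : HolderBdd α s N f) :
    HolderBdd α s N (fun x => (f x).im) :=
  ⟨fun x hx => (Complex.abs_im_le_norm _).trans (hf.1 x hx), fun x hx y hy => by
    rw [← Complex.sub_im]; exact (Complex.abs_im_le_norm _).trans (hf.2 x hx y hy)⟩

theorem norm_dq_le {N : ℝ} {f f' : ℝ × ℝ → ℝ} (hN : ∀ x ∈ Obar p₀, |f' x| ≤ N)
    (h : ∀ x ∈ Obar p₀, HasDerivAt (fun q => f (q, x.2)) (f' x) x.1) {ε : ℝ} (hε : ε ≠ 0)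
    {x : ℝ × ℝ} (hx : x ∈ Obar p₀) : |dq ε f x| ≤ N := by
  have := Convex.norm_image_sub_le_of_norm_hasDerivWithin_le (C := N)
    (f := fun t => f (x.1 + t, x.2))
    (fun t _ => ((h (x.1 + t, x.2) hx).comp_const_add x.1 t).hasDerivWithinAt (s := Set.univ))
    (fun t _ => hN (x.1 + t, x.2) hx) convex_univ (Set.mem_univ (0 : ℝ)) (Set.mem_univ ε)
  rw [dq, abs_mul, abs_inv, inv_mul_le_iff₀ (abs_pos.2 hε)]
  simpa [mul_comm] using this

theorem qIter_zero (f : ℝ × ℝ → ℝ) : qIter 0 f = f := by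
  funext x; simp [qIter]

theorem qIter_of_eq_const_add {F f : ℝ × ℝ → ℝ} {p a : ℝ} (h : ∀ q, F (q, p) = a + f (q, p))
    (m : ℕ) : ∃ a', ∀ q, qIter m F (q, p) = a' + qIter m f (q, p) := by
  rcases Nat.eq_zero_or_pos m with rfl | hm
  · exact ⟨a, by simpa [qIter] using h⟩
  · refine ⟨0, fun q => ?_⟩
    have e : (fun q => F (q, p)) = fun q => a + f (q, p) := funext h
    rw [zero_add, qIter, e]
    exact iteratedDeriv_const_add hm a

theorem dq_qIter_of_eq_const_add {F f : ℝ × ℝ → ℝ} {p a : ℝ}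
    (h : ∀ q, F (q, p) = a + f (q, p)) (ε : ℝ) (m : ℕ) (q : ℝ) :
    dq ε (qIter m F) (q, p) = dq ε (qIter m f) (q, p) := by
  obtain ⟨a', ha'⟩ := qIter_of_eq_const_add h m
  simp only [dq, ha']
  ring

theorem dq_qIter_const_mul (a ε : ℝ) (m : ℕ) (f : ℝ × ℝ → ℝ) (x : ℝ × ℝ) :
    dq ε (qIter m (fun x => a * f x)) x = a * dq ε (qIter m f) x := by
  simp only [dq, qIter, iteratedDeriv_const_mul_field]
  ring

theorem dq_qIter_const (a ε : ℝ) (m : ℕ) (x : ℝ × ℝ) :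
    dq ε (qIter m (fun _ => a)) x = 0 := by
  simp [dq, qIter, iteratedDeriv_const]

theorem dq_qIter_add {m : ℕ} {f f' : ℝ × ℝ → ℝ}
    (hf : ∀ p ∈ Set.Icc p₀ 0, ContDiff ℝ m (fun q => f (q, p)))
    (hf' : ∀ p ∈ Set.Icc p₀ 0, ContDiff ℝ m (fun q => f' (q, p))) (ε : ℝ) {x : ℝ × ℝ}
    (hx : x ∈ Obar p₀) : dq ε (qIter m (fun x => f x + f' x)) x =
      dq ε (qIter m f) x + dq ε (qIter m f') x := by
  have hx' := mem_Obar.1 hx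
  have key : ∀ q, qIter m (fun x => f x + f' x) (q, x.2) =
      qIter m f (q, x.2) + qIter m f' (q, x.2) := fun q =>
    iteratedDeriv_fun_add (hf _ hx').contDiffAt (hf' _ hx').contDiffAt
  have := key x.1
  simp only [Prod.mk.eta] at this
  rw [dq, key, this, dq, dq]
  ring

/-- The quantities attached to a weak solution `h`: its derivatives `hq`, `hp`, the inverse
`B = 1 / hp`, and a potential `S` with `∂_p S = hq / hp` and
`∂_q S = G(p) + (1 + hq²) / (2 hp²)`. -/
structure FlowData (p₀ α g Q Λ : ℝ) (h hq hp X S Sp B : ℝ × ℝ → ℝ) (G : ℝ → ℝ) : Prop where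
  hq_holder : HolderBdd α (Obar p₀) Λ hq
  hp_holder : HolderBdd α (Obar p₀) Λ hp
  X_holder : HolderBdd α (Obar p₀) Λ X
  Sp_holder : HolderBdd α (Obar p₀) Λ Sp
  B_holder : HolderBdd α (Obar p₀) Λ B
  hp_lower : ∀ x ∈ Obar p₀, Λ⁻¹ ≤ hp x
  B_lower : ∀ x ∈ Obar p₀, Λ⁻¹ ≤ B x
  Sq_bound : ∀ x ∈ Obar p₀, |G x.2 + X x| ≤ Λ
  h_q : ∀ x ∈ Obar p₀, HasDerivAt (fun q => h (q, x.2)) (hq x) x.1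
  h_p : ∀ x ∈ Obar p₀, HasDerivWithinAt (fun p => h (x.1, p)) (hp x) (Set.Icc p₀ 0) x.2
  S_q : ∀ x ∈ Obar p₀, HasDerivAt (fun q => S (q, x.2)) (G x.2 + X x) x.1
  S_p : ∀ x ∈ Obar p₀, HasDerivWithinAt (fun p => S (x.1, p)) (Sp x) (Set.Icc p₀ 0) x.2
  Sp_mul : ∀ x ∈ Obar p₀, Sp x * hp x = hq x
  B_mul : ∀ x ∈ Obar p₀, B x * hp x = 1
  X_eq : ∀ x ∈ Obar p₀, B x * B x + Sp x * Sp x = 2 * X x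
  bottom : ∀ q, hq (q, p₀) = 0
  top : ∀ q, X (q, 0) = Q / 2 + -g * h (q, 0)

/-- Horizontal regularity of order `m` of the quantities attached to a weak solution. -/
structure FlowReg (p₀ α : ℝ) (h hq hp X S Sp B : ℝ × ℝ → ℝ) (y : ℕ → ℝ) (m : ℕ) : Prop where
  hq_reg : QReg p₀ α y m hq
  hp_reg : QReg p₀ α y m hp
  X_reg : QReg p₀ α y m X
  Sp_reg : QReg p₀ α y m Sp
  B_reg : QReg p₀ α y m B
  h_p : ∀ k ≤ m, ∀ x ∈ Obar p₀, HasDerivWithinAt (fun p => qIter k h (x.1, p)) (qIter k hp x)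
    (Set.Icc p₀ 0) x.2
  S_p : ∀ k ≤ m, ∀ x ∈ Obar p₀, HasDerivWithinAt (fun p => qIter k S (x.1, p)) (qIter k Sp x)
    (Set.Icc p₀ 0) x.2

variable {h hq hp X S Sp B : ℝ × ℝ → ℝ} {G : ℝ → ℝ} {y : ℕ → ℝ} {m : ℕ}

theorem QReg.zero {f : ℝ × ℝ → ℝ} (hα : 0 < α) (hf : HolderBdd α (Obar p₀) (y 0) f) :
    QReg p₀ α y 0 f := by
  refine ⟨fun p hp => ?_, fun k hk => ?_⟩
  · rw [Nat.cast_zero, contDiff_zero]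
    exact (hf.continuousOn hα).comp_continuous (by fun_prop) fun q => mem_Obar.2 hp
  · rw [Nat.le_zero.1 hk, qIter_zero]; exact hf

theorem FlowData.reg_zero (D : FlowData p₀ α g Q Λ h hq hp X S Sp B G) (hα : 0 < α)
    (hy : Λ ≤ y 0) : FlowReg p₀ α h hq hp X S Sp B y 0 where
  hq_reg := QReg.zero hα (D.hq_holder.mono hy)
  hp_reg := QReg.zero hα (D.hp_holder.mono hy)
  X_reg := QReg.zero hα (D.X_holder.mono hy)
  Sp_reg := QReg.zero hα (D.Sp_holder.mono hy)
  B_reg := QReg.zero hα (D.B_holder.mono hy)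
  h_p k hk x hx := by
    rw [Nat.le_zero.1 hk, qIter_zero, qIter_zero]; exact D.h_p x hx
  S_p k hk x hx := by
    rw [Nat.le_zero.1 hk, qIter_zero, qIter_zero]; exact D.S_p x hx

theorem FlowReg.Sq_smooth (L : FlowReg p₀ α h hq hp X S Sp B y m) :
    ∀ p ∈ Set.Icc p₀ 0, ContDiff ℝ m (fun q => (fun x : ℝ × ℝ => G x.2 + X x) (q, p)) :=
  fun p hp => (contDiff_const (c := G p)).add (L.X_reg.smooth p hp)

theorem FlowReg.Sq_bound (L : FlowReg p₀ α h hq hp X S Sp B y m)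
    (D : FlowData p₀ α g Q Λ h hq hp X S Sp B G) (hy : Λ ≤ y 0) :
    ∀ x ∈ Obar p₀, |qIter m (fun x => G x.2 + X x) x| ≤ y m := by
  intro x hx
  rcases Nat.eq_zero_or_pos m with rfl | hm
  · rw [qIter_zero]; exact (D.Sq_bound x hx).trans hy
  · refine le_trans (le_of_eq ?_) ((L.X_reg.holder m le_rfl).1 x hx)
    rw [Real.norm_eq_abs, qIter, qIter]
    exact congrArg _ (iteratedDeriv_const_add hm (G x.2))

theorem FlowReg.h_q (L : FlowReg p₀ α h hq hp X S Sp B y m)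
    (D : FlowData p₀ α g Q Λ h hq hp X S Sp B G) {x : ℝ × ℝ} (hx : x ∈ Obar p₀) :
    HasDerivAt (fun q => qIter m h (q, x.2)) (qIter m hq x) x.1 :=
  hasDerivAt_qIter_of_hasDerivAt D.h_q L.hq_reg.smooth hx

theorem FlowReg.S_q (L : FlowReg p₀ α h hq hp X S Sp B y m)
    (D : FlowData p₀ α g Q Λ h hq hp X S Sp B G) {x : ℝ × ℝ} (hx : x ∈ Obar p₀) :
    HasDerivAt (fun q => qIter m S (q, x.2)) (qIter m (fun x => G x.2 + X x) x) x.1 :=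
  hasDerivAt_qIter_of_hasDerivAt D.S_q L.Sq_smooth hx

theorem FlowReg.dq_hq (L : FlowReg p₀ α h hq hp X S Sp B y m)
    (D : FlowData p₀ α g Q Λ h hq hp X S Sp B G) (ε : ℝ) {x : ℝ × ℝ} (hx : x ∈ Obar p₀) :
    dq ε (qIter m hq) x = av ε hp x * dq ε (qIter m Sp) x + av ε Sp x * dq ε (qIter m hp) x +
      leibnizRem ε m Sp hp x :=
  dq_qIter_mul L.Sp_reg.smooth L.hp_reg.smooth D.Sp_mul ε hx

theorem FlowReg.dq_B (L : FlowReg p₀ α h hq hp X S Sp B y m)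
    (D : FlowData p₀ α g Q Λ h hq hp X S Sp B G) (ε : ℝ) {x : ℝ × ℝ} (hx : x ∈ Obar p₀) :
    0 = av ε hp x * dq ε (qIter m B) x + av ε B x * dq ε (qIter m hp) x +
      leibnizRem ε m B hp x := by
  rw [← dq_qIter_mul L.B_reg.smooth L.hp_reg.smooth D.B_mul ε hx, dq_qIter_const]

theorem FlowReg.dq_X (L : FlowReg p₀ α h hq hp X S Sp B y m)
    (D : FlowData p₀ α g Q Λ h hq hp X S Sp B G) (ε : ℝ) {x : ℝ × ℝ} (hx : x ∈ Obar p₀) :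
    dq ε (qIter m X) x = av ε B x * dq ε (qIter m B) x + av ε Sp x * dq ε (qIter m Sp) x +
      1 / 2 * (leibnizRem ε m B B x + leibnizRem ε m Sp Sp x) := by
  have h1 := dq_qIter_const_mul 2 ε m X x
  have h2 : dq ε (qIter m (fun x => 2 * X x)) x =
      dq ε (qIter m (fun x => B x * B x + Sp x * Sp x)) x := by
    rw [dq, dq, qIter_congr D.X_eq hx, qIter_congr D.X_eq (x := (x.1 + ε, x.2)) hx]
  rw [h2, dq_qIter_add (fun p hp => (L.B_reg.smooth p hp).mul (L.B_reg.smooth p hp))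
    (fun p hp => (L.Sp_reg.smooth p hp).mul (L.Sp_reg.smooth p hp)) ε hx,
    dq_qIter_mul L.B_reg.smooth L.B_reg.smooth (fun _ _ => rfl) ε hx,
    dq_qIter_mul L.Sp_reg.smooth L.Sp_reg.smooth (fun _ _ => rfl) ε hx] at h1
  linarith

theorem FlowReg.leibnizSum_nonneg (L : FlowReg p₀ α h hq hp X S Sp B y m) (hp₀ : p₀ < 0) :
    0 ≤ leibnizSum y m := by
  have := (leibnizRem_holder L.B_reg L.B_reg one_ne_zero).nonneg
    (mem_Obar.2 ⟨hp₀.le, le_rfl⟩ : ((0 : ℝ), (0 : ℝ)) ∈ Obar p₀)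
  linarith

theorem le_av {f : ℝ × ℝ → ℝ} {a : ℝ} (h : ∀ x ∈ Obar p₀, a ≤ f x) (ε : ℝ) :
    ∀ x ∈ Obar p₀, a ≤ av ε f x := by
  intro x hx
  have h1 := h x hx
  have h2 := h (x.1 + ε, x.2) hx
  rw [av]; linarith

/-- The difference quotients of `∂_q^m h` solve a linear elliptic system. -/
theorem FlowReg.linSol (L : FlowReg p₀ α h hq hp X S Sp B y m) (hp₀ : p₀ < 0) (hg : 0 < g)
    (hΛ : 0 < Λ) (D : FlowData p₀ α g Q Λ h hq hp X S Sp B G) (hy : Λ ≤ y 0) {ε : ℝ}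
    (hε : ε ≠ 0) :
    LinSol p₀ α Λ ((24 * Λ + 4 + g) * (y m + leibnizSum y m)) (av ε hp) (av ε Sp) (av ε B)
      (fun x => -leibnizRem ε m Sp hp x)
      (fun x => -(av ε B x * leibnizRem ε m B hp x) + -(av ε Sp x * leibnizRem ε m Sp hp x) +
        av ε hp x * (1 / 2 * (leibnizRem ε m B B x + leibnizRem ε m Sp Sp x)))
      (fun x => ⟨dq ε (qIter m S) x, dq ε (qIter m h) x⟩)
      (fun x => ⟨dq ε (qIter m X) x, dq ε (qIter m hq) x⟩)
      (fun x => ⟨dq ε (qIter m Sp) x, dq ε (qIter m hp) x⟩) := by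
  have hT := L.leibnizSum_nonneg hp₀
  have hY : 0 ≤ y m := (L.B_reg.holder m le_rfl).nonneg
    (mem_Obar.2 ⟨hp₀.le, le_rfl⟩ : ((0 : ℝ), (0 : ℝ)) ∈ Obar p₀)
  have hΛT := mul_nonneg hΛ.le hT
  have hΛY := mul_nonneg hΛ.le hY
  have hgT := mul_nonneg hg.le hT
  have hgY := mul_nonneg hg.le hY
  refine ⟨le_av D.hp_lower ε, le_av D.B_lower ε, D.hp_holder.av ε, D.Sp_holder.av ε,
    D.B_holder.av ε, ?_, ?_, fun x hx => ?_, fun x hx => ?_, fun x hx => ?_, fun x hx => ?_,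
    fun x hx => ?_, fun q => ?_, fun q q' => ?_⟩
  · refine (leibnizRem_holder L.Sp_reg L.hp_reg hε).neg.mono ?_
    linarith
  · have h1 := leibnizRem_holder L.Sp_reg L.hp_reg hε
    have h2 := leibnizRem_holder L.B_reg L.hp_reg hε
    have h3 := leibnizRem_holder L.B_reg L.B_reg hε
    have h4 := leibnizRem_holder L.Sp_reg L.Sp_reg hε
    refine ((((D.B_holder.av ε).mul h2).neg.add ((D.Sp_holder.av ε).mul h1).neg).add
      ((D.hp_holder.av ε).mul ((h3.add h4).const_mul (1 / 2)))).mono ?_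
    rw [abs_of_pos (by norm_num)]
    linarith
  · have h1 := norm_dq_le (L.Sq_bound D hy) (fun x hx => L.S_q D hx) hε hx
    have h2 := norm_dq_le (fun x hx => (L.hq_reg.holder m le_rfl).1 x hx)
      (fun x hx => L.h_q D hx) hε hx
    refine (Complex.norm_le_abs_re_add_abs_im _).trans ?_
    dsimp only
    linarith
  · have h1 : HasDerivAt (fun q => dq ε (qIter m S) (q, x.2))
        (dq ε (qIter m (fun x => G x.2 + X x)) x) x.1 :=
      (((L.S_q D (x := (x.1 + ε, x.2)) hx).comp_add_const x.1 ε).fun_sub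
        (L.S_q D hx)).const_mul ε⁻¹
    have h2 : HasDerivAt (fun q => dq ε (qIter m h) (q, x.2)) (dq ε (qIter m hq) x) x.1 :=
      (((L.h_q D (x := (x.1 + ε, x.2)) hx).comp_add_const x.1 ε).fun_sub
        (L.h_q D hx)).const_mul ε⁻¹
    have e := dq_qIter_of_eq_const_add (F := fun x => G x.2 + X x) (f := X) (p := x.2)
      (a := G x.2) (fun q => rfl) ε m x.1
    simp only [Prod.mk.eta] at e
    rw [e] at h1
    have := h1.ofReal_comp.fun_add (h2.ofReal_comp.mul_const Complex.I)
    simpa only [Complex.mk_eq_add_mul_I] using this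
  · have h1 : HasDerivWithinAt (fun p => dq ε (qIter m S) (x.1, p))
        (dq ε (qIter m Sp) x) (Set.Icc p₀ 0) x.2 :=
      ((L.S_p m le_rfl (x.1 + ε, x.2) hx).fun_sub (L.S_p m le_rfl x hx)).const_mul ε⁻¹
    have h2 : HasDerivWithinAt (fun p => dq ε (qIter m h) (x.1, p))
        (dq ε (qIter m hp) x) (Set.Icc p₀ 0) x.2 :=
      ((L.h_p m le_rfl (x.1 + ε, x.2) hx).fun_sub (L.h_p m le_rfl x hx)).const_mul ε⁻¹
    have := h1.ofReal_comp.fun_add (h2.ofReal_comp.mul_const Complex.I)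
    simpa only [Complex.mk_eq_add_mul_I] using this
  · dsimp only
    rw [L.dq_hq D ε hx]; ring
  · dsimp only
    linear_combination (av ε hp x) * L.dq_X D ε hx - av ε Sp x * L.dq_hq D ε hx -
      av ε B x * L.dq_B D ε hx
  · dsimp only
    have e : ∀ q, qIter m hq (q, p₀) = qIter m (fun _ => (0 : ℝ)) (q, p₀) := fun q => by
      simp only [qIter, D.bottom]
    rw [← dq_qIter_const 0 ε m (q, p₀), dq, dq, e, e]
  · dsimp only
    have e : ∀ q, dq ε (qIter m X) (q, 0) = -g * dq ε (qIter m h) (q, 0) := fun q => by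
      rw [← dq_qIter_const_mul]
      exact dq_qIter_of_eq_const_add (f := fun x => -g * h x) D.top ε m q
    have h0 : ∀ q : ℝ, (q, (0 : ℝ)) ∈ Obar p₀ := fun q => mem_Obar.2 ⟨hp₀.le, le_rfl⟩
    have h1 := ((L.hq_reg.holder m le_rfl).dq (fun x hx => L.h_q D hx) hε).2 _ (h0 q) _ (h0 q')
    have hd : dist (q, (0 : ℝ)) (q', (0 : ℝ)) = |q - q'| := by
      simp [Prod.dist_eq, Real.dist_eq]
    rw [hd] at h1
    have h2 : 0 ≤ |q - q'| ^ α := Real.rpow_nonneg (abs_nonneg _) _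
    rw [e, e, ← mul_sub, abs_mul, abs_neg, abs_of_pos hg]
    refine (mul_le_mul_of_nonneg_left h1 hg.le).trans ?_
    rw [← mul_assoc]
    refine mul_le_mul_of_nonneg_right ?_ h2
    linarith

end Flow

section Bootstrap

open Topology

variable {p₀ α g Q Λ : ℝ}

theorem HolderBdd.mk_complex {s : Set (ℝ × ℝ)} {N N' : ℝ} {f f' : ℝ × ℝ → ℝ}
    (hf : HolderBdd α s N f) (hf' : HolderBdd α s N' f') :
    HolderBdd α s (N + N') (fun x => (⟨f x, f' x⟩ : ℂ)) := by
  refine ⟨fun x hx => (Complex.norm_le_abs_re_add_abs_im _).trans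
    (add_le_add (hf.1 x hx) (hf'.1 x hx)), fun x hx y hy => ?_⟩
  refine (Complex.norm_le_abs_re_add_abs_im _).trans ?_
  rw [add_mul]
  exact add_le_add (hf.2 x hx y hy) (hf'.2 x hx y hy)

/-- The inductive step: regularity of order `m` implies regularity of order `m + 1`. -/
theorem FlowReg.succ (hp₀ : p₀ < 0) (hα0 : 0 < α) (hα1 : α < 1) (hg : 0 < g) (hΛ : 0 < Λ) :
    ∃ C > 0, ∀ (h hq hp X S Sp B : ℝ × ℝ → ℝ) (G : ℝ → ℝ) (y : ℕ → ℝ) (m : ℕ),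
      FlowData p₀ α g Q Λ h hq hp X S Sp B G → Λ ≤ y 0 → 0 < y m →
      C * (y m + leibnizSum y m) ≤ y (m + 1) → FlowReg p₀ α h hq hp X S Sp B y m →
      FlowReg p₀ α h hq hp X S Sp B y (m + 1) := by
  obtain ⟨C, hC, hsch⟩ := LinSol.schauder (Λ := Λ) hp₀ hα0 hα1 hΛ
  set κ := 24 * Λ + 4 + g with hκ
  have hκ0 : 0 < κ := by positivity
  refine ⟨C * κ + (Λ + Λ ^ 3) * (2 * Λ * (C * κ) + 4), by positivity, ?_⟩
  intro h hq hp X S Sp B G y m D hy hym hstep L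
  have hT := L.leibnizSum_nonneg hp₀
  set E := y m + leibnizSum y m with hE
  have hE0 : 0 < E := by positivity
  have hC1 : C * (κ * E) ≤ y (m + 1) := by
    refine le_trans ?_ hstep
    have : 0 ≤ (Λ + Λ ^ 3) * (2 * Λ * (C * κ) + 4) * E := by positivity
    linarith
  have hC2 : (Λ + Λ ^ 3) * (2 * (Λ * (C * (κ * E))) + 4 * leibnizSum y m) ≤ y (m + 1) := by
    refine le_trans ?_ hstep
    have h1 : leibnizSum y m ≤ E := by linarith
    have h2 : (Λ + Λ ^ 3) * (4 * leibnizSum y m) ≤ (Λ + Λ ^ 3) * (4 * E) := by gcongr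
    have h3 : 0 ≤ C * κ * E := by positivity
    linarith
  -- uniform bounds for the difference quotients
  have hbd : ∀ ε ≠ 0, HolderBdd α (Obar p₀) (C * (κ * E))
        (fun x => (⟨dq ε (qIter m X) x, dq ε (qIter m hq) x⟩ : ℂ)) ∧
      HolderBdd α (Obar p₀) (C * (κ * E))
        (fun x => (⟨dq ε (qIter m Sp) x, dq ε (qIter m hp) x⟩ : ℂ)) := by
    intro ε hε
    have hd : ∀ f, QReg p₀ α y m f → HolderBdd α (Obar p₀) (|ε⁻¹| * (y m + y m))
      (dq ε (qIter m f)) := fun f hf => (hf.holder m le_rfl).dq_of_ne_zero ε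
    refine hsch _ _ _ _ _ _ _ _ _ (by positivity) (L.linSol hp₀ hg hΛ D hy hε) (K := ?_) ?_
    · exact |ε⁻¹| * (y m + y m) + |ε⁻¹| * (y m + y m) +
        (|ε⁻¹| * (y m + y m) + |ε⁻¹| * (y m + y m))
    · intro x hx z hz
      rw [add_mul]
      exact add_le_add (((hd X L.X_reg).mk_complex (hd hq L.hq_reg)).2 x hx z hz)
        (((hd Sp L.Sp_reg).mk_complex (hd hp L.hp_reg)).2 x hx z hz)
  have bX : ∀ ε ≠ 0, HolderBdd α (Obar p₀) (y (m + 1)) (dq ε (qIter m X)) := fun ε hε =>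
    (hbd ε hε).1.re.mono hC1
  have bhq : ∀ ε ≠ 0, HolderBdd α (Obar p₀) (y (m + 1)) (dq ε (qIter m hq)) := fun ε hε =>
    (hbd ε hε).1.im.mono hC1
  have bSp : ∀ ε ≠ 0, HolderBdd α (Obar p₀) (y (m + 1)) (dq ε (qIter m Sp)) := fun ε hε =>
    (hbd ε hε).2.re.mono hC1
  have bhp : ∀ ε ≠ 0, HolderBdd α (Obar p₀) (y (m + 1)) (dq ε (qIter m hp)) := fun ε hε =>
    (hbd ε hε).2.im.mono hC1
  have bB : ∀ ε ≠ 0, HolderBdd α (Obar p₀) (y (m + 1)) (dq ε (qIter m B)) := by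
    intro ε hε
    refine HolderBdd.mono ?_ hC2
    refine HolderBdd.of_mul_eq hΛ (D.hp_holder.av ε) (le_av D.hp_lower ε)
      (((D.B_holder.av ε).mul (hbd ε hε).2.im).neg.add
        (leibnizRem_holder L.B_reg L.hp_reg hε).neg |>.mono (le_of_eq (by ring))) fun x hx => ?_
    dsimp only
    linarith [L.dq_B D ε hx]
  have bSq : ∀ ε ≠ 0, HolderBdd α (Obar p₀) (y (m + 1))
      (dq ε (qIter m (fun x => G x.2 + X x))) := fun ε hε => (bX ε hε).congr fun x _ =>
    (dq_qIter_of_eq_const_add (F := fun x => G x.2 + X x) (f := X) (p := x.2)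
      (a := G x.2) (fun q => rfl) ε m x.1).symm
  -- passage to the limit
  have dh := fun x (hx : x ∈ Obar p₀) => hasDeriv_of_dq_bound hp₀ hα0 (fun x hx => L.h_q D hx)
    (L.h_p m le_rfl) bhq bhp hx
  have dS := fun x (hx : x ∈ Obar p₀) => hasDeriv_of_dq_bound hp₀ hα0 (fun x hx => L.S_q D hx)
    (L.S_p m le_rfl) bSq bSp hx
  have hderiv : ∀ (f : ℝ × ℝ → ℝ) (x : ℝ × ℝ),
      deriv (fun q => qIter m f (q, x.2)) x.1 = qIter (m + 1) f x := fun f x => by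
    rw [qIter, iteratedDeriv_succ]; rfl
  have rhp := L.hp_reg.succ hα0 (fun x hx => (dh x hx).2.1) bhp
  refine ⟨L.hq_reg.succ hα0 (fun x hx => (dh x hx).1) bhq, rhp,
    L.X_reg.succ hα0 (fun x hx => ?_) bX, L.Sp_reg.succ hα0 (fun x hx => (dS x hx).2.1) bSp,
    L.B_reg.succ hα0 (fun x hx => ?_) bB, fun k hk x hx => ?_, fun k hk x hx => ?_⟩
  · obtain ⟨a, ha⟩ := qIter_of_eq_const_add (F := fun x => G x.2 + X x) (f := X) (p := x.2)
      (a := G x.2) (fun q => rfl) m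
    refine ((dS x hx).1.sub_const a).congr_of_eventuallyEq (Filter.Eventually.of_forall fun q => ?_)
    simp only [ha]; ring
  · have hx' := mem_Obar.1 hx
    have e : (fun q => B (q, x.2)) = fun q => (hp (q, x.2))⁻¹ := funext fun q =>
      eq_inv_of_mul_eq_one_left (D.B_mul (q, x.2) hx)
    have hB : ContDiff ℝ (m + 1 : ℕ) (fun q => B (q, x.2)) := by
      rw [e]
      exact (rhp.smooth _ hx').inv fun q =>
        ((inv_pos.2 hΛ).trans_le (D.hp_lower (q, x.2) hx)).ne'
    exact (hasDerivAt_qIter hB (Nat.lt_succ_self m)).differentiableAt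
  · rcases Nat.le_succ_iff.1 hk with hk | rfl
    · exact L.h_p k hk x hx
    · have h1 := (dh x hx).2.2
      rw [hderiv] at h1
      exact h1.congr (fun p hp => qIter_succ_of_hasDerivAt D.h_q (mem_Obar.2 hp))
        (qIter_succ_of_hasDerivAt D.h_q hx)
  · rcases Nat.le_succ_iff.1 hk with hk | rfl
    · exact L.S_p k hk x hx
    · have h1 := (dS x hx).2.2
      rw [hderiv] at h1
      exact h1.congr (fun p hp => qIter_succ_of_hasDerivAt D.S_q (mem_Obar.2 hp))
        (qIter_succ_of_hasDerivAt D.S_q hx)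

end Bootstrap

section Majorant

theorem sum_one_div_succ_sq_le (n : ℕ) :
    ∑ i ∈ Finset.range n, (1 : ℝ) / ((i : ℝ) + 1) ^ 2 ≤ 2 := by
  suffices ∀ n : ℕ, ∑ i ∈ Finset.range (n + 1), (1 : ℝ) / ((i : ℝ) + 1) ^ 2 ≤
      2 - 1 / ((n : ℝ) + 1) by
    refine (Finset.sum_le_sum_of_subset_of_nonneg (Finset.range_mono n.le_succ)
      fun i _ _ => by positivity).trans ((this n).trans ?_)
    have : (0 : ℝ) ≤ 1 / ((n : ℝ) + 1) := by positivity
    linarith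
  intro n
  induction n with
  | zero => norm_num
  | succ n ih =>
    rw [Finset.sum_range_succ]
    have h1 : (1 : ℝ) / ((n : ℝ) + 1 + 1) ^ 2 ≤ 1 / ((n : ℝ) + 1) - 1 / ((n : ℝ) + 1 + 1) := by
      rw [div_sub_div _ _ (by positivity) (by positivity),
        div_le_div_iff₀ (by positivity) (by positivity)]
      have : (0 : ℝ) ≤ n := Nat.cast_nonneg n
      nlinarith
    push_cast
    linarith

theorem sum_one_div_mul_sq_le (n : ℕ) :
    ∑ j ∈ Finset.range (n + 1), (1 : ℝ) / (((j : ℝ) + 1) * (((n - j : ℕ) : ℝ) + 1) ^ 2) ≤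
      4 / ((n : ℝ) + 2) := by
  rw [le_div_iff₀ (by positivity), Finset.sum_mul]
  have h1 : ∀ j ∈ Finset.range (n + 1),
      (1 : ℝ) / (((j : ℝ) + 1) * (((n - j : ℕ) : ℝ) + 1) ^ 2) * ((n : ℝ) + 2) ≤
      1 / 2 * (1 / ((j : ℝ) + 1) ^ 2) + 3 / 2 * (1 / (((n - j : ℕ) : ℝ) + 1) ^ 2) := by
    intro j hj
    have hj' : j ≤ n := Nat.lt_succ_iff.1 (Finset.mem_range.1 hj)
    have e : (n : ℝ) + 2 = ((j : ℝ) + 1) + (((n - j : ℕ) : ℝ) + 1) := by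
      rw [Nat.cast_sub hj']; ring
    rw [e]
    have ha : (0 : ℝ) < (j : ℝ) + 1 := by positivity
    have hb : (0 : ℝ) < ((n - j : ℕ) : ℝ) + 1 := by positivity
    generalize (j : ℝ) + 1 = a at *
    generalize ((n - j : ℕ) : ℝ) + 1 = b at *
    have e2 : 1 / (a * b ^ 2) * (a + b) = (1 / b) ^ 2 + 1 / a * (1 / b) := by
      field_simp
    rw [e2, ← one_div_pow, ← one_div_pow]
    nlinarith [sq_nonneg (1 / a - 1 / b)]
  refine (Finset.sum_le_sum h1).trans ?_
  rw [Finset.sum_add_distrib, ← Finset.mul_sum, ← Finset.mul_sum]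
  have h2 := Finset.sum_range_reflect (fun j : ℕ => (1 : ℝ) / ((j : ℝ) + 1) ^ 2) (n + 1)
  have h3 := sum_one_div_succ_sq_le (n + 1)
  simp only [Nat.add_sub_cancel] at h2
  rw [h2]
  linarith

/-- A solution of the recursive inequality with factorial growth. -/
theorem exists_majorant {C Λ : ℝ} (hC : 0 < C) (hΛ : 0 < Λ) :
    ∃ (y : ℕ → ℝ) (A K : ℝ), 0 < A ∧ 1 ≤ K ∧ Λ ≤ y 0 ∧ (∀ m, 0 < y m) ∧
      (∀ m, C * (y m + leibnizSum y m) ≤ y (m + 1)) ∧ ∀ m, y m ≤ A * K ^ m * m.factorial := by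
  set A := C * Λ with hA
  have hA0 : 0 < A := mul_pos hC hΛ
  set K := C * (2 + 4 * A) + 1 with hK
  have hK0 : 0 < C * (2 + 4 * A) := by positivity
  have hK1 : 1 ≤ K := by linarith
  have hKp : 0 < K := by linarith
  obtain ⟨y, hy0, hys⟩ : ∃ y : ℕ → ℝ, y 0 = Λ ∧
      ∀ k : ℕ, y (k + 1) = A * K ^ k * k.factorial / ((k : ℝ) + 1) :=
    ⟨fun m => Nat.casesOn m Λ (fun k => A * K ^ k * k.factorial / ((k : ℝ) + 1)), rfl, fun _ => rfl⟩
  refine ⟨y, A + Λ, K, by positivity, hK1, hy0.ge, fun m => ?_, fun m => ?_, fun m => ?_⟩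
  · cases m with
    | zero => rwa [hy0]
    | succ k => rw [hys]; positivity
  · cases m with
    | zero => simp [leibnizSum, hys, hy0, hA]
    | succ n =>
      have h1 : leibnizSum y (n + 1) = A ^ 2 * K ^ n * (n + 1).factorial *
          ∑ j ∈ Finset.range (n + 1), (1 : ℝ) / (((j : ℝ) + 1) * (((n - j : ℕ) : ℝ) + 1) ^ 2) := by
        rw [leibnizSum, Finset.mul_sum]
        refine Finset.sum_congr rfl fun j hj => ?_
        have hj' : j ≤ n := Nat.lt_succ_iff.1 (Finset.mem_range.1 hj)
        obtain ⟨i, rfl⟩ := Nat.exists_eq_add_of_le hj'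
        have e1 : j + i + 1 - j = i + 1 := by omega
        have e2 : j + i - j = i := by omega
        have e3 : ((j + i + 1).choose j : ℝ) * j.factorial * (i + 1).factorial =
            (j + i + 1).factorial := by
          have := Nat.choose_mul_factorial_mul_factorial (n := j + i + 1) (k := j) (by omega)
          rw [e1] at this
          exact_mod_cast this
        rw [e1, e2, hys, hys, ← e3, Nat.factorial_succ i]
        push_cast
        field_simp
        ring
      have h2 := sum_one_div_mul_sq_le n
      have h3 : y (n + 1) ≤ 2 * (A * K ^ n * (n + 1).factorial / ((n : ℝ) + 2)) := by
        rw [hys, Nat.factorial_succ, ← mul_div_assoc,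
          div_le_div_iff₀ (by positivity) (by positivity)]
        push_cast
        have h0 : (0 : ℝ) ≤ n := Nat.cast_nonneg n
        have h4 : (0 : ℝ) ≤ A * K ^ n * n.factorial := by positivity
        have h5 : (n : ℝ) + 2 ≤ 2 * ((n + 1) * (n + 1)) := by nlinarith
        calc A * K ^ n * n.factorial * ((n : ℝ) + 2)
            ≤ A * K ^ n * n.factorial * (2 * ((n + 1) * (n + 1))) :=
              mul_le_mul_of_nonneg_left h5 h4
          _ = _ := by ring
      have h4 : leibnizSum y (n + 1) ≤ A ^ 2 * K ^ n * (n + 1).factorial * (4 / ((n : ℝ) + 2)) := by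
        rw [h1]
        exact mul_le_mul_of_nonneg_left h2 (by positivity)
      have h5 : y (n + 1 + 1) = K * (A * K ^ n * (n + 1).factorial / ((n : ℝ) + 2)) := by
        rw [hys, pow_succ]; push_cast; ring
      rw [h5]
      have h6 : 0 ≤ A * K ^ n * (n + 1).factorial / ((n : ℝ) + 2) := by positivity
      calc C * (y (n + 1) + leibnizSum y (n + 1))
          ≤ C * (2 * (A * K ^ n * (n + 1).factorial / ((n : ℝ) + 2)) +
            A ^ 2 * K ^ n * (n + 1).factorial * (4 / ((n : ℝ) + 2))) :=
            mul_le_mul_of_nonneg_left (add_le_add h3 h4) hC.le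
        _ = C * (2 + 4 * A) * (A * K ^ n * (n + 1).factorial / ((n : ℝ) + 2)) := by ring
        _ ≤ _ := mul_le_mul_of_nonneg_right (by linarith) h6
  · cases m with
    | zero => simp [hy0, hA0.le]
    | succ k =>
      rw [hys, div_le_iff₀ (by positivity), Nat.factorial_succ, pow_succ]
      push_cast
      have h0 : (0 : ℝ) ≤ k := Nat.cast_nonneg k
      have h1 : (0 : ℝ) < A * K ^ k * k.factorial := by positivity
      have h2 : 1 ≤ K * ((k + 1) * ((k : ℝ) + 1)) :=
        one_le_mul_of_one_le_of_one_le hK1 (by nlinarith)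
      have h3 : (0 : ℝ) ≤ Λ * K ^ k * k.factorial * (K * ((k + 1) * ((k : ℝ) + 1))) := by positivity
      calc A * K ^ k * k.factorial ≤ A * K ^ k * k.factorial * (K * ((k + 1) * ((k : ℝ) + 1))) :=
            le_mul_of_one_le_right h1.le h2
        _ ≤ A * K ^ k * k.factorial * (K * ((k + 1) * ((k : ℝ) + 1))) +
            Λ * K ^ k * k.factorial * (K * ((k + 1) * ((k : ℝ) + 1))) := by linarith
        _ = _ := by ring

/-- A factorial bound absorbs into the form `L ^ (m - 2) * (m - 3)!`. -/
theorem exists_pow_factorial_bound {A K : ℝ} (hA : 0 < A) (hK : 1 ≤ K) :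
    ∃ L : ℝ, 1 < L ∧ ∀ m : ℕ, 3 ≤ m →
      A * K ^ m * m.factorial ≤ L ^ (m - 2) * (m - 3).factorial := by
  have hfac : ∀ n : ℕ, (n + 3).factorial ≤ 6 * 4 ^ n * n.factorial := by
    intro n
    induction n with
    | zero => decide
    | succ n ih =>
      rw [Nat.factorial_succ n, show n + 1 + 3 = (n + 3) + 1 by ring, Nat.factorial_succ (n + 3),
        pow_succ]
      calc (n + 3 + 1) * (n + 3).factorial
          ≤ (4 * (n + 1)) * (6 * 4 ^ n * n.factorial) := Nat.mul_le_mul (by omega) ih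
        _ = _ := by ring
  refine ⟨(A + 1) * K ^ 3 * 6 * 4, ?_, fun m hm => ?_⟩
  · have : 1 ≤ K ^ 3 := one_le_pow₀ hK
    nlinarith
  · obtain ⟨n, rfl⟩ := Nat.exists_eq_add_of_le' hm
    have e1 : n + 3 - 2 = n + 1 := by omega
    have e2 : n + 3 - 3 = n := by omega
    rw [e1, e2]
    have h1 : ((n + 3).factorial : ℝ) ≤ 6 * 4 ^ n * n.factorial := by exact_mod_cast hfac n
    have hK0 : 0 < K := by linarith
    have h2 : A ≤ (A + 1) ^ (n + 1) := by
      have := le_self_pow₀ (a := A + 1) (by linarith) (Nat.succ_ne_zero n)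
      simp only [Nat.succ_eq_add_one] at this
      linarith
    have h3 : K ^ (n + 3) ≤ (K ^ 3) ^ (n + 1) := by
      rw [← pow_mul]; exact pow_le_pow_right₀ hK (by omega)
    have h4 : (6 : ℝ) ≤ 6 ^ (n + 1) := le_self_pow₀ (by norm_num) (Nat.succ_ne_zero n)
    have h5 : (4 : ℝ) ^ n ≤ 4 ^ (n + 1) := pow_le_pow_right₀ (by norm_num) (by omega)
    calc A * K ^ (n + 3) * (n + 3).factorial
        ≤ (A + 1) ^ (n + 1) * (K ^ 3) ^ (n + 1) * (6 ^ (n + 1) * 4 ^ (n + 1) * n.factorial) := by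
          refine mul_le_mul (mul_le_mul h2 h3 (by positivity) (by positivity))
            (h1.trans ?_) (by positivity) (by positivity)
          gcongr
      _ = _ := by rw [mul_pow, mul_pow, mul_pow]; ring

end Majorant

section Translation

open Topology

variable {p₀ α : ℝ}

theorem uniqueDiffOn_Obar (hp₀ : p₀ < 0) : UniqueDiffOn ℝ (Obar p₀) :=
  uniqueDiffOn_univ.prod (uniqueDiffOn_Icc hp₀)

theorem contDiffOn_one_of_partials (hp₀ : p₀ < 0) (hα : 0 < α) {N : ℝ} {V Vq Vp : ℝ × ℝ → ℝ}
    (hq : ∀ x ∈ Obar p₀, HasDerivAt (fun q => V (q, x.2)) (Vq x) x.1)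
    (hp : ∀ x ∈ Obar p₀, HasDerivWithinAt (fun p => V (x.1, p)) (Vp x) (Set.Icc p₀ 0) x.2)
    (hVq : HolderBdd α (Obar p₀) N Vq) (hVp : HolderBdd α (Obar p₀) N Vp) :
    ContDiffOn ℝ 1 V (Obar p₀) := by
  have h0 : (0 : ℝ × ℝ) ∈ Obar p₀ := mem_Obar.2 ⟨hp₀.le, le_rfl⟩
  have key := (contDiffOn_succ_iff_hasFDerivWithinAt_of_uniqueDiffOn (𝕜 := ℝ) (n := 0) (f := V)
    (uniqueDiffOn_Obar hp₀)).2
  rw [zero_add] at key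
  refine key ⟨fun h => by simp at h, fun x => Vq x • ContinuousLinearMap.fst ℝ ℝ ℝ +
    Vp x • ContinuousLinearMap.snd ℝ ℝ ℝ, contDiffOn_zero.2 ?_, fun x hx => ?_⟩
  · exact ((hVq.continuousOn hα).smul continuousOn_const).add
      ((hVp.continuousOn hα).smul continuousOn_const)
  · refine hasFDerivWithinAt_of_rpow_bound (C := 2 * N) hα fun y hy => ?_
    have := norm_sub_sub_smul_le_of_partials hα (hVq.nonneg h0) hq hp hVq.2 hVp.2 hx hy
    simpa [mul_comm] using this

theorem pd_q_eq {V Vq : ℝ × ℝ → ℝ} {x : ℝ × ℝ}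
    (hq : HasDerivAt (fun q => V (q, x.2)) (Vq x) x.1) : pd_q V x = Vq x :=
  hq.deriv

theorem pd_p_eq (hp₀ : p₀ < 0) {V Vp : ℝ × ℝ → ℝ} {x : ℝ × ℝ} (hx : x ∈ Obar p₀)
    (hp : HasDerivWithinAt (fun p => V (x.1, p)) (Vp x) (Set.Icc p₀ 0) x.2) :
    pd_p p₀ V x = Vp x :=
  hp.derivWithin (uniqueDiffOn_Icc hp₀ _ (mem_Obar.1 hx))

theorem HolderBdd.memCα {s : Set (ℝ × ℝ)} {N : ℝ} {f : ℝ × ℝ → ℝ} (hf : HolderBdd α s N f) :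
    MemCα α s f :=
  ⟨⟨N, hf.1⟩, ⟨N, hf.2⟩⟩

theorem MemCα.exists_holderBdd {s : Set (ℝ × ℝ)} {f : ℝ × ℝ → ℝ} (hf : MemCα α s f) :
    ∃ N, HolderBdd α s N f := by
  obtain ⟨⟨M, hM⟩, C, hC⟩ := hf
  refine ⟨max M C, fun x hx => (hM x hx).trans (le_max_left _ _), fun x hx y hy =>
    (hC x hx y hy).trans (mul_le_mul_of_nonneg_right (le_max_right _ _) ?_)⟩
  exact Real.rpow_nonneg dist_nonneg _

theorem supNorm_le {s : Set (ℝ × ℝ)} {N : ℝ} {f : ℝ × ℝ → ℝ} (hN : 0 ≤ N)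
    (hf : HolderBdd α s N f) : supNorm s f ≤ N := by
  refine Real.sSup_le ?_ hN
  rintro _ ⟨x, hx, rfl⟩
  exact hf.1 x hx

theorem holderSemi_le {s : Set (ℝ × ℝ)} {N : ℝ} {f : ℝ × ℝ → ℝ} (hN : 0 ≤ N)
    (hf : HolderBdd α s N f) : holderSemi α s f ≤ N := by
  refine Real.sSup_le ?_ hN
  rintro _ ⟨x, hx, y, hy, hxy, rfl⟩
  exact (div_le_iff₀ (Real.rpow_pos_of_pos (dist_pos.2 hxy) _)).2 (hf.2 x hx y hy)

theorem memC1α_and_norm1α_le (hp₀ : p₀ < 0) (hα : 0 < α) {N₀ N₁ : ℝ} {V Vq Vp : ℝ × ℝ → ℝ}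
    (hq : ∀ x ∈ Obar p₀, HasDerivAt (fun q => V (q, x.2)) (Vq x) x.1)
    (hp : ∀ x ∈ Obar p₀, HasDerivWithinAt (fun p => V (x.1, p)) (Vp x) (Set.Icc p₀ 0) x.2)
    (hV : HolderBdd α (Obar p₀) N₀ V) (hVq : HolderBdd α (Obar p₀) N₁ Vq)
    (hVp : HolderBdd α (Obar p₀) N₁ Vp) :
    MemC1α p₀ α V ∧ norm1α p₀ α V ≤ 2 * N₀ + 4 * N₁ := by
  have h0 : (0 : ℝ × ℝ) ∈ Obar p₀ := mem_Obar.2 ⟨hp₀.le, le_rfl⟩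
  have hN₀ := hV.nonneg h0
  have hN₁ := hVq.nonneg h0
  have hVq' : HolderBdd α (Obar p₀) N₁ (pd_q V) :=
    hVq.congr fun x hx => (pd_q_eq (hq x hx)).symm
  have hVp' : HolderBdd α (Obar p₀) N₁ (pd_p p₀ V) :=
    hVp.congr fun x hx => (pd_p_eq hp₀ hx (hp x hx)).symm
  refine ⟨⟨contDiffOn_one_of_partials hp₀ hα hq hp hVq hVp, hV.memCα, hVq'.memCα, hVp'.memCα⟩, ?_⟩
  have h1 := supNorm_le hN₀ hV
  have h2 := supNorm_le hN₁ hVq'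
  have h3 := supNorm_le hN₁ hVp'
  have h4 := holderSemi_le hN₀ hV
  have h5 := holderSemi_le hN₁ hVq'
  have h6 := holderSemi_le hN₁ hVp'
  rw [norm1α]
  linarith

theorem FlowData.memC1α_pd_q_iter {g Q Λ : ℝ} {h hq hp X S Sp B : ℝ × ℝ → ℝ} {G : ℝ → ℝ}
    {y : ℕ → ℝ} (D : FlowData p₀ α g Q Λ h hq hp X S Sp B G) (hp₀ : p₀ < 0) (hα : 0 < α)
    (L : ∀ m, FlowReg p₀ α h hq hp X S Sp B y m) (m : ℕ) :
    MemC1α p₀ α (pd_q_iter (m + 1) h) ∧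
      norm1α p₀ α (pd_q_iter (m + 1) h) ≤ 2 * y m + 4 * y (m + 1) := by
  rw [pd_q_iter_eq_qIter]
  refine memC1α_and_norm1α_le hp₀ hα (fun x hx => (L (m + 1)).h_q D hx)
    ((L (m + 1)).h_p (m + 1) le_rfl) ?_ ((L (m + 1)).hq_reg.holder _ le_rfl)
    ((L (m + 1)).hp_reg.holder _ le_rfl)
  exact ((L m).hq_reg.holder m le_rfl).congr fun x hx =>
    (qIter_succ_of_hasDerivAt D.h_q hx).symm

end Translation

section WeakSolution

open Topology

variable {p₀ g Q α : ℝ} {γ : ℝ → ℝ} {h : ℝ × ℝ → ℝ}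

theorem hasDerivAt_pd_q (hh : ContDiffOn ℝ 1 h (Obar p₀)) {x : ℝ × ℝ}
    (hx : x ∈ Obar p₀) : HasDerivAt (fun q => h (q, x.2)) (pd_q h x) x.1 := by
  have h1 := (hh.differentiableOn one_ne_zero) x hx
  have h2 : DifferentiableWithinAt ℝ (fun q : ℝ => h (q, x.2)) Set.univ x.1 :=
    DifferentiableWithinAt.comp (t := Obar p₀) x.1 h1 (by fun_prop) fun q _ =>
      mem_Obar.2 (mem_Obar.1 hx)
  exact (differentiableWithinAt_univ.1 h2).hasDerivAt

theorem hasDerivWithinAt_pd_p (hh : ContDiffOn ℝ 1 h (Obar p₀)) {x : ℝ × ℝ}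
    (hx : x ∈ Obar p₀) :
    HasDerivWithinAt (fun p => h (x.1, p)) (pd_p p₀ h x) (Set.Icc p₀ 0) x.2 := by
  have h1 := (hh.differentiableOn one_ne_zero) x hx
  have h2 : DifferentiableWithinAt ℝ (fun p : ℝ => h (x.1, p)) (Set.Icc p₀ 0) x.2 :=
    DifferentiableWithinAt.comp (t := Obar p₀) x.2 h1 (by fun_prop) fun p hp => mem_Obar.2 hp
  exact h2.hasDerivWithinAt

theorem closure_Oset (hp₀ : p₀ < 0) : closure (Oset p₀) = Obar p₀ := by
  rw [Oset, closure_prod_eq, closure_univ, closure_Ioo hp₀.ne, Obar]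

theorem isTest_mul {θ χ : ℝ → ℝ} (hθ : ContDiff ℝ 1 θ) (hθc : HasCompactSupport θ)
    (hχ : ContDiff ℝ 1 χ) (hχc : HasCompactSupport χ) (hχs : tsupport χ ⊆ Set.Ioo p₀ 0) :
    IsTest p₀ fun x => θ x.1 * χ x.2 := by
  have hs : tsupport (fun x : ℝ × ℝ => θ x.1 * χ x.2) ⊆ tsupport θ ×ˢ tsupport χ := by
    refine closure_minimal (fun x hx => ?_) ((isClosed_tsupport θ).prod (isClosed_tsupport χ))
    have hx' : θ x.1 * χ x.2 ≠ 0 := hx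
    exact ⟨subset_tsupport _ (left_ne_zero_of_mul hx'),
      subset_tsupport _ (right_ne_zero_of_mul hx')⟩
  exact ⟨(hθ.comp contDiff_fst).mul (hχ.comp contDiff_snd),
    (hθc.isCompact.prod hχc.isCompact).of_isClosed_subset (isClosed_tsupport _) hs,
    hs.trans (Set.prod_mono (Set.subset_univ _) hχs)⟩

/-- The weak formulation tested against products, for continuous extensions of the fields. -/
theorem IsWeakSolution.integral_mul_eq_zero (hp₀ : p₀ < 0)
    (hsol : IsWeakSolution p₀ g Q α γ h) {Φ₁ Φ₂ : ℝ × ℝ → ℝ} (h₁ : Continuous Φ₁)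
    (h₂ : Continuous Φ₂) (e₁ : ∀ x ∈ Oset p₀, Φ₁ x = pd_q h x / pd_p p₀ h x)
    (e₂ : ∀ x ∈ Oset p₀, Φ₂ x =
      (∫ s in (0 : ℝ)..x.2, γ s) + (1 + (pd_q h x) ^ 2) / (2 * (pd_p p₀ h x) ^ 2))
    {θ χ : ℝ → ℝ} (hθ : ContDiff ℝ 1 θ) (hθc : HasCompactSupport θ)
    (hχ : ContDiff ℝ 1 χ) (hχc : HasCompactSupport χ) (hχs : tsupport χ ⊆ Set.Ioo p₀ 0) :
    ∫ q, ∫ p in p₀..0, (Φ₁ (q, p) * (deriv θ q * χ p) - Φ₂ (q, p) * (θ q * deriv χ p)) = 0 := by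
  have hθ' : Continuous (deriv θ) := hθ.continuous_deriv le_rfl
  have hχ' : Continuous (deriv χ) := hχ.continuous_deriv le_rfl
  have hθ0 := hθ.continuous
  have hχ0 := hχ.continuous
  set F : ℝ × ℝ → ℝ := fun x =>
    Φ₁ x * (deriv θ x.1 * χ x.2) - Φ₂ x * (θ x.1 * deriv χ x.2) with hF
  have hFc : Continuous F := by fun_prop
  have hFs : HasCompactSupport F := by
    refine HasCompactSupport.of_support_subset_isCompact
      (hθc.isCompact.prod hχc.isCompact) fun x hx => ?_
    have hx' : F x ≠ 0 := hx
    by_contra hn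
    apply hx'
    rw [Set.mem_prod, not_and_or] at hn
    rcases hn with hn | hn
    · have a : deriv θ x.1 = 0 := by_contra fun hc => hn (support_deriv_subset hc)
      simp [hF, a, image_eq_zero_of_notMem_tsupport hn]
    · have a : deriv χ x.2 = 0 := by_contra fun hc => hn (support_deriv_subset hc)
      simp [hF, a, image_eq_zero_of_notMem_tsupport hn]
  have hw := hsol.weak _ (isTest_mul hθ hθc hχ hχc hχs)
  have hm : MeasurableSet (Oset p₀) := MeasurableSet.univ.prod measurableSet_Ioo
  have e : ∫ x in Oset p₀, F x = 0 := by
    rw [← hw]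
    refine setIntegral_congr_fun hm fun x hx => ?_
    have d1 : pd_q (fun x : ℝ × ℝ => θ x.1 * χ x.2) x = deriv θ x.1 * χ x.2 := by
      simp [pd_q]
    have d2 : pd_p p₀ (fun x : ℝ × ℝ => θ x.1 * χ x.2) x = θ x.1 * deriv χ x.2 :=
      (((hχ.differentiable one_ne_zero) x.2).hasDerivAt.const_mul
        (θ x.1)).hasDerivWithinAt.derivWithin
        (uniqueDiffOn_Icc hp₀ _ (Set.Ioo_subset_Icc_self hx.2))
    simp only [hF, d1, d2, e₁ x hx, e₂ x hx]
  rw [Oset, Measure.volume_eq_prod, setIntegral_prod _ (by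
    rw [← Measure.volume_eq_prod]
    exact (hFc.integrable_of_hasCompactSupport hFs).integrableOn), setIntegral_univ] at e
  refine Eq.trans ?_ e
  refine integral_congr_ae (Filter.Eventually.of_forall fun q => ?_)
  simp only
  rw [intervalIntegral.integral_of_le hp₀.le, integral_Ioc_eq_integral_Ioo]

/-- The projection of the plane onto the strip `Ω̄`. -/
def stripProj (p₀ : ℝ) (x : ℝ × ℝ) : ℝ × ℝ := (x.1, max p₀ (min x.2 0))

theorem stripProj_mem (hp₀ : p₀ < 0) (x : ℝ × ℝ) : stripProj p₀ x ∈ Obar p₀ :=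
  mem_Obar.2 ⟨le_max_left _ _, max_le hp₀.le (min_le_right _ _)⟩

theorem stripProj_of_mem {x : ℝ × ℝ} (hx : x ∈ Obar p₀) : stripProj p₀ x = x := by
  have hx' := mem_Obar.1 hx
  rw [stripProj, min_eq_left hx'.2, max_eq_right hx'.1]

theorem ContinuousOn.comp_stripProj (hp₀ : p₀ < 0) {f : ℝ × ℝ → ℝ}
    (hf : ContinuousOn f (Obar p₀)) : Continuous fun x => f (stripProj p₀ x) :=
  hf.comp_continuous (by unfold stripProj; fun_prop) (stripProj_mem hp₀)

theorem continuousOn_primitive_Icc (hp₀ : p₀ < 0) (hγ : IntegrableOn γ (Set.Ioo p₀ 0)) :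
    ContinuousOn (fun p => ∫ s in (0 : ℝ)..p, γ s) (Set.Icc p₀ 0) := by
  have h1 : IntervalIntegrable γ volume p₀ 0 :=
    (intervalIntegrable_iff_integrableOn_Ioo_of_le hp₀.le).2 hγ
  have := intervalIntegral.continuousOn_primitive_interval' h1 Set.right_mem_uIcc
  rwa [Set.uIcc_of_le hp₀.le] at this

theorem IsWeakSolution.exists_flowData (hp₀ : p₀ < 0) (hα : 0 < α)
    (hγ : IntegrableOn γ (Set.Ioo p₀ 0)) (hsol : IsWeakSolution p₀ g Q α γ h) :
    ∃ Λ > 0, ∃ X S Sp B G, FlowData p₀ α g Q Λ h (pd_q h) (pd_p p₀ h) X S Sp B G := by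
  have h0 : (0 : ℝ × ℝ) ∈ Obar p₀ := mem_Obar.2 ⟨hp₀.le, le_rfl⟩
  obtain ⟨hC1, -, hqα, hpα⟩ := hsol.reg
  obtain ⟨N₁, hN₁⟩ := hqα.exists_holderBdd
  obtain ⟨N₂, hN₂⟩ := hpα.exists_holderBdd
  obtain ⟨δ, hδ, hδp⟩ := hsol.infpos
  have hlow : ∀ x ∈ Obar p₀, δ ≤ pd_p p₀ h x := by
    rw [← closure_Oset hp₀]
    refine fun x hx => le_on_closure hδp continuousOn_const ?_ hx
    rw [closure_Oset hp₀]
    exact hN₂.continuousOn hα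
  have hpos : ∀ x ∈ Obar p₀, 0 < pd_p p₀ h x := fun x hx => hδ.trans_le (hlow x hx)
  have hN₂0 : 0 < N₂ := (hpos 0 h0).trans_le ((le_abs_self _).trans (hN₂.1 0 h0))
  set B : ℝ × ℝ → ℝ := fun x => (pd_p p₀ h x)⁻¹ with hB
  set Sp : ℝ × ℝ → ℝ := fun x => pd_q h x * B x with hSp
  set X : ℝ × ℝ → ℝ := fun x => 1 / 2 * (B x * B x + Sp x * Sp x) with hX
  set G : ℝ → ℝ := fun p => ∫ s in (0 : ℝ)..p, γ s with hG
  obtain ⟨N₃, hN₃⟩ : ∃ N, HolderBdd α (Obar p₀) N B := by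
    have h1 : HolderBdd α (Obar p₀) 1 (fun _ => (1 : ℝ)) :=
      ⟨fun _ _ => by simp, fun x _ y _ => by simpa using Real.rpow_nonneg dist_nonneg α⟩
    refine ⟨_, (hN₂.mono (le_max_left N₂ δ⁻¹)).of_mul_eq (hN₂0.trans_le (le_max_left _ _))
      (fun x hx => le_trans ?_ (hlow x hx)) h1 fun x hx => mul_inv_cancel₀ (hpos x hx).ne'⟩
    exact inv_le_of_inv_le₀ hδ (le_max_right _ _)
  obtain ⟨N₄, hN₄⟩ : ∃ N, HolderBdd α (Obar p₀) N Sp := ⟨_, hN₁.mul hN₃⟩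
  obtain ⟨N₅, hN₅⟩ : ∃ N, HolderBdd α (Obar p₀) N X :=
    ⟨_, ((hN₃.mul hN₃).add (hN₄.mul hN₄)).const_mul (1 / 2)⟩
  have hGc := continuousOn_primitive_Icc hp₀ hγ
  obtain ⟨N₆, hN₆⟩ := isCompact_Icc.exists_bound_of_continuousOn hGc
  have hGc' : ContinuousOn (fun x : ℝ × ℝ => G x.2) (Obar p₀) :=
    hGc.comp continuousOn_snd fun x hx => mem_Obar.1 hx
  have hΦ₁ := (hN₄.continuousOn hα).comp_stripProj hp₀
  have hΦ₂ := (hGc'.add (hN₅.continuousOn hα)).comp_stripProj hp₀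
  have hsub : Oset p₀ ⊆ Obar p₀ := closure_Oset hp₀ ▸ subset_closure
  obtain ⟨S, hS₁, hS₂⟩ := exists_potential hp₀ hΦ₁ hΦ₂ fun θ χ h1 h2 h3 h4 h5 =>
    hsol.integral_mul_eq_zero hp₀ hΦ₁ hΦ₂
      (fun x hx => by rw [stripProj_of_mem (hsub hx), div_eq_mul_inv])
      (fun x hx => by
        have := (hpos x (hsub hx)).ne'
        rw [stripProj_of_mem (hsub hx)]
        simp only [Pi.add_apply, hX, hSp, hB, hG]
        field_simp) h1 h2 h3 h4 h5
  obtain ⟨Λ, hΛ⟩ : ∃ Λ, ∀ a ∈ ({N₁, N₂, N₃, N₄, N₅, N₆ + N₅, δ⁻¹} : Finset ℝ), a ≤ Λ :=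
    Finset.exists_le _
  simp only [Finset.mem_insert, Finset.mem_singleton, forall_eq_or_imp, forall_eq] at hΛ
  obtain ⟨i1, i2, i3, i4, i5, i6, i7⟩ := hΛ
  refine ⟨Λ, hN₂0.trans_le i2, X, S, Sp, B, G, ?_⟩
  exact
    { hq_holder := hN₁.mono i1
      hp_holder := hN₂.mono i2
      X_holder := hN₅.mono i5
      Sp_holder := hN₄.mono i4
      B_holder := hN₃.mono i3
      hp_lower := fun x hx => (inv_le_of_inv_le₀ hδ i7).trans (hlow x hx)
      B_lower := fun x hx => inv_anti₀ (hpos x hx)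
        (((le_abs_self _).trans (hN₂.1 x hx)).trans i2)
      Sq_bound := fun x hx => ((abs_add_le _ _).trans
        (add_le_add (hN₆ _ (mem_Obar.1 hx)) (hN₅.1 x hx))).trans i6
      h_q := fun x hx => hasDerivAt_pd_q hC1 hx
      h_p := fun x hx => hasDerivWithinAt_pd_p hC1 hx
      S_q := fun x hx => by
        have := hS₂ x hx
        rwa [stripProj_of_mem hx] at this
      S_p := fun x hx => by
        have := hS₁ x
        rw [stripProj_of_mem hx] at this
        exact this.hasDerivWithinAt
      Sp_mul := fun x hx => by simp [hSp, hB, (hpos x hx).ne']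
      B_mul := fun x hx => inv_mul_cancel₀ (hpos x hx).ne'
      X_eq := fun x hx => by simp only [hX]; ring
      bottom := fun q => by simp [pd_q, hsol.bottom]
      top := fun q => by
        have h1 := hsol.top q
        have h2 := (hpos (q, 0) (mem_Obar.2 ⟨hp₀.le, le_rfl⟩)).ne'
        simp only [hX, hSp, hB]
        field_simp
        linarith }

end WeakSolution

/-- If `h` is a weak solution of the gravity water-wave problem (no
periodicity in `q` assumed), then `∂_q^m h ∈ C^{1+α}(Ω̄)` for all `m ∈ ℕ`, and there is a
constant `L > 1` with `‖∂_q^m h‖_{1+α} ≤ L^(m-2) * (m-3)!` for all integers `m ≥ 3`. -/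
theorem regularity_of_weak_solutions
    (p₀ g Q α : ℝ) (hp₀ : p₀ < 0) (hg : 0 < g) (hα : α ∈ Set.Ioo (0 : ℝ) 1)
    (γ : ℝ → ℝ) (hγ : MeasureTheory.IntegrableOn γ (Set.Ioo p₀ 0))
    (h : ℝ × ℝ → ℝ) (hsol : IsWeakSolution p₀ g Q α γ h) :
    (∀ m : ℕ, MemC1α p₀ α (pd_q_iter m h)) ∧
    ∃ L : ℝ, 1 < L ∧ ∀ m : ℕ, 3 ≤ m →
      norm1α p₀ α (pd_q_iter m h) ≤ L ^ (m - 2) * (m - 3).factorial := by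
  obtain ⟨Λ, hΛ, X, S, Sp, B, G, D⟩ := hsol.exists_flowData hp₀ hα.1 hγ
  obtain ⟨C, hC, hstep⟩ := FlowReg.succ (Q := Q) hp₀ hα.1 hα.2 hg hΛ
  obtain ⟨y, A, K, hA, hK, hy0, hy, hyC, hyA⟩ := exists_majorant hC hΛ
  have L : ∀ m, FlowReg p₀ α h (pd_q h) (pd_p p₀ h) X S Sp B y m := by
    intro m
    induction m with
    | zero => exact D.reg_zero hα.1 hy0
    | succ m ih => exact hstep _ _ _ _ _ _ _ _ y m D hy0 (hy m) (hyC m) ih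
  have key := D.memC1α_pd_q_iter hp₀ hα.1 L
  refine ⟨fun m => ?_, ?_⟩
  · cases m with
    | zero => exact hsol.reg
    | succ m => exact (key m).1
  obtain ⟨M, hM, hMb⟩ := exists_pow_factorial_bound (A := 6 * A) (by positivity) hK
  refine ⟨M, hM, fun m hm => ?_⟩
  refine le_trans ?_ (hMb m hm)
  obtain ⟨k, rfl⟩ : ∃ k, m = k + 1 := ⟨m - 1, by omega⟩
  refine (key k).2.trans ?_
  have h1 : A * K ^ k * k.factorial ≤ A * K ^ (k + 1) * (k + 1).factorial := by
    have : (k.factorial : ℝ) ≤ (k + 1).factorial := by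
      exact_mod_cast Nat.factorial_le (Nat.le_succ k)
    have hKk : K ^ k ≤ K ^ (k + 1) := pow_le_pow_right₀ hK (Nat.le_succ k)
    gcongr
  linarith [hyA k, hyA (k + 1)]
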